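/- arXiv:1803.10073 — 3 statements merged into one kernel-verified Lean document; each statement's English description precedes it below -/
import Mathlib

section
/- There exists a constant c > 0 and a bijection f : ℕ+ → ℕ+ such that for all n ≥ 2, lcm(f(n), f(n+1)) ≤ c · n · (log n)². -/
theorem log_factorial_eq_sum_primesLE (n : ℕ) :
    Real.log (n.factorial : ℝ) =
      ∑ p ∈ n.primesLE, (n.factorial.factorization p : ℝ) * Real.log p := by
  rw [Real.log_nat_eq_sum_factorization]
  refine Finset.sum_subset (fun p hp => ?_) (fun p _ hp => ?_)
  · have hp' := Nat.mem_primeFactors.1 (Nat.support_factorization _ ▸ hp)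
    exact Nat.mem_primesLE.2 ⟨(hp'.1.dvd_factorial).1 hp'.2.1, hp'.1⟩
  · simp [Finsupp.notMem_support_iff.1 hp]

theorem sum_log_div_primesLE_le (n : ℕ) (hn : n ≠ 0) :
    ∑ p ∈ n.primesLE, Real.log p / p ≤ Real.log n + Real.log 4 := by
  have hn' : (0 : ℝ) < n := by positivity
  have h1 : Real.log (n.factorial : ℝ) ≤ n * Real.log n := by
    rw [← Real.log_pow]
    exact Real.log_le_log (by positivity) (by exact_mod_cast Nat.factorial_le_pow n)
  have h2 : ∑ p ∈ n.primesLE, ((n : ℝ) / p - 1) * Real.log p ≤ Real.log (n.factorial : ℝ) := by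
    rw [log_factorial_eq_sum_primesLE]
    refine Finset.sum_le_sum fun p hp => ?_
    obtain ⟨hpn, hp⟩ := Nat.mem_primesLE.1 hp
    refine mul_le_mul_of_nonneg_right ?_ (Real.log_natCast_nonneg p)
    have h3 : n / p ≤ n.factorial.factorization p := by
      rw [Nat.factorization_factorial hp (b := Nat.log p n + 1) (Nat.lt_succ_self _)]
      have h4 : 1 ∈ Finset.Ico 1 (Nat.log p n + 1) := by
        simp [Nat.log_pos hp.one_lt hpn]
      simpa using Finset.single_le_sum (f := fun i => n / p ^ i) (fun _ _ => Nat.zero_le _) h4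
    have h5 : (n : ℝ) / p < (n / p : ℕ) + 1 := by
      rw [← Nat.floor_div_eq_div (K := ℝ)]; exact Nat.lt_floor_add_one _
    have h6 : ((n / p : ℕ) : ℝ) ≤ (n.factorial.factorization p : ℝ) := by exact_mod_cast h3
    linarith
  have h3 := Chebyshev.theta_le_log4_mul_x hn'.le
  rw [Chebyshev.theta_eq_sum_primesLE_log] at h3
  have h4 : ∑ p ∈ n.primesLE, ((n : ℝ) / p - 1) * Real.log p =
      n * ∑ p ∈ n.primesLE, Real.log p / p - ∑ p ∈ n.primesLE, Real.log p := by
    rw [Finset.mul_sum, ← Finset.sum_sub_distrib]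
    exact Finset.sum_congr rfl fun p _ => by ring
  refine le_of_mul_le_mul_left ?_ hn'
  linarith

theorem exists_le_sum_log_div_primesLE :
    ∃ C : ℝ, ∀ n : ℕ, n ≠ 0 → Real.log n - C ≤ ∑ p ∈ n.primesLE, Real.log p / p := by
  have hs : Summable fun n : ℕ => 1 / (n : ℝ) ^ (3 / 2 : ℝ) :=
    Real.summable_one_div_nat_rpow.2 (by norm_num)
  refine ⟨1 + 4 * ∑' n : ℕ, 1 / (n : ℝ) ^ (3 / 2 : ℝ), fun n hn => ?_⟩
  have hn' : (0 : ℝ) < n := by positivity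
  have h1 : n * Real.log n - n ≤ Real.log (n.factorial : ℝ) := by
    have := Stirling.le_log_factorial_stirling hn
    have h2 : 0 ≤ Real.log (2 * Real.pi) := Real.log_nonneg (by nlinarith [Real.pi_gt_three])
    have := Real.log_natCast_nonneg n
    linarith
  have h2 : Real.log (n.factorial : ℝ) ≤
      ∑ p ∈ n.primesLE, n * (Real.log p / p + 4 * (1 / (p : ℝ) ^ (3 / 2 : ℝ))) := by
    rw [log_factorial_eq_sum_primesLE]
    refine Finset.sum_le_sum fun p hp => ?_
    obtain ⟨hpn, hp⟩ := Nat.mem_primesLE.1 hp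
    have hp2 : (2 : ℝ) ≤ p := by exact_mod_cast hp.two_le
    have hp0 : (0 : ℝ) < p := by linarith
    have h3 : ((p : ℝ) - 1) * (n.factorial.factorization p : ℝ) ≤ n := by
      have h4 : (p - 1) * n.factorial.factorization p ≤ n := by
        rw [Nat.sub_one_mul_factorization_factorial hp]; exact Nat.sub_le _ _
      have h5 : (((p - 1 : ℕ) : ℝ)) * (n.factorial.factorization p : ℝ) ≤ n := by exact_mod_cast h4
      rwa [Nat.cast_sub hp.one_le, Nat.cast_one] at h5
    have h4 : Real.log p ≤ (p : ℝ) ^ (1 / 2 : ℝ) / (1 / 2) :=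
      Real.log_le_rpow_div hp0.le (by norm_num)
    have h5 : (p : ℝ) ^ (3 / 2 : ℝ) * (p : ℝ) ^ (1 / 2 : ℝ) = p ^ 2 := by
      rw [← Real.rpow_add hp0, ← Real.rpow_natCast]; norm_num
    have h6 : 0 < (p : ℝ) ^ (3 / 2 : ℝ) := by positivity
    have hlog : 0 ≤ Real.log p := Real.log_natCast_nonneg p
    have h7 : Real.log p / (p - 1) ≤ Real.log p / p + 4 * (1 / (p : ℝ) ^ (3 / 2 : ℝ)) := by
      have h8 : Real.log p / (p - 1) - Real.log p / p = Real.log p / (p * (p - 1)) := by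
        field_simp [show (p : ℝ) - 1 ≠ 0 by linarith]; ring
      have h9 : Real.log p / (p * (p - 1)) ≤ 4 * (1 / (p : ℝ) ^ (3 / 2 : ℝ)) := by
        rw [mul_one_div, div_le_div_iff₀ (by nlinarith) h6]
        have : Real.log p * (p : ℝ) ^ (3 / 2 : ℝ) ≤ 2 * p ^ 2 := by
          rw [← h5]; nlinarith
        nlinarith
      linarith
    calc (n.factorial.factorization p : ℝ) * Real.log p
        ≤ n / (p - 1) * Real.log p := by
          refine mul_le_mul_of_nonneg_right ?_ hlog
          rw [le_div_iff₀ (by linarith)]; linarith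
      _ = n * (Real.log p / (p - 1)) := by ring
      _ ≤ _ := mul_le_mul_of_nonneg_left h7 hn'.le
  rw [← Finset.mul_sum, Finset.sum_add_distrib, ← Finset.mul_sum] at h2
  have h3 := hs.sum_le_tsum n.primesLE (fun _ _ => by positivity)
  have h4 := le_of_mul_le_mul_left
    ((by linarith : (n : ℝ) * (Real.log n - 1) ≤ _).trans h2) hn'
  linarith

theorem exists_forall_sum_log_div_window :
    ∃ N : ℕ, ∀ Y : ℕ, N ≤ Y → 4 / 27 * Real.log ((Y : ℝ) + 1) ≤
      ∑ p ∈ (Nat.sqrt Y).primesLE with Y < p ^ 3, Real.log p / p := by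
  obtain ⟨C, hC⟩ := exists_le_sum_log_div_primesLE
  obtain ⟨N, hN⟩ := Filter.eventually_atTop.1
    ((Real.tendsto_log_atTop.comp tendsto_natCast_atTop_atTop).eventually_ge_atTop
      (54 * (Real.log 2 + C + Real.log 4 + 4 / 27 * Real.log 2)))
  refine ⟨max N 1, fun Y hY => ?_⟩
  have hN' := hN Y (le_of_max_le_left hY)
  have hY1 : 1 ≤ Y := le_of_max_le_right hY
  simp only [Function.comp_apply] at hN'
  have hYr : (1 : ℝ) ≤ Y := by exact_mod_cast hY1
  have hs : 1 ≤ Nat.sqrt Y := Nat.sqrt_pos.2 hY1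
  have hsr : (1 : ℝ) ≤ Nat.sqrt Y := by exact_mod_cast hs
  have h1 := hC (Nat.sqrt Y) (by omega)
  have h2 : Real.log Y ≤ 2 * Real.log (Nat.sqrt Y) + 2 * Real.log 2 := by
    have : (Y : ℝ) ≤ (Nat.sqrt Y * 2) ^ 2 := by
      have h3 : Y ≤ (Nat.sqrt Y * 2) ^ 2 := by nlinarith [Nat.lt_succ_sqrt Y]
      exact_mod_cast h3
    have := Real.log_le_log (by linarith) this
    rw [Real.log_pow, Real.log_mul (by linarith) (by norm_num)] at this
    push_cast at this
    linarith
  have h3 : Real.log ((Y : ℝ) + 1) ≤ Real.log Y + Real.log 2 := by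
    rw [← Real.log_mul (by linarith) (by norm_num)]
    exact Real.log_le_log (by linarith) (by linarith)
  set x := ⌊(Y : ℝ) ^ (1 / 3 : ℝ)⌋₊ with hx
  have hx1 : 1 ≤ x := Nat.le_floor (by simpa using Real.one_le_rpow hYr (by norm_num))
  have h4 := sum_log_div_primesLE_le x (by omega)
  have h5 : Real.log x ≤ 1 / 3 * Real.log Y := by
    rw [← Real.log_rpow (by linarith)]
    exact Real.log_le_log (by exact_mod_cast hx1) (Nat.floor_le (by positivity))
  have h6 : ∑ p ∈ (Nat.sqrt Y).primesLE with ¬ Y < p ^ 3, Real.log p / p ≤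
      ∑ p ∈ x.primesLE, Real.log p / p := by
    refine Finset.sum_le_sum_of_subset_of_nonneg (fun p hp => ?_)
      (fun p _ _ => div_nonneg (Real.log_natCast_nonneg p) (Nat.cast_nonneg p))
    obtain ⟨hp, hp3⟩ := Finset.mem_filter.1 hp
    refine Nat.mem_primesLE.2 ⟨Nat.le_floor ?_, (Nat.mem_primesLE.1 hp).2⟩
    have : ((p : ℝ) ^ 3) ≤ Y := by exact_mod_cast not_lt.1 hp3
    calc (p : ℝ) = ((p : ℝ) ^ 3) ^ (1 / 3 : ℝ) := by
          rw [← Real.rpow_natCast, ← Real.rpow_mul (by positivity)]; norm_num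
      _ ≤ _ := Real.rpow_le_rpow (by positivity) this (by norm_num)
  have h7 := Finset.sum_filter_add_sum_filter_not (Nat.sqrt Y).primesLE (fun p => Y < p ^ 3)
    (fun p => Real.log p / p)
  linarith

/-- The number of entries of `walk K n b` in terms of `Y = 2 ^ K / n` and `b`. -/
def walkLength : ℕ → ℕ → ℕ
  | _, 0 => 0
  | Y, b + 1 => walkLength Y b +
      if (b + 1).Prime ∧ 2 < b + 1 ∧ (b + 1) ^ 2 ≤ Y then walkLength (Y / (b + 1)) b + 2 else 0

theorem walkLength_eq_sum (Y b : ℕ) :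
    walkLength Y b = ∑ p ∈ Finset.range (b + 1) with p.Prime ∧ 2 < p ∧ p ^ 2 ≤ Y,
      (walkLength (Y / p) (p - 1) + 2) := by
  induction b with
  | zero => simp [walkLength, Finset.sum_filter]
  | succ b ih =>
    rw [walkLength, ih, Finset.sum_filter, Finset.sum_filter, Finset.sum_range_succ _ (b + 1)]
    simp

theorem mul_sub_sq_le {L l : ℝ} (hL : l ≤ L) (h : 0 ≤ L) : 27 * (l * (L - l) ^ 2) ≤ 4 * L ^ 3 := by
  nlinarith [mul_nonneg (sq_nonneg (L - 3 * l)) (by linarith : 0 ≤ 4 * L - 3 * l)]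

theorem div_log_sq_monotone {x y : ℝ} (hx : Real.exp 2 ≤ x) (hxy : x ≤ y) :
    x / Real.log x ^ 2 ≤ y / Real.log y ^ 2 := by
  have hx0 : 0 < x := (Real.exp_pos 2).trans_le hx
  have hlx : 2 ≤ Real.log x := (Real.le_log_iff_exp_le hx0).2 hx
  have hly : 2 ≤ Real.log y := hlx.trans (Real.log_le_log hx0 hxy)
  have h := Real.log_div_sqrt_antitoneOn (Set.mem_Ici.2 hx) (Set.mem_Ici.2 (hx.trans hxy)) hxy
  have h1 : (Real.log y / √y) ^ 2 ≤ (Real.log x / √x) ^ 2 :=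
    pow_le_pow_left₀ (by positivity) h 2
  rw [div_pow, div_pow, Real.sq_sqrt hx0.le, Real.sq_sqrt (hx0.le.trans hxy)] at h1
  rw [← inv_div, ← inv_div (Real.log y ^ 2)]
  exact inv_anti₀ (by have := hx0.trans_le hxy; positivity) h1

theorem exists_le_walkLength :
    ∃ a : ℝ, 0 < a ∧ ∀ Y b : ℕ, 9 ≤ Y → Y < (b + 1) ^ 2 →
      a * (((Y : ℝ) + 1) / Real.log ((Y : ℝ) + 1) ^ 2) ≤ walkLength Y b := by
  obtain ⟨N, hN⟩ := exists_forall_sum_log_div_window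
  refine ⟨2 / ((N : ℝ) + 1001), by positivity, fun Y => ?_⟩
  induction Y using Nat.strong_induction_on with
  | _ Y ih =>
  intro b hY hb
  have hYr : (9 : ℝ) ≤ Y := by exact_mod_cast hY
  have hlog1 : 1 ≤ Real.log ((Y : ℝ) + 1) := by
    rw [Real.le_log_iff_exp_le (by linarith)]
    have := Real.exp_one_lt_d9
    linarith
  by_cases hYN : Y < N + 1000
  · have h2 : 2 ≤ walkLength Y b := by
      rw [walkLength_eq_sum]
      have h3 : 3 ∈ {p ∈ Finset.range (b + 1) | p.Prime ∧ 2 < p ∧ p ^ 2 ≤ Y} := by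
        simp only [Finset.mem_filter, Finset.mem_range]
        refine ⟨by nlinarith, by norm_num, by norm_num, by omega⟩
      refine le_trans ?_ (Finset.single_le_sum (fun _ _ => Nat.zero_le _) h3)
      omega
    have h3 : ((Y : ℝ) + 1) / Real.log ((Y : ℝ) + 1) ^ 2 ≤ (N : ℝ) + 1001 := by
      refine (div_le_self (by positivity) (one_le_pow₀ hlog1)).trans ?_
      have : (Y : ℝ) < N + 1000 := by exact_mod_cast hYN
      linarith
    calc _ ≤ 2 / ((N : ℝ) + 1001) * ((N : ℝ) + 1001) := by gcongr
      _ = 2 := by field_simp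
      _ ≤ _ := by exact_mod_cast h2
  · set a : ℝ := 2 / ((N : ℝ) + 1001) with ha
    have ha0 : 0 < a := by positivity
    have hw := hN Y (by omega)
    set L := Real.log ((Y : ℝ) + 1) with hL
    set W := {p ∈ (Nat.sqrt Y).primesLE | Y < p ^ 3} with hW
    have hWmem : ∀ p ∈ W, p.Prime ∧ 10 ≤ p ∧ p ^ 2 ≤ Y ∧ Y < p ^ 3 := by
      intro p hp
      obtain ⟨hp1, hp3⟩ := Finset.mem_filter.1 hp
      obtain ⟨hp1, hp2⟩ := Nat.mem_primesLE.1 hp1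
      refine ⟨hp2, ?_, Nat.le_sqrt'.1 hp1, hp3⟩
      by_contra! h
      have : p ^ 3 ≤ 9 ^ 3 := Nat.pow_le_pow_left (by omega) 3
      omega
    have h1 : ∑ p ∈ W, (walkLength (Y / p) (p - 1) : ℝ) ≤ walkLength Y b := by
      rw [walkLength_eq_sum Y b]
      push_cast
      have hsub : W ⊆ {p ∈ Finset.range (b + 1) | p.Prime ∧ 2 < p ∧ p ^ 2 ≤ Y} := by
        intro p hp
        obtain ⟨h1, h2, h3, h4⟩ := hWmem p hp
        simp only [Finset.mem_filter, Finset.mem_range]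
        exact ⟨lt_of_pow_lt_pow_left₀ 2 (by omega) (by omega), h1, by omega, h3⟩
      refine le_trans ?_ (Finset.sum_le_sum_of_subset_of_nonneg hsub fun _ _ _ => by positivity)
      exact Finset.sum_le_sum fun p _ => by linarith
    refine le_trans ?_ h1
    have h2 : ∀ p ∈ W, a * ((Y : ℝ) + 1) * (27 / (4 * L ^ 3)) * (Real.log p / p) ≤
        walkLength (Y / p) (p - 1) := by
      intro p hp
      obtain ⟨hpp, hp10, hp2, hp3⟩ := hWmem p hp
      have hpY : p ≤ Y / p := (Nat.le_div_iff_mul_le hpp.pos).2 (by nlinarith)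
      have hp0 : (0 : ℝ) < p := by exact_mod_cast hpp.pos
      have hp10r : (10 : ℝ) ≤ p := by exact_mod_cast hp10
      have h := ih (Y / p) (Nat.div_lt_self (by omega) hpp.one_lt) (p - 1) (by omega) (by
        rw [Nat.sub_add_cancel hpp.one_le, Nat.div_lt_iff_lt_mul hpp.pos]
        nlinarith)
      refine le_trans ?_ h
      have hle : ((Y : ℝ) + 1) / p ≤ ((Y / p : ℕ) : ℝ) + 1 := by
        rw [div_le_iff₀ hp0]
        have : Y + 1 ≤ (Y / p + 1) * p := by
          have := Nat.div_add_mod Y p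
          have := Nat.mod_lt Y hpp.pos
          nlinarith
        exact_mod_cast this
      have hpp2 : (p : ℝ) ≤ ((Y : ℝ) + 1) / p := by
        rw [le_div_iff₀ hp0]
        have : (p : ℝ) ^ 2 ≤ Y := by exact_mod_cast hp2
        nlinarith
      have hexp : Real.exp 2 ≤ ((Y : ℝ) + 1) / p := by
        refine le_trans ?_ hpp2
        have := Real.exp_one_lt_d9
        have h2 : Real.exp 2 = Real.exp 1 * Real.exp 1 := by rw [← Real.exp_add]; norm_num
        have := Real.exp_pos 1
        nlinarith
      have hmono := div_log_sq_monotone hexp hle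
      have hlogdiv : Real.log (((Y : ℝ) + 1) / p) = L - Real.log p :=
        Real.log_div (by positivity) (by positivity)
      have hpos : 2 ≤ L - Real.log p := by
        rw [← hlogdiv]
        exact (Real.le_log_iff_exp_le ((Real.exp_pos 2).trans_le hexp)).2 hexp
      have hlp : 0 ≤ Real.log p := Real.log_natCast_nonneg p
      have hamgm := mul_sub_sq_le (L := L) (l := Real.log p) (by linarith) (by linarith)
      rw [hlogdiv] at hmono
      have h27 : 27 / (4 * L ^ 3) * Real.log p ≤ 1 / (L - Real.log p) ^ 2 := by
        rw [div_mul_eq_mul_div, div_le_div_iff₀ (by positivity) (by positivity)]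
        linarith
      calc a * ((Y : ℝ) + 1) * (27 / (4 * L ^ 3)) * (Real.log p / p)
          = a * (((Y : ℝ) + 1) / p) * (27 / (4 * L ^ 3) * Real.log p) := by ring
        _ ≤ a * (((Y : ℝ) + 1) / p) * (1 / (L - Real.log p) ^ 2) := by gcongr
        _ = a * (((Y : ℝ) + 1) / p / (L - Real.log p) ^ 2) := by ring
        _ ≤ _ := by gcongr
    refine le_trans ?_ (Finset.sum_le_sum h2)
    rw [← Finset.mul_sum]
    calc a * (((Y : ℝ) + 1) / L ^ 2)
        = a * ((Y : ℝ) + 1) * (27 / (4 * L ^ 3)) * (4 / 27 * L) := by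
          field_simp
      _ ≤ _ := by gcongr

/-- The entry of a tree vertex `m` at scale `2 ^ K`: `m` times the largest power of two that is at
most `2 ^ K / (m * m.minFac)`, rounded down to depend on `K` only by a shift of the exponent. -/
def node (K m : ℕ) : ℕ := m * 2 ^ (K - Nat.clog 2 (m * m.minFac))

/-- Depth-first walk through the numbers `n * p₁ * ⋯ * pᵣ` with odd primes `b ≥ p₁ > ⋯ > pᵣ`
such that `n * p₁ * ⋯ * pᵢ₋₁ * pᵢ ^ 2 ≤ 2 ^ K` for all `i`. Each of these is met twice, as
`node K m` on entering its subtree and as `2 * node K m` on leaving it. -/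
def walk (K : ℕ) : ℕ → ℕ → List ℕ
  | _, 0 => []
  | n, b + 1 => walk K n b ++
      if (b + 1).Prime ∧ 2 < b + 1 ∧ n * (b + 1) ^ 2 ≤ 2 ^ K then
        node K (n * (b + 1)) :: (walk K (n * (b + 1)) b ++ [2 * node K (n * (b + 1))])
      else []

theorem length_walk (K n b : ℕ) (hn : 0 < n) :
    (walk K n b).length = walkLength (2 ^ K / n) b := by
  induction b generalizing n with
  | zero => rfl
  | succ b ih =>
    have h : n * (b + 1) ^ 2 ≤ 2 ^ K ↔ (b + 1) ^ 2 ≤ 2 ^ K / n := by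
      rw [Nat.le_div_iff_mul_le hn, mul_comm]
    rw [walk, walkLength, List.length_append, ih n hn, Nat.div_div_eq_div_mul]
    simp only [← h]
    split_ifs
    · simp [ih (n * (b + 1)) (by positivity)]
    · rfl

theorem lcm_mul_two_pow_le {u v l i j B : ℕ} (hl : 0 < l) (hu : u ∣ l) (hv : v ∣ l)
    (hi : l * 2 ^ i ≤ B) (hj : l * 2 ^ j ≤ B) : Nat.lcm (u * 2 ^ i) (v * 2 ^ j) ≤ B := by
  have h : Nat.lcm (u * 2 ^ i) (v * 2 ^ j) ≤ l * 2 ^ max i j :=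
    Nat.le_of_dvd (by positivity) (Nat.lcm_dvd
      (mul_dvd_mul hu (pow_dvd_pow 2 (le_max_left i j)))
      (mul_dvd_mul hv (pow_dvd_pow 2 (le_max_right i j))))
  rcases max_choice i j with h' | h' <;> rw [h'] at h <;> omega

theorem two_pow_sub_clog_mul_le {K w : ℕ} (h : w ≤ 2 ^ K) :
    w * 2 ^ (K - Nat.clog 2 w) ≤ 2 ^ K := by
  have h1 : Nat.clog 2 w ≤ K := Nat.clog_le_of_le_pow h
  calc w * 2 ^ (K - Nat.clog 2 w) ≤ 2 ^ Nat.clog 2 w * 2 ^ (K - Nat.clog 2 w) :=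
        Nat.mul_le_mul_right _ (Nat.le_pow_clog (by norm_num) w)
    _ = 2 ^ K := by rw [← pow_add, Nat.add_sub_cancel' h1]

theorem minFac_mul_prime {n p : ℕ} (hp : p.Prime) (h : ∀ q, q.Prime → q ∣ n → p ≤ q) :
    (n * p).minFac = p := by
  refine le_antisymm (Nat.minFac_le_of_dvd hp.two_le (dvd_mul_left p n)) ?_
  have hne : n * p ≠ 1 := fun h1 => hp.ne_one (Nat.eq_one_of_mul_eq_one_left h1)
  have h1 := Nat.minFac_prime hne
  rcases h1.dvd_mul.1 (Nat.minFac_dvd (n * p)) with h2 | h2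
  · exact h _ h1 h2
  · exact ((Nat.prime_dvd_prime_iff_eq h1 hp).1 h2).ge

/-- The entry of `n * p` is `n * p * 2 ^ e` with `n * p ^ 2 * 2 ^ e ≤ 2 ^ K`. -/
theorem exists_node_eq {K n p : ℕ} (hp : p.Prime) (h : ∀ q, q.Prime → q ∣ n → p ≤ q)
    (hK : n * p ^ 2 ≤ 2 ^ K) :
    ∃ e, node K (n * p) = n * p * 2 ^ e ∧ n * p ^ 2 * 2 ^ e ≤ 2 ^ K := by
  refine ⟨_, rfl, ?_⟩
  rw [minFac_mul_prime hp h, mul_assoc n p p, ← pow_two]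
  exact two_pow_sub_clog_mul_le hK

theorem isChain_walk (K : ℕ) : ∀ b n : ℕ, 0 < n → (∀ q, q.Prime → q ∣ n → b < q) →
    (walk K n b).IsChain (fun x y => Nat.lcm x y ≤ 4 * 2 ^ K) ∧
    (∀ y ∈ (walk K n b).head?, ∃ p, p.Prime ∧ p ≤ b ∧ n * p ^ 2 ≤ 2 ^ K ∧
      y = node K (n * p)) ∧
    (∀ y ∈ (walk K n b).getLast?, ∃ p, p.Prime ∧ p ≤ b ∧ n * p ^ 2 ≤ 2 ^ K ∧
      y = 2 * node K (n * p) ∧ ∀ q, q.Prime → p < q → q ≤ b → 2 ^ K < n * q ^ 2) := by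
  intro b
  induction b with
  | zero => simp [walk]
  | succ b ih =>
    intro n hn hnb
    obtain ⟨hc, hh, hl⟩ := ih n hn fun q hq hqn => (Nat.lt_succ_self b).trans (hnb q hq hqn)
    rw [walk]
    split_ifs with hP
    swap
    · rw [List.append_nil]
      refine ⟨hc, fun y hy => ?_, fun y hy => ?_⟩
      · obtain ⟨p, h1, h2, h3⟩ := hh y hy
        exact ⟨p, h1, by omega, h3⟩
      · obtain ⟨p, h1, h2, h3, h4, h5⟩ := hl y hy
        refine ⟨p, h1, by omega, h3, h4, fun q hq hpq hqb => ?_⟩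
        rcases Nat.lt_or_ge b q with h6 | h6
        · obtain rfl : q = b + 1 := by omega
          by_contra! h7
          exact hP ⟨hq, by have := h1.two_le; omega, h7⟩
        · exact h5 q hq hpq h6
    obtain ⟨hp, hp2, hpK⟩ := hP
    set P := b + 1 with hPdef
    have hnP : ∀ q, q.Prime → q ∣ n * P → P ≤ q := by
      intro q hq hqn
      rcases hq.dvd_mul.1 hqn with h | h
      · exact (hnb q hq h).le
      · exact ((Nat.prime_dvd_prime_iff_eq hq hp).1 h).ge
    obtain ⟨e, he, heK⟩ := exists_node_eq hp (fun q hq h => (hnb q hq h).le) hpK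
    obtain ⟨hc', hh', hl'⟩ := ih (n * P) (by positivity) hnP
    refine ⟨?_, ?_, ?_⟩
    · refine List.isChain_append.2 ⟨hc, List.isChain_cons.2 ⟨?_, List.isChain_append.2
        ⟨hc', List.isChain_singleton _, ?_⟩⟩, ?_⟩
      · intro y hy
        cases hw : walk K (n * P) b with
        | nil =>
          simp only [hw, List.nil_append, List.head?_cons, Option.mem_some_iff] at hy
          rw [← hy, Nat.lcm_eq_right (dvd_mul_left _ _), he]
          nlinarith [hp.one_le, Nat.zero_le (n * P * 2 ^ e)]
        | cons z l =>
          obtain ⟨q, hq, hqb, hqK, hqe⟩ := hh' y (by simpa [hw] using hy)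
          obtain ⟨e', he', heK'⟩ := exists_node_eq hq
            (fun r hr h => (by omega : q ≤ P).trans (hnP r hr h)) hqK
          rw [hqe, he, he']
          have hqP : q ≤ P := by omega
          have hq0 := hq.pos
          refine lcm_mul_two_pow_le (l := n * P * q) (by positivity) (dvd_mul_right _ _) dvd_rfl
            ?_ ?_
          · calc n * P * q * 2 ^ e ≤ n * P * P * 2 ^ e := by gcongr
              _ = n * P ^ 2 * 2 ^ e := by ring
              _ ≤ _ := by omega
          · calc n * P * q * 2 ^ e' ≤ n * P * q * q * 2 ^ e' :=
                  Nat.mul_le_mul_right _ (Nat.le_mul_of_pos_right _ hq0)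
              _ = n * P * q ^ 2 * 2 ^ e' := by ring
              _ ≤ _ := by omega
      · intro x hx y hy
        simp only [List.head?_cons, Option.mem_some_iff] at hy
        obtain ⟨q, hq, hqb, hqK, hqe, -⟩ := hl' x hx
        obtain ⟨e', he', heK'⟩ := exists_node_eq hq
          (fun r hr h => (by omega : q ≤ P).trans (hnP r hr h)) hqK
        rw [← hy, hqe, he, he']
        have hqP : q ≤ P := by omega
        have hq0 := hq.pos
        rw [show 2 * (n * P * q * 2 ^ e') = n * P * q * 2 ^ (e' + 1) by ring,
          show 2 * (n * P * 2 ^ e) = n * P * 2 ^ (e + 1) by ring]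
        refine lcm_mul_two_pow_le (l := n * P * q) (by positivity) dvd_rfl (dvd_mul_right _ _)
          ?_ ?_
        · calc n * P * q * 2 ^ (e' + 1) ≤ n * P * q * q * 2 ^ (e' + 1) :=
                Nat.mul_le_mul_right _ (Nat.le_mul_of_pos_right _ hq0)
            _ = 2 * (n * P * q ^ 2 * 2 ^ e') := by ring
            _ ≤ _ := by omega
        · calc n * P * q * 2 ^ (e + 1) ≤ n * P * P * 2 ^ (e + 1) := by gcongr
            _ = 2 * (n * P ^ 2 * 2 ^ e) := by ring
            _ ≤ _ := by omega
      · intro x hx y hy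
        simp only [List.head?_cons, Option.mem_some_iff] at hy
        obtain ⟨q, hq, hqb, hqK, hqe, hmax⟩ := hl x hx
        have hq0 := hq.pos
        obtain ⟨e', he', heK'⟩ := exists_node_eq hq
          (fun r hr h => (by have := hnb r hr h; omega : q ≤ r)) hqK
        have hP2 : P ≤ 2 * q := by
          obtain ⟨r, hr, hqr, hr2⟩ := Nat.exists_prime_lt_and_le_two_mul q hq0.ne'
          by_contra! h
          have h1 := hmax r hr hqr (by omega)
          have h2 : n * r ^ 2 ≤ n * P ^ 2 := by gcongr; omega
          omega
        have hqP : q ≤ P := by omega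
        rw [← hy, hqe, he, he', show 2 * (n * q * 2 ^ e') = n * q * 2 ^ (e' + 1) by ring]
        refine lcm_mul_two_pow_le (l := n * q * P) (by positivity) (dvd_mul_right _ _)
          ⟨q, by ring⟩ ?_ ?_
        · calc n * q * P * 2 ^ (e' + 1) ≤ n * q * (2 * q) * 2 ^ (e' + 1) := by gcongr
            _ = 4 * (n * q ^ 2 * 2 ^ e') := by ring
            _ ≤ _ := by omega
        · calc n * q * P * 2 ^ e ≤ n * P * P * 2 ^ e := by gcongr
            _ = n * P ^ 2 * 2 ^ e := by ring
            _ ≤ _ := by omega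
    · intro y hy
      rw [List.head?_append] at hy
      cases hw : (walk K n b).head? with
      | none =>
        simp only [hw, Option.none_or, List.head?_cons, Option.mem_some_iff] at hy
        exact ⟨P, hp, le_rfl, hpK, hy.symm⟩
      | some z =>
        obtain ⟨p, h1, h2, h3⟩ := hh y (by simpa [hw] using hy)
        exact ⟨p, h1, by omega, h3⟩
    · intro y hy
      have hy' : y = 2 * node K (n * P) := by
        rw [← List.cons_append, ← List.append_assoc, List.getLast?_append] at hy
        simpa using hy.symm
      exact ⟨P, hp, le_rfl, hpK, hy', fun q _ h1 h2 => absurd h1 (by omega)⟩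

theorem mem_walk {K : ℕ} : ∀ {b n x : ℕ}, Odd n → x ∈ walk K n b →
    (∀ q, q.Prime → q ∣ n → b < q) →
    ∃ m e, Odd m ∧ n ∣ m ∧ n < m ∧ (∀ q, q.Prime → q ∣ m → q ∣ n ∨ q ≤ b) ∧ e ≤ 1 ∧
      m * m.minFac ≤ 2 ^ K ∧ x = m * 2 ^ (K - Nat.clog 2 (m * m.minFac) + e) := by
  intro b
  induction b with
  | zero => simp [walk]
  | succ b ih =>
    intro n x hn hx hnb
    rw [walk, List.mem_append] at hx
    rcases hx with hx | hx
    · obtain ⟨m, e, h1, h2, h3, h4, h5⟩ := ih hn hx fun q hq h => by have := hnb q hq h; omega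
      exact ⟨m, e, h1, h2, h3, fun q hq hqm => (h4 q hq hqm).imp_right (by omega), h5⟩
    · split_ifs at hx with hP
      swap
      · simp at hx
      obtain ⟨hp, hp2, hpK⟩ := hP
      set P := b + 1 with hPdef
      have hodd : Odd (n * P) := hn.mul (hp.odd_of_ne_two (by omega))
      have hlt : n < n * P := lt_mul_of_one_lt_right hn.pos hp.one_lt
      have hdvd : ∀ q, q.Prime → q ∣ n * P → q ∣ n ∨ q ≤ P := fun q hq h =>
        (hq.dvd_mul.1 h).imp_right (Nat.le_of_dvd hp.pos)
      have hmin := minFac_mul_prime hp fun q hq h => (hnb q hq h).le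
      have hw : n * P * (n * P).minFac ≤ 2 ^ K := by
        rw [hmin, mul_assoc, ← pow_two]; exact hpK
      simp only [List.mem_cons, List.mem_append, List.not_mem_nil, or_false] at hx
      rcases hx with hx | hx | hx
      · exact ⟨n * P, 0, hodd, dvd_mul_right _ _, hlt, hdvd, by omega, hw, hx⟩
      · obtain ⟨m, e, h1, h2, h3, h4, h5⟩ := ih hodd hx fun q hq h => by
          rcases hq.dvd_mul.1 h with h | h
          · have := hnb q hq h; omega
          · have := (Nat.prime_dvd_prime_iff_eq hq hp).1 h; omega
        refine ⟨m, e, h1, (dvd_mul_right _ _).trans h2, hlt.trans h3, fun q hq hqm => ?_, h5⟩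
        rcases h4 q hq hqm with h | h
        · exact hdvd q hq h
        · exact Or.inr (by omega)
      · exact ⟨n * P, 1, hodd, dvd_mul_right _ _, hlt, hdvd, le_rfl, hw, by
          rw [hx, node]; ring⟩

theorem odd_mul_two_pow_injective {m m' i i' : ℕ} (hm : Odd m) (hm' : Odd m')
    (h : m * 2 ^ i = m' * 2 ^ i') : m = m' ∧ i = i' := by
  have key : ∀ {m m' i i' : ℕ}, Odd m → m * 2 ^ i = m' * 2 ^ i' → i' ≤ i := by
    intro m m' i i' hm h
    have h1 : 2 ^ i' ∣ m * 2 ^ i := h ▸ dvd_mul_left _ _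
    have h2 : Nat.Coprime (2 ^ i') m := Nat.Coprime.pow_left _ (Nat.coprime_two_left.2 hm)
    exact (Nat.pow_dvd_pow_iff_le_right (by norm_num)).1 (h2.dvd_of_dvd_mul_left h1)
  obtain rfl : i = i' := le_antisymm (key hm' h.symm) (key hm h)
  exact ⟨Nat.eq_of_mul_eq_mul_right (by positivity) h, rfl⟩

theorem nodup_walk (K : ℕ) : ∀ b n : ℕ, Odd n → (∀ q, q.Prime → q ∣ n → b < q) →
    (walk K n b).Nodup := by
  intro b
  induction b with
  | zero => simp [walk]
  | succ b ih =>
    intro n hn hnb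
    have hnb' : ∀ q, q.Prime → q ∣ n → b < q := fun q hq h => by have := hnb q hq h; omega
    rw [walk]
    split_ifs with hP
    swap
    · simpa using ih n hn hnb'
    obtain ⟨hp, hp2, hpK⟩ := hP
    set P := b + 1 with hPdef
    have hodd : Odd (n * P) := hn.mul (hp.odd_of_ne_two (by omega))
    have hnP : ∀ q, q.Prime → q ∣ n * P → b < q := fun q hq h => by
      rcases hq.dvd_mul.1 h with h | h
      · have := hnb q hq h; omega
      · have := (Nat.prime_dvd_prime_iff_eq hq hp).1 h; omega
    have hnode : 2 * node K (n * P) =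
        n * P * 2 ^ (K - Nat.clog 2 (n * P * (n * P).minFac) + 1) := by rw [node]; ring
    have hnotP : ∀ x ∈ walk K n b, ∀ m i, Odd m → P ∣ m → x ≠ m * 2 ^ i := by
      rintro x hx m i hm hPm rfl
      obtain ⟨m', e', h1, -, -, h4, -, -, h7⟩ := mem_walk hn hx hnb'
      obtain ⟨rfl, -⟩ := odd_mul_two_pow_injective hm h1 h7
      rcases h4 P hp hPm with h | h
      · exact absurd (hnb P hp h) (lt_irrefl _)
      · omega
    have hnotnP : ∀ x ∈ walk K (n * P) b, ∀ i, x ≠ n * P * 2 ^ i := by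
      rintro x hx i rfl
      obtain ⟨m', e', h1, -, h3, -, -, -, h7⟩ := mem_walk hodd hx hnP
      obtain ⟨h, -⟩ := odd_mul_two_pow_injective hodd h1 h7
      omega
    have hpos : 0 < node K (n * P) := Nat.mul_pos hodd.pos (by positivity)
    rw [List.nodup_append', List.nodup_cons, List.nodup_append']
    refine ⟨ih n hn hnb', ⟨?_, ih _ hodd hnP, List.nodup_singleton _, ?_⟩, ?_⟩
    · rw [List.mem_append, List.mem_singleton]
      rintro (h | h)
      · exact hnotnP _ h _ rfl
      · omega
    · rw [List.disjoint_singleton]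
      exact fun h => hnotnP _ h _ hnode
    · rw [List.disjoint_left]
      intro x hx hx'
      simp only [List.mem_cons, List.mem_append, List.not_mem_nil, or_false] at hx'
      rcases hx' with h | h | h
      · exact hnotP x hx _ _ hodd (dvd_mul_left _ _) h
      · obtain ⟨m', e', h1, h2, -, -, -, -, h7⟩ := mem_walk hodd h hnP
        exact hnotP x hx _ _ h1 ((dvd_mul_left _ _).trans h2) h7
      · exact hnotP x hx _ _ hodd (dvd_mul_left _ _) (h.trans hnode)

/-- Positive integers that are neither a power of two nor visited by any of the walks
`walk (4 * j) 1 (4 ^ j)`. -/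
def Spare (m : ℕ) : Prop := 0 < m ∧ (∀ i, m ≠ 2 ^ i) ∧ ∀ j, m ∉ walk (4 * j) 1 (4 ^ j)

open Classical in
/-- The walk at scale `16 ^ k`, followed by two powers of two with `k` between them if `k` would
not occur otherwise. -/
noncomputable def block (k : ℕ) : List ℕ :=
  walk (4 * k) 1 (4 ^ k) ++ 2 ^ (2 * k) :: ((if Spare k then [k] else []) ++ [2 ^ (2 * k + 1)])

/-- Concatenation of the first `k` blocks. -/
noncomputable def blocks : ℕ → List ℕ
  | 0 => []
  | k + 1 => blocks k ++ block k

theorem not_dvd_one_of_prime (k : ℕ) : ∀ q : ℕ, q.Prime → q ∣ 1 → k < q :=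
  fun _ hq h => absurd h hq.not_dvd_one

theorem mem_walk_one {k x : ℕ} (hx : x ∈ walk (4 * k) 1 (4 ^ k)) :
    ∃ m e, Odd m ∧ 1 < m ∧ e ≤ 1 ∧ Nat.clog 2 (m * m.minFac) ≤ 4 * k ∧
      x = m * 2 ^ (4 * k - Nat.clog 2 (m * m.minFac) + e) := by
  obtain ⟨m, e, h1, -, h3, -, h5, h6, h7⟩ := mem_walk odd_one hx (not_dvd_one_of_prime _)
  exact ⟨m, e, h1, h3, h5, Nat.clog_le_of_le_pow h6, h7⟩

theorem ne_two_pow_of_mem_walk {k x : ℕ} (hx : x ∈ walk (4 * k) 1 (4 ^ k)) (i : ℕ) :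
    x ≠ 2 ^ i := by
  rintro rfl
  obtain ⟨m, e, h1, h3, -, -, h7⟩ := mem_walk_one hx
  obtain ⟨h, -⟩ := odd_mul_two_pow_injective odd_one h1 ((one_mul _).trans h7)
  omega

theorem eq_of_mem_walk {k k' x : ℕ} (hx : x ∈ walk (4 * k) 1 (4 ^ k))
    (hx' : x ∈ walk (4 * k') 1 (4 ^ k')) : k = k' := by
  obtain ⟨m, e, h1, -, h3, h4, h5⟩ := mem_walk_one hx
  obtain ⟨m', e', h1', -, h3', h4', h5'⟩ := mem_walk_one hx'
  obtain ⟨rfl, h⟩ := odd_mul_two_pow_injective h1 h1' (h5.symm.trans h5')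
  omega

theorem mem_block {k x : ℕ} : x ∈ block k ↔
    x ∈ walk (4 * k) 1 (4 ^ k) ∨ x = 2 ^ (2 * k) ∨ (Spare k ∧ x = k) ∨ x = 2 ^ (2 * k + 1) := by
  rw [block]
  split_ifs with h <;> simp [h]

theorem block_disjoint {k k' x : ℕ} (hx : x ∈ block k) (hx' : x ∈ block k') : k = k' := by
  have hinj : ∀ {i j : ℕ}, 2 ^ i = 2 ^ j → i = j := fun h => Nat.pow_right_injective le_rfl h
  rcases mem_block.1 hx with h | h | ⟨hs, h⟩ | h <;>
  rcases mem_block.1 hx' with h' | h' | ⟨hs', h'⟩ | h'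
  · exact eq_of_mem_walk h h'
  · exact absurd h' (ne_two_pow_of_mem_walk h _)
  · exact absurd (h' ▸ h) (hs'.2.2 _)
  · exact absurd h' (ne_two_pow_of_mem_walk h _)
  · exact absurd h (ne_two_pow_of_mem_walk h' _)
  · have := hinj (h.symm.trans h'); omega
  · exact absurd (h'.symm.trans h) (hs'.2.1 _)
  · have := hinj (h.symm.trans h'); omega
  · exact absurd (h ▸ h') (hs.2.2 _)
  · exact absurd (h.symm.trans h') (hs.2.1 _)
  · exact h.symm.trans h'
  · exact absurd (h.symm.trans h') (hs.2.1 _)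
  · exact absurd h (ne_two_pow_of_mem_walk h' _)
  · have := hinj (h.symm.trans h'); omega
  · exact absurd (h'.symm.trans h) (hs'.2.1 _)
  · have := hinj (h.symm.trans h'); omega

theorem nodup_block (k : ℕ) : (block k).Nodup := by
  have hne : (2 : ℕ) ^ (2 * k) ≠ 2 ^ (2 * k + 1) := fun h => by
    have := Nat.pow_right_injective le_rfl h; omega
  have hw := nodup_walk (4 * k) (4 ^ k) 1 odd_one (not_dvd_one_of_prime _)
  have hn := fun i (h : 2 ^ i ∈ walk (4 * k) 1 (4 ^ k)) => ne_two_pow_of_mem_walk h i rfl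
  rw [block, List.nodup_append']
  refine ⟨hw, ?_, ?_⟩
  · split_ifs with h
    · simpa [hne] using ⟨(h.2.1 _).symm, h.2.1 _⟩
    · simp
  · rw [List.disjoint_left]
    intro x hx hx'
    split_ifs at hx' with h
    · simp only [List.singleton_append, List.mem_cons, List.not_mem_nil, or_false] at hx'
      rcases hx' with rfl | rfl | rfl
      · exact hn _ hx
      · exact h.2.2 _ hx
      · exact hn _ hx
    · simp only [List.nil_append, List.mem_cons, List.not_mem_nil, or_false] at hx'
      rcases hx' with rfl | rfl
      · exact hn _ hx
      · exact hn _ hx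

theorem mem_blocks {k x : ℕ} : x ∈ blocks k ↔ ∃ j < k, x ∈ block j := by
  induction k with
  | zero => simp [blocks]
  | succ k ih =>
    rw [blocks, List.mem_append, ih]
    constructor
    · rintro (⟨j, hj, h⟩ | h)
      · exact ⟨j, by omega, h⟩
      · exact ⟨k, by omega, h⟩
    · rintro ⟨j, hj, h⟩
      rcases Nat.lt_succ_iff_lt_or_eq.1 hj with hj | rfl
      · exact Or.inl ⟨j, hj, h⟩
      · exact Or.inr h

theorem nodup_blocks (k : ℕ) : (blocks k).Nodup := by
  induction k with
  | zero => simp [blocks]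
  | succ k ih =>
    rw [blocks, List.nodup_append']
    refine ⟨ih, nodup_block k, List.disjoint_left.2 fun x hx hx' => ?_⟩
    obtain ⟨j, hj, h⟩ := mem_blocks.1 hx
    exact hj.ne (block_disjoint h hx')

theorem pos_of_mem_blocks {k x : ℕ} (hx : x ∈ blocks k) : 0 < x := by
  obtain ⟨j, -, h⟩ := mem_blocks.1 hx
  rcases mem_block.1 h with h | rfl | ⟨h, rfl⟩ | rfl
  · obtain ⟨m, e, -, h3, -, -, rfl⟩ := mem_walk_one h
    positivity
  · positivity
  · exact h.1
  · positivity

theorem exists_mem_blocks {m : ℕ} (hm : 0 < m) : ∃ k, m ∈ blocks k := by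
  by_cases hs : Spare m
  · exact ⟨m + 1, mem_blocks.2 ⟨m, by omega, mem_block.2 (by tauto)⟩⟩
  · rw [Spare] at hs
    push Not at hs
    by_cases h2 : ∀ i, m ≠ 2 ^ i
    · obtain ⟨j, hj⟩ := hs hm h2
      exact ⟨j + 1, mem_blocks.2 ⟨j, by omega, mem_block.2 (Or.inl hj)⟩⟩
    · push Not at h2
      obtain ⟨i, rfl⟩ := h2
      refine ⟨i / 2 + 1, mem_blocks.2 ⟨i / 2, by omega, mem_block.2 ?_⟩⟩
      rcases Nat.even_or_odd' i with ⟨j, rfl | rfl⟩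
      · exact Or.inr (Or.inl (by rw [Nat.mul_div_cancel_left _ (by norm_num)]))
      · exact Or.inr (Or.inr (Or.inr (by congr 1; omega)))

theorem blocks_prefix {k k' : ℕ} (h : k ≤ k') : blocks k <+: blocks k' := by
  induction h with
  | refl => exact List.prefix_rfl
  | step _ ih => exact ih.trans (List.prefix_append _ _)

theorem two_mul_le_length_blocks (k : ℕ) : 2 * k ≤ (blocks k).length := by
  induction k with
  | zero => simp
  | succ k ih =>
    rw [blocks, block]
    simp only [List.length_append, List.length_cons, List.length_nil]
    omega

theorem walkLength_le_length_blocks (k : ℕ) :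
    walkLength (16 ^ k) (4 ^ k) ≤ (blocks (k + 1)).length := by
  have h := length_walk (4 * k) 1 (4 ^ k) one_pos
  rw [Nat.div_one, pow_mul, show 2 ^ 4 = 16 by norm_num] at h
  rw [blocks, block, ← h]
  simp only [List.length_append]
  omega

theorem isChain_block (k : ℕ) : (block k).IsChain (fun x y => Nat.lcm x y ≤ 4 * 16 ^ k) := by
  have h16 : (2 : ℕ) ^ (4 * k) = 16 ^ k := by rw [pow_mul]; norm_num
  have h4 : (2 : ℕ) ^ (2 * k) = 4 ^ k := by rw [pow_mul]; norm_num
  have h44 : (4 : ℕ) ^ k * 4 ^ k = 16 ^ k := by rw [← mul_pow]; norm_num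
  have h41 : 1 ≤ 4 ^ k := Nat.one_le_pow _ _ (by norm_num)
  obtain ⟨hc, -, hl⟩ := isChain_walk (4 * k) (4 ^ k) 1 one_pos (not_dvd_one_of_prime _)
  rw [h16] at hc hl
  have hk : k ≤ 4 ^ k := (Nat.lt_pow_self (by norm_num)).le
  rw [block]
  refine List.isChain_append.2 ⟨hc, ?_, ?_⟩
  · split_ifs with h
    · have hlcm : ∀ x y : ℕ, 0 < x → 0 < y → Nat.lcm x y ≤ x * y := fun x y hx hy =>
        Nat.le_of_dvd (by positivity) (Nat.lcm_dvd_mul x y)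
      have h1 := hlcm (2 ^ (2 * k)) k (by positivity) h.1
      have h2 := hlcm k (2 ^ (2 * k + 1)) h.1 (by positivity)
      rw [pow_succ, h4] at h2
      rw [h4] at h1
      simp only [List.singleton_append, List.isChain_cons_cons, List.isChain_singleton, and_true]
      rw [pow_succ, h4]
      constructor <;> nlinarith
    · simp only [List.nil_append, List.isChain_cons_cons, List.isChain_singleton, and_true]
      rw [Nat.lcm_eq_right (pow_dvd_pow 2 (Nat.le_succ _)), pow_succ, h4]
      nlinarith
  · intro x hx y hy
    simp only [List.head?_cons, Option.mem_some_iff] at hy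
    obtain ⟨p, hp, hpb, hpK, hpe, -⟩ := hl x hx
    obtain ⟨e, he, heK⟩ := exists_node_eq (K := 4 * k) (n := 1) hp
      (fun q hq h => absurd h hq.not_dvd_one) (by rwa [h16])
    rw [h16] at heK
    rw [← hy, hpe, he, show 2 * (1 * p * 2 ^ e) = p * 2 ^ (e + 1) by ring,
      ← one_mul (2 ^ (2 * k))]
    refine lcm_mul_two_pow_le hp.pos dvd_rfl (one_dvd _) ?_ ?_
    · rw [pow_succ]
      have : p * 2 ^ e ≤ p ^ 2 * 2 ^ e :=
        Nat.mul_le_mul_right _ (Nat.le_self_pow (by norm_num) p)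
      nlinarith
    · rw [h4]
      nlinarith

theorem getLast?_block (k : ℕ) : (block k).getLast? = some (2 ^ (2 * k + 1)) := by
  rw [block, ← List.cons_append, ← List.append_assoc, List.getLast?_append]
  rfl

theorem lcm_head_block_le {k y : ℕ} (hy : y ∈ (block (k + 1)).head?) :
    Nat.lcm (2 ^ (2 * k + 1)) y ≤ 4 * 16 ^ (k + 1) := by
  have h16 : (2 : ℕ) ^ (4 * (k + 1)) = 16 ^ (k + 1) := by rw [pow_mul]; norm_num
  have h4 : (2 : ℕ) ^ (2 * (k + 1)) = 4 ^ (k + 1) := by rw [pow_mul]; norm_num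
  have h44 : (4 : ℕ) ^ (k + 1) * 4 ^ (k + 1) = 16 ^ (k + 1) := by rw [← mul_pow]; norm_num
  have h41 : 1 ≤ 4 ^ (k + 1) := Nat.one_le_pow _ _ (by norm_num)
  have hle : 2 ^ (2 * k + 1) ≤ 4 ^ (k + 1) := by
    rw [← h4]; exact Nat.pow_le_pow_right (by norm_num) (by omega)
  obtain ⟨-, hh, -⟩ := isChain_walk (4 * (k + 1)) (4 ^ (k + 1)) 1 one_pos (not_dvd_one_of_prime _)
  rw [block, List.head?_append] at hy
  cases hw : (walk (4 * (k + 1)) 1 (4 ^ (k + 1))).head? with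
  | none =>
    simp only [hw, Option.none_or, List.head?_cons, Option.mem_some_iff] at hy
    rw [← hy, Nat.lcm_eq_right (pow_dvd_pow 2 (by omega)), h4]
    nlinarith
  | some z =>
    obtain ⟨p, hp, hpb, hpK, hpe⟩ := hh y (by simpa [hw] using hy)
    obtain ⟨e, he, heK⟩ := exists_node_eq hp (fun q hq h => absurd h hq.not_dvd_one) hpK
    rw [h16] at heK
    rw [hpe, he, one_mul, ← one_mul (2 ^ (2 * k + 1))]
    refine lcm_mul_two_pow_le hp.pos (one_dvd _) dvd_rfl ?_ ?_
    · nlinarith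
    · have : p * 2 ^ e ≤ p ^ 2 * 2 ^ e :=
        Nat.mul_le_mul_right _ (Nat.le_self_pow (by norm_num) p)
      nlinarith

theorem isChain_blocks (k : ℕ) :
    (blocks (k + 1)).IsChain (fun x y => Nat.lcm x y ≤ 4 * 16 ^ k) := by
  induction k with
  | zero => simpa [blocks] using isChain_block 0
  | succ k ih =>
    rw [blocks]
    refine List.isChain_append.2 ⟨ih.imp fun x y h => h.trans ?_, isChain_block (k + 1), ?_⟩
    · gcongr <;> omega
    · intro x hx y hy
      rw [blocks, List.getLast?_append, getLast?_block] at hx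
      simp only [Option.some_or, Option.mem_some_iff] at hx
      exact hx ▸ lcm_head_block_le hy

/-- The infinite concatenation of all blocks. -/
noncomputable def blockSeq (i : ℕ) : ℕ := (blocks (i + 1)).getD i 0

theorem blockSeq_eq {k i : ℕ} (h : i < (blocks k).length) : blockSeq i = (blocks k)[i] := by
  have h' : i < (blocks (i + 1)).length := by have := two_mul_le_length_blocks (i + 1); omega
  rw [blockSeq, List.getD_eq_getElem _ _ h']
  rcases le_total k (i + 1) with hk | hk
  · exact ((blocks_prefix hk).getElem h).symm
  · exact (blocks_prefix hk).getElem h'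

theorem blockSeq_pos (i : ℕ) : 0 < blockSeq i := by
  have h : i < (blocks (i + 1)).length := by have := two_mul_le_length_blocks (i + 1); omega
  rw [blockSeq_eq h]
  exact pos_of_mem_blocks (List.getElem_mem h)

theorem blockSeq_injective : Function.Injective blockSeq := by
  intro i j hij
  have h := two_mul_le_length_blocks (max i j + 1)
  have hi : i < (blocks (max i j + 1)).length := by omega
  have hj : j < (blocks (max i j + 1)).length := by omega
  rw [blockSeq_eq hi, blockSeq_eq hj] at hij
  exact ((nodup_blocks _).getElem_inj_iff).1 hij

theorem exists_blockSeq_eq {m : ℕ} (hm : 0 < m) : ∃ i, blockSeq i = m := by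
  obtain ⟨k, hk⟩ := exists_mem_blocks hm
  obtain ⟨i, hi, h⟩ := List.getElem_of_mem hk
  exact ⟨i, (blockSeq_eq hi).trans h⟩

theorem exists_lcm_blockSeq_le (n : ℕ) (hn : 1 ≤ n) : ∃ k, (blocks k).length ≤ n ∧
    Nat.lcm (blockSeq (n - 1)) (blockSeq n) ≤ 4 * 16 ^ k := by
  classical
  have hex : ∃ k, n < (blocks (k + 1)).length :=
    ⟨n, by have := two_mul_le_length_blocks (n + 1); omega⟩
  obtain ⟨k, hk, hmin⟩ : ∃ k, n < (blocks (k + 1)).length ∧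
      ∀ j < k, ¬ n < (blocks (j + 1)).length :=
    ⟨Nat.find hex, Nat.find_spec hex, fun j hj => Nat.find_min hex hj⟩
  refine ⟨k, ?_, ?_⟩
  · cases k with
    | zero => simp [blocks]
    | succ j =>
      have := hmin j (Nat.lt_succ_self j)
      omega
  · obtain ⟨m, rfl⟩ := Nat.exists_eq_add_of_le' hn
    rw [Nat.add_sub_cancel, blockSeq_eq hk, blockSeq_eq ((Nat.lt_succ_self m).trans hk)]
    exact List.isChain_iff_getElem.1 (isChain_blocks _) m hk

theorem exists_sixteen_pow_le :
    ∃ C : ℝ, 0 < C ∧ ∀ n k : ℕ, 2 ≤ n → (blocks k).length ≤ n →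
      (16 : ℝ) ^ k ≤ C * n * Real.log n ^ 2 := by
  obtain ⟨a, ha, hA⟩ := exists_le_walkLength
  have hlog2 : 0 < Real.log 2 := Real.log_pos (by norm_num)
  set A := |Real.log (a / 9)| with hAdef
  have hA0 : 0 ≤ A := abs_nonneg _
  set B := 1 + A / Real.log 2 with hB
  have hB1 : 1 ≤ B := by rw [hB]; have : 0 ≤ A / Real.log 2 := by positivity
                         linarith
  refine ⟨16 / Real.log 2 ^ 2 + 16 * 9 * 4 * B ^ 2 / a, by positivity, fun n k hn hk => ?_⟩
  have hn1 : (2 : ℝ) ≤ n := by exact_mod_cast hn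
  have hlogn : Real.log 2 ≤ Real.log n := Real.log_le_log (by norm_num) hn1
  have hlogn0 : 0 < Real.log n := by linarith
  have hsplit : (16 / Real.log 2 ^ 2 + 16 * 9 * 4 * B ^ 2 / a) * n * Real.log n ^ 2 =
      16 / Real.log 2 ^ 2 * n * Real.log n ^ 2 +
        16 * 9 * 4 * B ^ 2 / a * n * Real.log n ^ 2 := by ring
  have hpos1 : 0 ≤ 16 / Real.log 2 ^ 2 * n * Real.log n ^ 2 := by positivity
  have hpos2 : 0 ≤ 16 * 9 * 4 * B ^ 2 / a * n * Real.log n ^ 2 := by positivity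
  rw [hsplit]
  rcases Nat.lt_or_ge k 2 with hk2 | hk2
  · have h1 : (16 : ℝ) ^ k ≤ 16 := by
      calc (16 : ℝ) ^ k ≤ 16 ^ 1 := pow_le_pow_right₀ (by norm_num) (by omega)
        _ = 16 := by norm_num
    have h2 : 16 ≤ 16 / Real.log 2 ^ 2 * n * Real.log n ^ 2 := by
      calc (16 : ℝ) = 16 / Real.log 2 ^ 2 * 1 * Real.log 2 ^ 2 := by field_simp
        _ ≤ _ := by gcongr; linarith
    linarith
  · obtain ⟨j, rfl⟩ := Nat.exists_eq_add_of_le' (by omega : 1 ≤ k)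
    have hj : 1 ≤ j := by omega
    have h16j : (16 : ℝ) ≤ 16 ^ j := by
      simpa using pow_le_pow_right₀ (by norm_num : (1 : ℝ) ≤ 16) hj
    have h16n : 16 ≤ 16 ^ j := by exact_mod_cast h16j
    have h44 : (4 : ℕ) ^ j * 4 ^ j = 16 ^ j := by rw [← mul_pow]; norm_num
    have hw := hA (16 ^ j) (4 ^ j) (by omega)
      (by rw [← h44]; nlinarith [Nat.zero_le (4 ^ j)])
    have hwn : (walkLength (16 ^ j) (4 ^ j) : ℝ) ≤ n := by
      exact_mod_cast (walkLength_le_length_blocks j).trans hk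
    push_cast at hw
    have hlog16 : Real.log 16 ≤ 3 := by
      rw [show (16 : ℝ) = 2 ^ 4 by norm_num, Real.log_pow]
      have := Real.log_two_lt_d9
      push_cast
      linarith
    have hlog : Real.log ((16 : ℝ) ^ j + 1) ≤ 3 * (j + 1) := by
      calc Real.log ((16 : ℝ) ^ j + 1) ≤ Real.log (16 ^ (j + 1)) :=
            Real.log_le_log (by positivity) (by rw [pow_succ]; linarith)
        _ = (j + 1) * Real.log 16 := by rw [Real.log_pow]; push_cast; ring
        _ ≤ _ := by nlinarith
    have hlog0 : 0 < Real.log ((16 : ℝ) ^ j + 1) := Real.log_pos (by linarith)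
    have h1 : a * 16 ^ j ≤ n * (9 * (j + 1) ^ 2) := by
      have h2 := hw.trans hwn
      rw [← mul_div_assoc, div_le_iff₀ (by positivity)] at h2
      calc a * 16 ^ j ≤ a * (16 ^ j + 1) := by gcongr; linarith
        _ ≤ n * Real.log ((16 : ℝ) ^ j + 1) ^ 2 := h2
        _ ≤ n * (3 * (j + 1)) ^ 2 := by gcongr
        _ = _ := by ring
    have h2 : ((j : ℝ) + 1) ^ 2 ≤ 4 ^ j := by
      have h3 : j + 1 ≤ 2 ^ j := Nat.lt_pow_self (by norm_num)
      have h4 : ((j : ℝ) + 1) ≤ 2 ^ j := by exact_mod_cast h3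
      calc ((j : ℝ) + 1) ^ 2 ≤ (2 ^ j) ^ 2 := by gcongr
        _ = 4 ^ j := by rw [← pow_mul, mul_comm, pow_mul]; norm_num
    have h3 : a / 9 * 4 ^ j ≤ n := by
      have h4 : a * 16 ^ j ≤ n * (9 * 4 ^ j) := h1.trans (by gcongr)
      rw [show (16 : ℝ) ^ j = 4 ^ j * 4 ^ j by rw [← mul_pow]; norm_num] at h4
      have h5 : (0 : ℝ) < 4 ^ j := by positivity
      have h6 : a * 4 ^ j ≤ n * 9 := le_of_mul_le_mul_right (by linarith) h5
      linarith
    have h4 : (j : ℝ) ≤ B * Real.log n := by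
      have h5 := Real.log_le_log (by positivity) h3
      rw [Real.log_mul (by positivity) (by positivity), Real.log_pow] at h5
      have h6 : -A ≤ Real.log (a / 9) := neg_abs_le _
      have h7 : 1 ≤ Real.log 4 := by
        rw [show (4 : ℝ) = 2 ^ 2 by norm_num, Real.log_pow]
        have := Real.log_two_gt_d9
        push_cast
        linarith
      have h8 : A ≤ A / Real.log 2 * Real.log n := by
        rw [div_mul_eq_mul_div, le_div_iff₀ hlog2]
        gcongr
      have h9 : (j : ℝ) ≤ j * Real.log 4 := le_mul_of_one_le_right (by positivity) h7
      rw [hB]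
      linarith
    have hj1 : (1 : ℝ) ≤ j := by exact_mod_cast hj
    have h5 : ((j : ℝ) + 1) ^ 2 ≤ 4 * B ^ 2 * Real.log n ^ 2 := by
      calc ((j : ℝ) + 1) ^ 2 ≤ (2 * (B * Real.log n)) ^ 2 := by gcongr; linarith
        _ = _ := by ring
    have h6 : (16 : ℝ) ^ (j + 1) ≤ 16 * 9 * 4 * B ^ 2 / a * n * Real.log n ^ 2 := by
      have h7 : a * 16 ^ j ≤ n * (9 * (4 * B ^ 2 * Real.log n ^ 2)) := h1.trans (by gcongr)
      calc (16 : ℝ) ^ (j + 1) = 16 / a * (a * 16 ^ j) := by field_simp; ring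
        _ ≤ 16 / a * (n * (9 * (4 * B ^ 2 * Real.log n ^ 2))) := by gcongr
        _ = _ := by ring
    linarith

theorem lcm_permutation_nlogsq :
    ∃ c : ℝ, 0 < c ∧ ∃ f : ℕ+ → ℕ+, Function.Bijective f ∧
      ∀ n : ℕ+, 2 ≤ n →
        ((Nat.lcm (f n : ℕ) (f (n + 1) : ℕ) : ℕ) : ℝ) ≤
          c * ((n : ℕ) : ℝ) * (Real.log ((n : ℕ) : ℝ)) ^ 2 := by
  obtain ⟨C, hC0, hC⟩ := exists_sixteen_pow_le
  refine ⟨4 * C, by positivity, fun n => ⟨blockSeq (n - 1), blockSeq_pos _⟩, ⟨?_, ?_⟩, ?_⟩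
  · intro m n h
    have h1 := blockSeq_injective (congrArg PNat.val h)
    have := m.pos
    have := n.pos
    exact PNat.eq (by omega)
  · intro m
    obtain ⟨i, hi⟩ := exists_blockSeq_eq m.pos
    exact ⟨i.succPNat, PNat.eq (by simpa using hi)⟩
  · intro n hn
    have hn' : 2 ≤ (n : ℕ) := by exact_mod_cast hn
    obtain ⟨k, hk, hlcm⟩ := exists_lcm_blockSeq_le n (by omega)
    have h1 := hC n k hn' hk
    have h2 : ((Nat.lcm (blockSeq (n - 1)) (blockSeq n) : ℕ) : ℝ) ≤ 4 * 16 ^ k := by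
      exact_mod_cast hlcm
    simp only [PNat.mk_coe, PNat.add_coe, PNat.one_coe, Nat.add_sub_cancel]
    linarith
end

section
/- There is a constant c > 0 such that for every prime p, the number of squarefree integers m with F(m) ≤ p² is at least c · p² / log p. -/
def Fdiv (n : ℕ) : ℕ :=
  if n = 1 then 1 else (n.divisors.filter (fun d => 1 < d)).sup (fun d => d * d.minFac)

open Classical in
/-- The integers in `(0, z]` in which every prime `q ≥ y` has even exponent. -/
noncomputable def evenTailSet (z y : ℕ) : Finset ℕ :=
  (Finset.Ioc 0 z).filter fun n => ∀ q, q.Prime → y ≤ q → Even (n.factorization q)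

/-- The number of integers in `(0, z]` in which every prime `q ≥ y` has even exponent. -/
noncomputable def evenTailCount (z y : ℕ) : ℕ :=
  (evenTailSet z y).card

lemma mem_evenTailSet {z y n : ℕ} : n ∈ evenTailSet z y ↔
    (0 < n ∧ n ≤ z) ∧ ∀ q, q.Prime → y ≤ q → Even (n.factorization q) := by
  simp [evenTailSet]

/-- A finite set `S` all of whose upper segments, multiplied by their least element, have
product at most `x`. -/
def DenseSet (x : ℕ) (S : Finset ℕ) : Prop :=
  ∀ e ∈ S, e * ∏ a ∈ S with e ≤ a, a ≤ x

open Classical in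
/-- The sets of primes below `y` that satisfy `DenseSet x`. -/
noncomputable def denseFamily (x y : ℕ) : Finset (Finset ℕ) :=
  ((Finset.range y).filter Nat.Prime).powerset.filter (DenseSet x)

lemma mem_denseFamily {x y : ℕ} {S : Finset ℕ} :
    S ∈ denseFamily x y ↔ (∀ q ∈ S, q < y ∧ q.Prime) ∧ DenseSet x S := by
  simp [denseFamily, Finset.subset_iff]

lemma evenTailCount_of_lt {z y : ℕ} (h : z < y) : evenTailCount z y = z := by
  have : evenTailSet z y = Finset.Ioc 0 z := by
    ext n
    rw [mem_evenTailSet, Finset.mem_Ioc, and_iff_left_iff_imp]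
    intro hn q _ hyq
    rw [Nat.factorization_eq_zero_of_lt (by lia)]
    exact Even.zero
  rw [evenTailCount, this]
  simp

lemma evenTailCount_le (z y : ℕ) : evenTailCount z y ≤ z := by
  classical
  exact (Finset.card_filter_le _ _).trans (by simp)

lemma evenTailCount_zero (z : ℕ) : evenTailCount z 0 = z.sqrt := by
  have : evenTailSet z 0 = (Finset.Ioc 0 z.sqrt).image (fun k => k ^ 2) := by
    ext n
    simp only [mem_evenTailSet, Finset.mem_Ioc, Finset.mem_image]
    constructor
    · rintro ⟨⟨h0, hz⟩, h⟩
      have hsq : (∏ p ∈ n.primeFactors, p ^ (n.factorization p / 2)) ^ 2 = n := by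
        conv_rhs => rw [← Nat.prod_factorization_pow_eq_self h0.ne']
        rw [Finsupp.prod, Nat.support_factorization, ← Finset.prod_pow]
        refine Finset.prod_congr rfl fun p hp => ?_
        rw [← pow_mul, Nat.div_mul_cancel
          (even_iff_two_dvd.1 (h p (Nat.prime_of_mem_primeFactors hp) (Nat.zero_le _)))]
      refine ⟨_, ⟨?_, ?_⟩, hsq⟩
      · exact Finset.prod_pos fun p hp => pow_pos (Nat.prime_of_mem_primeFactors hp).pos _
      · rw [Nat.le_sqrt', hsq]; exact hz
    · rintro ⟨k, ⟨h0, hk⟩, rfl⟩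
      refine ⟨⟨by positivity, Nat.le_sqrt'.1 hk⟩, fun q _ _ => ?_⟩
      simp
  rw [evenTailCount, this, Finset.card_image_of_injective _ (Nat.pow_left_injective (by norm_num))]
  simp

lemma evenTailCount_succ_of_not_prime {z y : ℕ} (hy : ¬ y.Prime) :
    evenTailCount z (y + 1) = evenTailCount z y := by
  unfold evenTailCount
  congr 1
  ext n
  simp only [mem_evenTailSet, and_congr_right_iff]
  refine fun _ => forall_congr' fun q => imp_congr_right fun hq => ?_
  have : q ≠ y := by rintro rfl; exact hy hq
  have : y + 1 ≤ q ↔ y ≤ q := by lia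
  rw [this]

lemma evenTailCount_succ_of_prime {z y : ℕ} (hy : y.Prime) :
    evenTailCount z (y + 1) = evenTailCount z y + evenTailCount (z / y) y := by
  classical
  unfold evenTailCount
  have hfac : ∀ m : ℕ, 0 < m → ∀ q, (y * m).factorization q
      = (if q = y then 1 else 0) + m.factorization q := by
    intro m hm q
    rw [Nat.factorization_mul hy.ne_zero hm.ne', Finsupp.add_apply, hy.factorization,
      Finsupp.single_apply]
    simp only [eq_comm]
  rw [← Finset.card_image_of_injective (evenTailSet (z / y) y)
    (mul_right_injective₀ hy.ne_zero), ← Finset.card_union_of_disjoint]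
  · congr 1
    ext n
    simp only [Finset.mem_union, mem_evenTailSet, Finset.mem_image]
    constructor
    · rintro ⟨⟨h0, hz⟩, h⟩
      by_cases hev : Even (n.factorization y)
      · left
        refine ⟨⟨h0, hz⟩, fun q hq hyq => ?_⟩
        rcases hyq.eq_or_lt with rfl | hlt
        · exact hev
        · exact h q hq hlt
      · right
        have hdvd : y ∣ n := by
          by_contra hnd
          rw [Nat.factorization_eq_zero_of_not_dvd hnd] at hev
          exact hev Even.zero
        obtain ⟨m, rfl⟩ := hdvd
        have hm : 0 < m := Nat.pos_of_mul_pos_left h0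
        refine ⟨m, ⟨⟨hm, ?_⟩, fun q hq hyq => ?_⟩, rfl⟩
        · rw [Nat.le_div_iff_mul_le hy.pos, mul_comm]; exact hz
        · rcases hyq.eq_or_lt with rfl | hlt
          · rw [hfac m hm, if_pos rfl] at hev
            grind
          · have := h q hq hlt
            rwa [hfac m hm, if_neg hlt.ne', zero_add] at this
    · rintro (⟨⟨h0, hz⟩, h⟩ | ⟨m, ⟨⟨h0, hz⟩, h⟩, rfl⟩)
      · exact ⟨⟨h0, hz⟩, fun q hq hyq => h q hq (by lia)⟩
      · refine ⟨⟨Nat.mul_pos hy.pos h0, ?_⟩, fun q hq hyq => ?_⟩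
        · rw [Nat.le_div_iff_mul_le hy.pos, mul_comm] at hz; exact hz
        · rw [hfac m h0, if_neg (by lia), zero_add]
          exact h q hq (by lia)
  · rw [Finset.disjoint_left]
    simp only [mem_evenTailSet, Finset.mem_image, not_exists, not_and]
    rintro n ⟨-, h⟩ m ⟨⟨h0, hz⟩, h'⟩ rfl
    have h1 := h y hy le_rfl
    have h2 := h' y hy le_rfl
    rw [hfac m h0, if_pos rfl] at h1
    grind

lemma denseSet_insert_top {z y : ℕ} {S : Finset ℕ} (hyz : y * y ≤ z) (hS : DenseSet (z / y) S)
    (hlt : ∀ q ∈ S, q < y) : DenseSet z (insert y S) := by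
  have hyS : y ∉ S := fun h => (hlt y h).false
  rcases Nat.eq_zero_or_pos y with rfl | hy
  · intro e he
    simp only [Finset.mem_insert] at he
    rcases he with rfl | he
    · simp
    · exact absurd (hlt e he) (by simp)
  intro e he
  rw [Finset.mem_insert] at he
  rcases he with rfl | he
  · have : (insert e S).filter (e ≤ ·) = {e} := by
      ext a
      simp only [Finset.mem_filter, Finset.mem_insert, Finset.mem_singleton]
      constructor
      · rintro ⟨rfl | ha, h⟩
        · rfl
        · exact absurd (hlt a ha) (by lia)
      · rintro rfl; simp
    rw [this, Finset.prod_singleton]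
    exact hyz
  · have hey := hlt e he
    rw [Finset.filter_insert, if_pos hey.le, Finset.prod_insert (by simp [hyS])]
    have := hS e he
    rw [Nat.le_div_iff_mul_le hy] at this
    calc _ = (e * ∏ a ∈ S with e ≤ a, a) * y := by ring
      _ ≤ z := this

lemma sum_denseFamily_succ {z y : ℕ} (hy : y.Prime) (hyz : y * y ≤ z) :
    ∑ S ∈ denseFamily z y, (z / ∏ a ∈ S, a).sqrt
      + ∑ S ∈ denseFamily (z / y) y, (z / y / ∏ a ∈ S, a).sqrt
      ≤ ∑ S ∈ denseFamily z (y + 1), (z / ∏ a ∈ S, a).sqrt := by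
  classical
  have hnot : ∀ {w : ℕ} {S}, S ∈ denseFamily w y → y ∉ S := fun hS h =>
    ((mem_denseFamily.1 hS).1 y h).1.false
  have hinj : Set.InjOn (insert y) (denseFamily (z / y) y : Set (Finset ℕ)) := by
    intro S hS S' hS' h
    rw [← Finset.erase_insert (hnot hS), h, Finset.erase_insert (hnot hS')]
  have hsum : ∑ S ∈ denseFamily (z / y) y, (z / y / ∏ a ∈ S, a).sqrt
      = ∑ S ∈ (denseFamily (z / y) y).image (insert y), (z / ∏ a ∈ S, a).sqrt := by
    rw [Finset.sum_image hinj]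
    refine Finset.sum_congr rfl fun S hS => ?_
    rw [Finset.prod_insert (hnot hS), Nat.div_div_eq_div_mul]
  rw [hsum, ← Finset.sum_union]
  · refine Finset.sum_le_sum_of_subset fun S hS => ?_
    rw [Finset.mem_union, Finset.mem_image] at hS
    rw [mem_denseFamily]
    rcases hS with hS | ⟨S, hS, rfl⟩
    · rw [mem_denseFamily] at hS
      exact ⟨fun q hq => ⟨(hS.1 q hq).1.trans (Nat.lt_succ_self _), (hS.1 q hq).2⟩, hS.2⟩
    · rw [mem_denseFamily] at hS
      refine ⟨fun q hq => ?_, denseSet_insert_top hyz hS.2 fun q hq => (hS.1 q hq).1⟩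
      rw [Finset.mem_insert] at hq
      rcases hq with rfl | hq
      · exact ⟨Nat.lt_succ_self _, hy⟩
      · exact ⟨(hS.1 q hq).1.trans (Nat.lt_succ_self _), (hS.1 q hq).2⟩
  · rw [Finset.disjoint_left]
    rintro S hS hS'
    obtain ⟨S', -, rfl⟩ := Finset.mem_image.1 hS'
    exact hnot hS (Finset.mem_insert_self _ _)

lemma evenTailCount_add_card_le (y z : ℕ) :
    4 * evenTailCount (z / 4) y
        + ((Finset.range y).filter fun q => q.Prime ∧ z / 4 < q ∧ q ≤ z ∧ z < q * q).card
      ≤ evenTailCount z y + ∑ S ∈ denseFamily z y, (z / ∏ a ∈ S, a).sqrt := by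
  induction y generalizing z with
  | zero =>
    have h0 : denseFamily z 0 = {∅} := by
      ext S
      rw [mem_denseFamily, Finset.mem_singleton]
      constructor
      · rintro ⟨h, -⟩
        exact Finset.eq_empty_of_forall_notMem fun q hq => absurd (h q hq).1 (by simp)
      · rintro rfl
        simp [DenseSet]
    rw [h0, evenTailCount_zero, evenTailCount_zero]
    simp only [Finset.range_zero, Finset.filter_empty, Finset.card_empty, Finset.sum_singleton,
      Finset.prod_empty, Nat.div_one, add_zero]
    have : 2 * (z / 4).sqrt ≤ z.sqrt := by
      rw [Nat.le_sqrt']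
      have := Nat.sqrt_le' (z / 4)
      have := Nat.div_mul_le_self z 4
      nlinarith
    lia
  | succ y ih =>
    have hmono : ∑ S ∈ denseFamily z y, (z / ∏ a ∈ S, a).sqrt
        ≤ ∑ S ∈ denseFamily z (y + 1), (z / ∏ a ∈ S, a).sqrt := by
      refine Finset.sum_le_sum_of_subset fun S hS => ?_
      rw [mem_denseFamily] at hS ⊢
      exact ⟨fun q hq => ⟨(hS.1 q hq).1.trans (Nat.lt_succ_self _), (hS.1 q hq).2⟩, hS.2⟩
    have ihz := ih z
    rw [Finset.range_add_one, Finset.filter_insert]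
    by_cases hy : y.Prime
    · rw [evenTailCount_succ_of_prime hy, evenTailCount_succ_of_prime hy, Nat.div_right_comm]
      by_cases hyz : y * y ≤ z
      · rw [if_neg (by lia)]
        have h1 := sum_denseFamily_succ hy hyz
        have h2 := ih (z / y)
        lia
      · have hlt : z / y < y := by
          rw [Nat.div_lt_iff_lt_mul hy.pos]; lia
        rw [evenTailCount_of_lt hlt]
        have h3 := evenTailCount_le (z / y / 4) y
        split_ifs with hc
        · rw [Finset.card_insert_of_notMem (by simp)]
          have h4 : z / y < 4 := by
            rw [Nat.div_lt_iff_lt_mul hy.pos]; lia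
          have h5 : 0 < z / y := Nat.div_pos hc.2.2.1 hy.pos
          lia
        · lia
    · rw [evenTailCount_succ_of_not_prime hy, evenTailCount_succ_of_not_prime hy, if_neg (by tauto)]
      lia

lemma card_primes_le_sum_sqrt {x : ℕ} (hx : 16 ≤ x) :
    ((Finset.Ioc (x / 4) x).filter Nat.Prime).card
      ≤ 3 + ∑ S ∈ denseFamily x (x + 1), (x / ∏ a ∈ S, a).sqrt := by
  have h := evenTailCount_add_card_le (x + 1) x
  rw [evenTailCount_of_lt (by lia), evenTailCount_of_lt (by lia)] at h
  have hs : (Finset.Ioc (x / 4) x).filter Nat.Prime ⊆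
      (Finset.range (x + 1)).filter fun q => q.Prime ∧ x / 4 < q ∧ q ≤ x ∧ x < q * q := by
    intro q hq
    simp only [Finset.mem_filter, Finset.mem_Ioc, Finset.mem_range] at hq ⊢
    refine ⟨by lia, hq.2, hq.1.1, hq.1.2, ?_⟩
    have : x / 4 + 1 ≤ q := hq.1.1
    have h4 : x < 4 * (x / 4 + 1) := by lia
    have : 4 ≤ x / 4 := by lia
    nlinarith
  have := Finset.card_le_card hs
  lia

lemma eventually_le_log_mul_card_primes : ∃ N : ℕ, ∀ n : ℕ, N ≤ n →
    (n : ℝ) ≤ 4 * Real.log n * ((Finset.Ioc (n / 4) n).filter Nat.Prime).card := by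
  have hlog := (isLittleO_log_rpow_atTop (r := 1 / 2) (by norm_num)).bound
    (show (0 : ℝ) < 1 / 50 by norm_num)
  obtain ⟨N, hN⟩ := Filter.eventually_atTop.1
    ((tendsto_natCast_atTop_atTop (R := ℝ)).eventually hlog)
  refine ⟨max N 2, fun n hn => ?_⟩
  have hn2 : 2 ≤ n := (le_max_right _ _).trans hn
  have hnR : (2 : ℝ) ≤ n := by exact_mod_cast hn2
  have hl0 : 0 ≤ Real.log n := Real.log_natCast_nonneg n
  have h1 : Real.log n ≤ 1 / 50 * √n := by
    have := hN n ((le_max_left _ _).trans hn)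
    rwa [Real.norm_of_nonneg hl0, Real.norm_of_nonneg (by positivity), ← Real.sqrt_eq_rpow] at this
  have hs1 : 1 ≤ √(n : ℝ) := Real.one_le_sqrt.2 (by linarith)
  have hss : √(n : ℝ) * √n = n := Real.mul_self_sqrt (by linarith)
  have h2 : Real.log (n + 1) ≤ 2 * Real.log n := by
    rw [← Nat.cast_ofNat, ← Real.log_pow]
    exact Real.log_le_log (by linarith) (by nlinarith)
  have h3 := Chebyshev.theta_ge n
  have h4 := Chebyshev.theta_le_log4_mul_x (x := ((n / 4 : ℕ) : ℝ)) (by positivity)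
  have h5 : ((n / 4 : ℕ) : ℝ) ≤ n / 4 := Nat.cast_div_le
  have h6 : Real.log 4 = 2 * Real.log 2 := by
    rw [show (4 : ℝ) = 2 ^ 2 by norm_num, Real.log_pow]; norm_num
  have h7 : Chebyshev.theta n - Chebyshev.theta (n / 4 : ℕ)
      ≤ ((Finset.Ioc (n / 4) n).filter Nat.Prime).card * Real.log n := by
    have hsub : Finset.Ioc 0 (n / 4) ∪ Finset.Ioc (n / 4) n = Finset.Ioc 0 n :=
      Finset.Ioc_union_Ioc_eq_Ioc (Nat.zero_le _) (Nat.div_le_self n 4)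
    rw [Chebyshev.theta, Chebyshev.theta, Nat.floor_natCast, Nat.floor_natCast, ← hsub,
      Finset.filter_union, Finset.sum_union, add_sub_cancel_left, ← nsmul_eq_mul]
    · refine Finset.sum_le_card_nsmul _ _ _ fun p hp => ?_
      rw [Finset.mem_filter, Finset.mem_Ioc] at hp
      exact Real.log_le_log (by exact_mod_cast hp.2.pos) (by exact_mod_cast hp.1.2)
    · refine Finset.disjoint_filter_filter (Finset.disjoint_left.2 fun a ha hb => ?_)
      rw [Finset.mem_Ioc] at ha hb
      lia
  have h8 := Real.log_two_gt_d9
  have h9 : √(n : ℝ) * Real.log n ≤ 1 / 50 * n := by nlinarith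
  nlinarith

/-- The primes in the interval `(4 ^ k, 4 ^ (k + 1)]`. -/
def primeBlock (k : ℕ) : Finset ℕ :=
  (Finset.Ioc (4 ^ k) (4 ^ (k + 1))).filter Nat.Prime

lemma mem_primeBlock {k q : ℕ} :
    q ∈ primeBlock k ↔ (4 ^ k < q ∧ q ≤ 4 ^ (k + 1)) ∧ q.Prime := by
  simp [primeBlock]

lemma card_primeBlock_le (k : ℕ) : (primeBlock k).card ≤ 3 * 4 ^ k := by
  refine (Finset.card_filter_le _ _).trans ?_
  rw [Nat.card_Ioc, pow_succ]
  lia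

lemma exists_pow_le_card_primeBlock :
    ∃ K : ℕ, ∀ k, K ≤ k → 4 ^ k ≤ 2 * (k + 1) * (primeBlock k).card := by
  obtain ⟨N, hN⟩ := eventually_le_log_mul_card_primes
  refine ⟨N, fun k hk => ?_⟩
  have h := hN (4 ^ (k + 1)) (hk.trans ((Nat.lt_succ_self k).trans
    (Nat.lt_pow_self (by norm_num))).le)
  have hdiv : 4 ^ (k + 1) / 4 = 4 ^ k := by rw [pow_succ]; simp
  rw [hdiv, ← primeBlock] at h
  have h4 : Real.log 4 ≤ 2 := by
    rw [show (4 : ℝ) = 2 ^ 2 by norm_num, Real.log_pow]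
    have := Real.log_two_lt_d9
    norm_num; linarith
  push_cast at h
  rw [Real.log_pow, pow_succ] at h
  push_cast at h
  have h5 : ((k : ℝ) + 1) * (primeBlock k).card * Real.log 4
      ≤ ((k : ℝ) + 1) * (primeBlock k).card * 2 := by gcongr
  have : (4 : ℝ) ^ k ≤ 2 * (k + 1) * (primeBlock k).card := by nlinarith
  exact_mod_cast this

lemma DenseSet.mul_self_le {x e : ℕ} {S : Finset ℕ} (hS : DenseSet x S)
    (hprime : ∀ q ∈ S, q.Prime) (he : e ∈ S) : e * e ≤ x := by
  refine le_trans (Nat.mul_le_mul_left e ?_) (hS e he)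
  exact Nat.le_of_dvd (Finset.prod_pos fun a ha => (hprime a (Finset.mem_filter.1 ha).1).pos)
    (Finset.dvd_prod_of_mem (fun a => a) (Finset.mem_filter.2 ⟨he, le_rfl⟩))

lemma mem_denseFamily_succ_self {x : ℕ} {S : Finset ℕ} :
    S ∈ denseFamily x (x + 1) ↔ (∀ q ∈ S, q.Prime) ∧ DenseSet x S := by
  rw [mem_denseFamily]
  refine ⟨fun h => ⟨fun q hq => (h.1 q hq).2, h.2⟩, fun h => ⟨fun q hq => ⟨?_, h.1 q hq⟩, h.2⟩⟩
  exact Nat.lt_succ_of_le ((Nat.le_mul_self q).trans (h.2.mul_self_le h.1 hq))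

lemma prod_mul_prod_filter_le {S U : Finset ℕ} (hprime : ∀ q ∈ S, q.Prime) (hU : U ⊆ S)
    {e f : ℕ} (hfe : f ≤ e) (hfU : ∀ u ∈ U, f ≤ u) :
    (∏ u ∈ U, u) * ∏ a ∈ S \ U with e ≤ a, a ≤ ∏ a ∈ S with f ≤ a, a := by
  rw [← Finset.prod_union]
  · refine Finset.prod_le_prod_of_subset_of_one_le' (fun a ha => ?_) fun a ha _ =>
      (hprime a (Finset.mem_filter.1 ha).1).one_le
    simp only [Finset.mem_union, Finset.mem_filter, Finset.mem_sdiff] at ha ⊢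
    rcases ha with ha | ha
    · exact ⟨hU ha, hfU a ha⟩
    · exact ⟨ha.1.1, hfe.trans ha.2⟩
  · exact (Finset.sdiff_disjoint.mono_left (Finset.filter_subset _ _)).symm

/-- Replacing two of at least three elements of a block by one element of a suitable higher block
preserves density. -/
lemma DenseSet.swap {x k b c f q : ℕ} {S : Finset ℕ} (hS : DenseSet x S)
    (hprime : ∀ p ∈ S, p.Prime) (hk : 3 ≤ k)
    (hb : b ∈ S ∩ primeBlock k) (hc : c ∈ S ∩ primeBlock k) (hf : f ∈ S ∩ primeBlock k)
    (hbc : b ≠ c) (hfb : f ≠ b) (hfc : f ≠ c) (hq : q ∈ primeBlock (2 * k - 2) \ S) :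
    DenseSet x (insert q (S \ {b, c})) := by
  rw [Finset.mem_inter, mem_primeBlock] at hb hc hf
  rw [Finset.mem_sdiff, mem_primeBlock] at hq
  obtain ⟨i, rfl⟩ : ∃ i, k = i + 3 := ⟨k - 3, by lia⟩
  obtain ⟨⟨⟨hq1, hq2⟩, hqp⟩, hqS⟩ := hq
  obtain ⟨hbS, ⟨hb1, hb2⟩, hbp⟩ := hb
  obtain ⟨hcS, ⟨hc1, hc2⟩, hcp⟩ := hc
  obtain ⟨hfS, ⟨hf1, hf2⟩, hfp⟩ := hf
  rw [show 2 * (i + 3) - 2 = i + i + 4 by lia] at hq1 hq2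
  have hB : 1 ≤ 4 ^ i := Nat.one_le_pow _ _ (by norm_num)
  simp only [pow_succ, pow_add] at *
  generalize 4 ^ i = B at *
  have hbq : b < q := by nlinarith
  have hcq : c < q := by nlinarith
  intro e he
  rw [Finset.mem_insert] at he
  rcases lt_or_ge q e with hqe | hqe
  · have heS : e ∈ S := by
      rcases he with rfl | he
      · exact absurd hqe (lt_irrefl _)
      · exact (Finset.mem_sdiff.1 he).1
    have : (insert q (S \ {b, c})).filter (e ≤ ·) = S.filter (e ≤ ·) := by
      ext a
      simp only [Finset.mem_filter, Finset.mem_insert, Finset.mem_sdiff, Finset.mem_singleton]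
      grind
    rw [this]
    exact hS e heS
  rw [Finset.filter_insert, if_pos hqe, Finset.prod_insert (by simp [hqS])]
  rcases lt_or_ge (B * 4 * 4 * 4 * 4) e with hBe | hBe
  · set m := min b (min c f) with hm
    have hmS : m ∈ S := by
      rcases min_choice b (min c f) with h | h <;> rcases min_choice c f with h' | h' <;>
        rw [hm, h] <;> try rw [h']
      all_goals assumption
    have h1 := prod_mul_prod_filter_le (e := e) (f := m) hprime
      (show ({b, c, f} : Finset ℕ) ⊆ S by
        intro a ha; simp only [Finset.mem_insert, Finset.mem_singleton] at ha
        rcases ha with rfl | rfl | rfl <;> assumption) (by lia) (by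
        intro a ha; simp only [Finset.mem_insert, Finset.mem_singleton] at ha
        lia)
    have hset : (S \ {b, c}).filter (e ≤ ·) = (S \ {b, c, f}).filter (e ≤ ·) := by
      ext a
      simp only [Finset.mem_filter, Finset.mem_insert, Finset.mem_sdiff, Finset.mem_singleton]
      grind
    rw [Finset.prod_insert (by simp [hbc, hfb.symm]), Finset.prod_insert (by simp [hfc.symm]),
      Finset.prod_singleton] at h1
    rw [hset]
    have h2 := hS m hmS
    set P := ∏ a ∈ S \ {b, c, f} with e ≤ a, a
    have hm64 : B * 4 * 4 * 4 ≤ m := by lia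
    have h3 : (B * 4 * 4 * 4) * ((B * 4 * 4 * 4) * ((B * 4 * 4 * 4) * (B * 4 * 4 * 4)))
        ≤ m * (b * (c * f)) := by gcongr
    have h4 : e * q ≤ (B * B * 4 * 4 * 4 * 4 * 4) * (B * B * 4 * 4 * 4 * 4 * 4) := by
      have : e ≤ B * B * 4 * 4 * 4 * 4 * 4 := by lia
      have : q ≤ B * B * 4 * 4 * 4 * 4 * 4 := by lia
      gcongr
    calc e * (q * P) = (e * q) * P := by ring
      _ ≤ (m * (b * (c * f))) * P := by
        refine Nat.mul_le_mul_right _ (h4.trans (le_trans ?_ h3))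
        ring_nf
        lia
      _ = m * (b * (c * f) * P) := by ring
      _ ≤ m * _ := Nat.mul_le_mul_left _ h1
      _ ≤ x := h2
  · have heS : e ∈ S := by
      rcases he with rfl | he
      · nlinarith
      · exact (Finset.mem_sdiff.1 he).1
    set m := min e (min b c) with hm
    have hmS : m ∈ S := by
      rcases min_choice e (min b c) with h | h <;> rcases min_choice b c with h' | h' <;>
        rw [hm, h] <;> try rw [h']
      all_goals assumption
    have h1 := prod_mul_prod_filter_le (e := e) (f := m) hprime
      (show ({b, c} : Finset ℕ) ⊆ S by
        intro a ha; simp only [Finset.mem_insert, Finset.mem_singleton] at ha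
        rcases ha with rfl | rfl <;> assumption) (by lia) (by
        intro a ha; simp only [Finset.mem_insert, Finset.mem_singleton] at ha
        lia)
    rw [Finset.prod_insert (by simp [hbc]), Finset.prod_singleton] at h1
    have h2 := hS m hmS
    set P := ∏ a ∈ S \ {b, c} with e ≤ a, a
    have hbc2 : (B * 4 * 4 * 4) * (B * 4 * 4 * 4) ≤ b * c := by gcongr
    have h3 : e * q ≤ m * (b * c) := by
      rcases le_or_gt (B * 4 * 4 * 4) m with h | h
      · calc e * q ≤ (B * 4 * 4 * 4 * 4) * (B * B * 4 * 4 * 4 * 4 * 4) := by gcongr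
          _ ≤ (B * 4 * 4 * 4) * ((B * 4 * 4 * 4) * (B * 4 * 4 * 4)) := by ring_nf; lia
          _ ≤ _ := by gcongr
      · have hme : m = e := by lia
        rw [hme]
        exact Nat.mul_le_mul_left _ (by nlinarith)
    calc e * (q * P) = (e * q) * P := by ring
      _ ≤ (m * (b * c)) * P := Nat.mul_le_mul_right _ h3
      _ = m * (b * c * P) := by ring
      _ ≤ m * _ := Nat.mul_le_mul_left _ h1
      _ ≤ x := h2

/-- The second moment, over the dense sets, of the number of elements in a block. -/
noncomputable def blockMoment (x k : ℕ) : ℕ :=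
  ∑ S ∈ denseFamily x (x + 1), (S ∩ primeBlock k).card ^ 2

lemma sum_swap_le {x k : ℕ} (hk : 3 ≤ k) {G : Finset (Finset ℕ)}
    (hG : G ⊆ denseFamily x (x + 1)) (hG3 : ∀ S ∈ G, 3 ≤ (S ∩ primeBlock k).card) :
    ∑ S ∈ G, (S ∩ primeBlock k).offDiag.card * (primeBlock (2 * k - 2) \ S).card
      ≤ (primeBlock k).card ^ 2
        * ∑ S ∈ denseFamily x (x + 1), (S ∩ primeBlock (2 * k - 2)).card := by
  classical
  have h1 : ∑ S ∈ G, (S ∩ primeBlock k).offDiag.card * (primeBlock (2 * k - 2) \ S).card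
      = (G.sigma fun S => (S ∩ primeBlock k).offDiag ×ˢ (primeBlock (2 * k - 2) \ S)).card := by
    rw [Finset.card_sigma]
    exact Finset.sum_congr rfl fun S _ => (Finset.card_product _ _).symm
  have h2 : (primeBlock k).card ^ 2
        * ∑ S ∈ denseFamily x (x + 1), (S ∩ primeBlock (2 * k - 2)).card
      = ((denseFamily x (x + 1)).sigma fun S =>
        (primeBlock k ×ˢ primeBlock k) ×ˢ (S ∩ primeBlock (2 * k - 2))).card := by
    rw [Finset.card_sigma, Finset.mul_sum]
    refine Finset.sum_congr rfl fun S _ => ?_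
    rw [Finset.card_product, Finset.card_product, sq]
  rw [h1, h2]
  refine Finset.card_le_card_of_injOn
    (fun t => ⟨insert t.2.2 (t.1 \ {t.2.1.1, t.2.1.2}), t.2⟩) ?_ ?_
  · rintro ⟨S, ⟨b, c⟩, q⟩ ht
    simp only [Finset.coe_sigma, Set.mem_sigma_iff, Finset.mem_coe, Finset.mem_product,
      Finset.mem_offDiag] at ht ⊢
    obtain ⟨hS, ⟨hb, hc, hbc⟩, hq⟩ := ht
    have hSA := mem_denseFamily_succ_self.1 (hG hS)
    obtain ⟨f, hf, hfbc⟩ : ∃ f ∈ S ∩ primeBlock k, f ∉ ({b, c} : Finset ℕ) := by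
      refine Finset.exists_mem_notMem_of_card_lt_card ?_
      rw [Finset.card_pair hbc]
      exact hG3 S hS
    simp only [Finset.mem_insert, Finset.mem_singleton, not_or] at hfbc
    rw [mem_denseFamily_succ_self]
    refine ⟨⟨fun p hp => ?_, hSA.2.swap hSA.1 hk hb hc hf hbc hfbc.1 hfbc.2 hq⟩,
      ⟨(Finset.mem_inter.1 hb).2, (Finset.mem_inter.1 hc).2⟩,
      Finset.mem_inter.2 ⟨Finset.mem_insert_self _ _, (Finset.mem_sdiff.1 hq).1⟩⟩
    rcases Finset.mem_insert.1 hp with rfl | hp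
    · exact (mem_primeBlock.1 (Finset.mem_sdiff.1 hq).1).2
    · exact hSA.1 p (Finset.mem_sdiff.1 hp).1
  · rintro ⟨S, ⟨b, c⟩, q⟩ ht ⟨S', ⟨b', c'⟩, q'⟩ ht' h
    simp only [Finset.coe_sigma, Set.mem_sigma_iff, Finset.mem_coe, Finset.mem_product,
      Finset.mem_offDiag, Finset.mem_inter, Finset.mem_sdiff] at ht ht'
    simp only [Sigma.mk.injEq, heq_eq_eq, Prod.mk.injEq] at h
    obtain ⟨h, ⟨rfl, rfl⟩, rfl⟩ := h
    have : S = S' := by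
      ext a
      have := Finset.ext_iff.1 h a
      simp only [Finset.mem_insert, Finset.mem_sdiff, Finset.mem_singleton] at this
      grind
    rw [this]

lemma card_primeBlock_mul_blockMoment_le {x k : ℕ} (hk : 3 ≤ k) :
    (primeBlock (2 * k - 2)).card * blockMoment x k
      ≤ 4 * (primeBlock (2 * k - 2)).card * (denseFamily x (x + 1)).card
        + 5 * (primeBlock k).card ^ 2
          * ∑ S ∈ denseFamily x (x + 1), (S ∩ primeBlock (2 * k - 2)).card := by
  classical
  have h := sum_swap_le (G := (denseFamily x (x + 1)).filter fun S =>
    3 ≤ (S ∩ primeBlock k).card ∧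
      2 * (S ∩ primeBlock (2 * k - 2)).card < (primeBlock (2 * k - 2)).card) hk
    (Finset.filter_subset _ _) fun S hS => (Finset.mem_filter.1 hS).2.1
  rw [Finset.sum_filter] at h
  have hpt : ∀ S ∈ denseFamily x (x + 1),
      (primeBlock (2 * k - 2)).card * (S ∩ primeBlock k).card ^ 2
      ≤ 4 * (primeBlock (2 * k - 2)).card
        + 2 * (primeBlock k).card ^ 2 * (S ∩ primeBlock (2 * k - 2)).card
        + 3 * if 3 ≤ (S ∩ primeBlock k).card ∧
            2 * (S ∩ primeBlock (2 * k - 2)).card < (primeBlock (2 * k - 2)).card then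
          (S ∩ primeBlock k).offDiag.card * (primeBlock (2 * k - 2) \ S).card else 0 := by
    intro S _
    have hle : (S ∩ primeBlock k).card ≤ (primeBlock k).card :=
      Finset.card_le_card Finset.inter_subset_right
    have hsd : (primeBlock (2 * k - 2) \ S).card + (S ∩ primeBlock (2 * k - 2)).card
        = (primeBlock (2 * k - 2)).card := by
      rw [Finset.inter_comm]; exact Finset.card_sdiff_add_card_inter _ _
    rw [Finset.offDiag_card]
    generalize (primeBlock (2 * k - 2) \ S).card = r at *
    generalize (S ∩ primeBlock (2 * k - 2)).card = v at *
    generalize (primeBlock (2 * k - 2)).card = p at *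
    generalize (S ∩ primeBlock k).card = w at *
    generalize (primeBlock k).card = y at *
    split_ifs with hc
    · obtain ⟨u, rfl⟩ : ∃ u, w = u + 1 := ⟨w - 1, by lia⟩
      rw [show (u + 1) * (u + 1) - (u + 1) = (u + 1) * u by
        rw [Nat.mul_succ, Nat.add_sub_cancel]]
      have h1 : (u + 1) * 2 ≤ 3 * u := by lia
      have h2 : p ≤ 2 * r := by lia
      have h3 : ((u + 1) * 2) * p ≤ (3 * u) * (2 * r) := Nat.mul_le_mul h1 h2
      have h4 : (u + 1) * (((u + 1) * 2) * p) ≤ (u + 1) * ((3 * u) * (2 * r)) :=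
        Nat.mul_le_mul_left _ h3
      nlinarith
    · rcases Nat.lt_or_ge w 3 with hw | hw
      · have : w ^ 2 ≤ 2 ^ 2 := Nat.pow_le_pow_left (by lia) 2
        nlinarith
      · have h1 : p ≤ 2 * v := by
          by_contra h; exact hc ⟨hw, by lia⟩
        have h2 : w ^ 2 ≤ y ^ 2 := Nat.pow_le_pow_left hle 2
        have h3 := Nat.mul_le_mul h1 h2
        nlinarith
  have hs := Finset.sum_le_sum hpt
  rw [Finset.sum_add_distrib, Finset.sum_add_distrib, Finset.sum_const, smul_eq_mul,
    ← Finset.mul_sum, ← Finset.mul_sum, ← Finset.mul_sum] at hs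
  rw [blockMoment]
  nlinarith

lemma blockMoment_eq_zero {x k : ℕ} (hk : x ≤ k) : blockMoment x k = 0 := by
  refine Finset.sum_eq_zero fun S hS => ?_
  have : S ∩ primeBlock k = ∅ := by
    refine Finset.eq_empty_of_forall_notMem fun q hq => ?_
    rw [Finset.mem_inter, mem_primeBlock] at hq
    have h1 := ((mem_denseFamily.1 hS).1 q hq.1).1
    have h2 : k < 4 ^ k := Nat.lt_pow_self (by norm_num)
    lia
  simp [this]

lemma eight_mul_blockMoment_le {K x k : ℕ}
    (hK : ∀ k, K ≤ k → 4 ^ k ≤ 2 * (k + 1) * (primeBlock k).card) (hk : 3 ≤ k) (hKk : K ≤ k) :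
    8 * blockMoment x k
      ≤ blockMoment x (2 * k - 2) + 2 ^ 28 * k ^ 2 * (denseFamily x (x + 1)).card := by
  have h := card_primeBlock_mul_blockMoment_le (x := x) hk
  have h1 : (primeBlock k).card ^ 2 ≤ 576 * k * (primeBlock (2 * k - 2)).card := by
    have h2 := Nat.pow_le_pow_left (card_primeBlock_le k) 2
    have h3 := hK (2 * k - 2) (by lia)
    have h4 : 4 ^ (2 * k - 2) * 16 = (4 ^ k) ^ 2 := by
      rw [show (16 : ℕ) = 4 ^ 2 by norm_num, ← pow_add, ← pow_mul]
      congr 1; lia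
    have h5 : 2 * (2 * k - 2 + 1) * (primeBlock (2 * k - 2)).card
        ≤ 4 * k * (primeBlock (2 * k - 2)).card := Nat.mul_le_mul_right _ (by lia)
    nlinarith
  have hpos : 0 < (primeBlock (2 * k - 2)).card := by
    refine Nat.pos_of_ne_zero fun h0 => ?_
    have h3 := hK (2 * k - 2) (by lia)
    rw [h0, mul_zero] at h3
    exact absurd h3 (by simp)
  have h2 : blockMoment x k ≤ 4 * (denseFamily x (x + 1)).card
      + 2880 * k * ∑ S ∈ denseFamily x (x + 1), (S ∩ primeBlock (2 * k - 2)).card := by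
    refine Nat.le_of_mul_le_mul_left (h.trans ?_) hpos
    have := Nat.mul_le_mul_right
      (∑ S ∈ denseFamily x (x + 1), (S ∩ primeBlock (2 * k - 2)).card) h1
    nlinarith
  have h3 : 8 * (2880 * k * ∑ S ∈ denseFamily x (x + 1), (S ∩ primeBlock (2 * k - 2)).card)
      ≤ blockMoment x (2 * k - 2)
        + 16 * 2880 ^ 2 * k ^ 2 * (denseFamily x (x + 1)).card := by
    rw [blockMoment, Finset.mul_sum, Finset.mul_sum, mul_comm _ (Finset.card _),
      ← smul_eq_mul (Finset.card _),
      ← Finset.sum_const, ← Finset.sum_add_distrib]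
    refine Finset.sum_le_sum fun S _ => ?_
    generalize (S ∩ primeBlock (2 * k - 2)).card = w
    zify
    nlinarith [sq_nonneg ((w : ℤ) - 4 * (2880 * k))]
  have h4 : (denseFamily x (x + 1)).card ≤ k ^ 2 * (denseFamily x (x + 1)).card :=
    Nat.le_mul_of_pos_left _ (by positivity)
  nlinarith

lemma blockMoment_le {K x k : ℕ}
    (hK : ∀ k, K ≤ k → 4 ^ k ≤ 2 * (k + 1) * (primeBlock k).card) (hk : 3 ≤ k) (hKk : K ≤ k) :
    blockMoment x k ≤ 2 ^ 26 * k ^ 2 * (denseFamily x (x + 1)).card := by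
  induction h : x - k using Nat.strong_induction_on generalizing k with
  | _ n ih =>
    rcases le_or_gt x k with hxk | hxk
    · rw [blockMoment_eq_zero hxk]; exact Nat.zero_le _
    · have h1 := ih (x - (2 * k - 2)) (by lia) (k := 2 * k - 2) (by lia) (by lia) rfl
      have h2 := eight_mul_blockMoment_le (x := x) hK hk hKk
      have h3 : (2 * k - 2) ^ 2 ≤ (2 * k) ^ 2 := Nat.pow_le_pow_left (by lia) 2
      have h4 := Nat.mul_le_mul_right (denseFamily x (x + 1)).card h3
      nlinarith

lemma DenseSet.insert_insert {x k b c : ℕ} {S : Finset ℕ} (hS : DenseSet x S)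
    (hprime : ∀ p ∈ S, p.Prime) (hb : b ∈ primeBlock k \ S) (hc : c ∈ primeBlock k \ S)
    (hbc : b ≠ c) (hx : 64 ^ (k + 1) * ∏ a ∈ S, a ≤ x) :
    DenseSet x (insert b (insert c S)) := by
  rw [Finset.mem_sdiff, mem_primeBlock] at hb hc
  obtain ⟨⟨⟨-, hb2⟩, hbp⟩, hbS⟩ := hb
  obtain ⟨⟨⟨-, hc2⟩, hcp⟩, hcS⟩ := hc
  have hp : ∀ p ∈ insert b (insert c S), p.Prime := by
    intro p hp
    simp only [Finset.mem_insert] at hp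
    rcases hp with rfl | rfl | hp
    exacts [hbp, hcp, hprime p hp]
  intro e he
  rcases le_or_gt e (4 ^ (k + 1)) with h | h
  · have h1 : ∏ a ∈ insert b (insert c S) with e ≤ a, a ≤ b * (c * ∏ a ∈ S, a) := by
      rw [← Finset.prod_insert (f := fun a => a) hcS,
        ← Finset.prod_insert (f := fun a => a) (by simp [hbc, hbS])]
      exact Finset.prod_le_prod_of_subset_of_one_le' (Finset.filter_subset _ _)
        fun a ha _ => (hp a ha).one_le
    calc _ ≤ 4 ^ (k + 1) * (4 ^ (k + 1) * (4 ^ (k + 1) * ∏ a ∈ S, a)) := by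
          refine Nat.mul_le_mul h (h1.trans ?_)
          gcongr
      _ = 64 ^ (k + 1) * ∏ a ∈ S, a := by
          rw [show (64 : ℕ) = 4 * (4 * 4) by norm_num, mul_pow, mul_pow]; ring
      _ ≤ x := hx
  · rw [Finset.filter_insert, if_neg (by lia), Finset.filter_insert, if_neg (by lia)]
    simp only [Finset.mem_insert] at he
    rcases he with rfl | rfl | he
    · lia
    · lia
    · exact hS e he

lemma sum_insert_le {x k : ℕ} {G : Finset (Finset ℕ)} (hG : G ⊆ denseFamily x (x + 1))
    (hGx : ∀ S ∈ G, 64 ^ (k + 1) * ∏ a ∈ S, a ≤ x) :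
    ∑ S ∈ G, (primeBlock k \ S).offDiag.card ≤ blockMoment x k := by
  classical
  have h2 : blockMoment x k = ((denseFamily x (x + 1)).sigma fun S =>
      (S ∩ primeBlock k) ×ˢ (S ∩ primeBlock k)).card := by
    rw [Finset.card_sigma]
    refine Finset.sum_congr rfl fun S _ => ?_
    rw [Finset.card_product, sq]
  rw [h2, ← Finset.card_sigma]
  refine Finset.card_le_card_of_injOn (fun t => ⟨insert t.2.1 (insert t.2.2 t.1), t.2⟩) ?_ ?_
  · rintro ⟨S, b, c⟩ ht
    simp only [Finset.coe_sigma, Set.mem_sigma_iff, Finset.mem_coe, Finset.mem_product,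
      Finset.mem_offDiag] at ht ⊢
    obtain ⟨hS, hb, hc, hbc⟩ := ht
    have hSA := mem_denseFamily_succ_self.1 (hG hS)
    have hb' := (Finset.mem_sdiff.1 hb).1
    have hc' := (Finset.mem_sdiff.1 hc).1
    rw [mem_denseFamily_succ_self]
    refine ⟨⟨fun p hp => ?_, hSA.2.insert_insert hSA.1 hb hc hbc (hGx S hS)⟩, by simp [hb'],
      by simp [hc']⟩
    simp only [Finset.mem_insert] at hp
    rcases hp with rfl | rfl | hp
    exacts [(mem_primeBlock.1 hb').2, (mem_primeBlock.1 hc').2, hSA.1 p hp]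
  · rintro ⟨S, b, c⟩ ht ⟨S', b', c'⟩ ht' h
    simp only [Finset.coe_sigma, Set.mem_sigma_iff, Finset.mem_coe,
      Finset.mem_offDiag, Finset.mem_sdiff] at ht ht'
    simp only [Sigma.mk.injEq, heq_eq_eq, Prod.mk.injEq] at h
    obtain ⟨h, rfl, rfl⟩ := h
    have : S = S' := by
      ext a
      have := Finset.ext_iff.1 h a
      simp only [Finset.mem_insert] at this
      grind
    rw [this]

lemma card_mul_sq_card_primeBlock_le {x k : ℕ} (hk : 4 ≤ (primeBlock k).card)
    {G : Finset (Finset ℕ)} (hG : G ⊆ denseFamily x (x + 1))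
    (hGx : ∀ S ∈ G, 64 ^ (k + 1) * ∏ a ∈ S, a ≤ x) :
    G.card * (primeBlock k).card ^ 2 ≤ 12 * blockMoment x k := by
  have h1 := sum_insert_le hG hGx
  have h2 : ∑ S ∈ G, (S ∩ primeBlock k).card ^ 2 ≤ blockMoment x k :=
    Finset.sum_le_sum_of_subset hG
  have h3 : ∑ S ∈ G, (primeBlock k).card ^ 2
      ≤ ∑ S ∈ G, (4 * (S ∩ primeBlock k).card ^ 2 + 8 * (primeBlock k \ S).offDiag.card) := by
    refine Finset.sum_le_sum fun S _ => ?_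
    have hsd : (primeBlock k \ S).card + (S ∩ primeBlock k).card = (primeBlock k).card := by
      rw [Finset.inter_comm]; exact Finset.card_sdiff_add_card_inter _ _
    rw [Finset.offDiag_card]
    generalize (primeBlock k \ S).card = r at *
    generalize (S ∩ primeBlock k).card = w at *
    generalize (primeBlock k).card = y at *
    rcases le_or_gt y (2 * w) with h | h
    · have := Nat.pow_le_pow_left h 2
      nlinarith
    · obtain ⟨u, rfl⟩ : ∃ u, r = u + 2 := ⟨r - 2, by lia⟩
      rw [show (u + 2) * (u + 2) - (u + 2) = (u + 2) * (u + 1) by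
        rw [Nat.mul_succ (u + 2) (u + 1), Nat.add_sub_cancel]]
      have := Nat.pow_le_pow_left (show y ≤ 2 * (u + 2) by lia) 2
      nlinarith
  rw [Finset.sum_const, smul_eq_mul, Finset.sum_add_distrib, ← Finset.mul_sum,
    ← Finset.mul_sum] at h3
  lia

lemma exists_sum_sqrt_le : ∃ C : ℝ, 0 ≤ C ∧ ∀ x : ℕ,
    ((∑ S ∈ denseFamily x (x + 1), (x / ∏ a ∈ S, a).sqrt : ℕ) : ℝ)
      ≤ C * (denseFamily x (x + 1)).card := by
  classical
  obtain ⟨K₀, hK₀⟩ := exists_pow_le_card_primeBlock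
  set K := max K₀ 3
  have hsum : Summable fun k : ℕ => 2 ^ 39 * (((k + 1 : ℕ) : ℝ) ^ 4 * (1 / 2) ^ (k + 1)) :=
    ((summable_nat_add_iff 1).2
      (summable_pow_mul_geometric_of_norm_lt_one 4 (r := (1 / 2 : ℝ)) (by norm_num))).mul_left _
  have hnn : ∀ k : ℕ, 0 ≤ (2 : ℝ) ^ 39 * (((k + 1 : ℕ) : ℝ) ^ 4 * (1 / 2) ^ (k + 1)) :=
    fun k => by positivity
  refine ⟨8 ^ (K + 1) + ∑' k : ℕ, 2 ^ 39 * (((k + 1 : ℕ) : ℝ) ^ 4 * (1 / 2) ^ (k + 1)),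
    add_nonneg (by positivity) (tsum_nonneg hnn), fun x => ?_⟩
  let L : ℕ → Finset (Finset ℕ) := fun k => (denseFamily x (x + 1)).filter fun S =>
    64 ^ (k + 1) ≤ x / ∏ a ∈ S, a ∧ x / ∏ a ∈ S, a < 64 ^ (k + 2)
  have hL : ∀ k, K ≤ k → ((8 ^ (k + 2) * (L k).card : ℕ) : ℝ)
      ≤ 2 ^ 39 * (((k + 1 : ℕ) : ℝ) ^ 4 * (1 / 2) ^ (k + 1))
        * (denseFamily x (x + 1)).card := by
    intro k hk
    have hk3 : 3 ≤ k := (le_max_right _ _).trans hk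
    have hk0 : K₀ ≤ k := (le_max_left _ _).trans hk
    have h1 := hK₀ k hk0
    have hcard : 4 ≤ (primeBlock k).card := by
      by_contra! h
      have h2 : ∀ m, 3 ≤ m → 6 * (m + 1) < 4 ^ m := by
        intro m hm
        induction m, hm using Nat.le_induction with
        | base => norm_num
        | succ m _ ih => rw [pow_succ]; lia
      have h3 := h2 k hk3
      have h4 : 2 * (k + 1) * (primeBlock k).card ≤ 2 * (k + 1) * 3 :=
        Nat.mul_le_mul_left _ (by lia)
      lia
    have h2 := card_mul_sq_card_primeBlock_le (x := x) (G := L k) hcard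
      (Finset.filter_subset _ _) fun S hS =>
        Nat.mul_le_of_le_div _ _ _ (Finset.mem_filter.1 hS).2.1
    have h3 := blockMoment_le (x := x) hK₀ hk3 hk0
    have h4 := Nat.pow_le_pow_left h1 2
    have h5 : (L k).card * 16 ^ k ≤ 2 ^ 32 * (k + 1) ^ 4 * (denseFamily x (x + 1)).card := by
      calc (L k).card * 16 ^ k = (L k).card * (4 ^ k) ^ 2 := by
            rw [← pow_mul, mul_comm k, pow_mul]; norm_num
        _ ≤ (L k).card * (2 * (k + 1) * (primeBlock k).card) ^ 2 := Nat.mul_le_mul_left _ h4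
        _ = 4 * (k + 1) ^ 2 * ((L k).card * (primeBlock k).card ^ 2) := by ring
        _ ≤ 4 * (k + 1) ^ 2 * (12 * (2 ^ 26 * (k + 1) ^ 2 * (denseFamily x (x + 1)).card)) := by
            refine Nat.mul_le_mul_left _ (h2.trans (Nat.mul_le_mul_left _ (h3.trans ?_)))
            gcongr
            lia
        _ = 48 * 2 ^ 26 * ((k + 1) ^ 4 * (denseFamily x (x + 1)).card) := by ring
        _ ≤ 2 ^ 32 * ((k + 1) ^ 4 * (denseFamily x (x + 1)).card) :=
            Nat.mul_le_mul_right _ (by norm_num)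
        _ = _ := by ring
    have h6 : ((L k).card : ℝ) * 16 ^ k
        ≤ 2 ^ 32 * ((k + 1 : ℕ) : ℝ) ^ 4 * (denseFamily x (x + 1)).card := by exact_mod_cast h5
    have h7 : (16 : ℝ) ^ k * (1 / 2) ^ k = 8 ^ k := by rw [← mul_pow]; norm_num
    calc ((8 ^ (k + 2) * (L k).card : ℕ) : ℝ)
        = 64 * (1 / 2) ^ k * ((L k).card * 16 ^ k) := by
          push_cast; rw [pow_add, ← h7]; ring
      _ ≤ 64 * (1 / 2) ^ k * (2 ^ 32 * ((k + 1 : ℕ) : ℝ) ^ 4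
          * (denseFamily x (x + 1)).card) := by gcongr
      _ = _ := by rw [pow_succ (1 / 2 : ℝ)]; ring
  have hpt : ∀ S ∈ denseFamily x (x + 1), (x / ∏ a ∈ S, a).sqrt
      ≤ 8 ^ (K + 1) + ∑ k ∈ Finset.Ico K x, if 64 ^ (k + 1) ≤ x / ∏ a ∈ S, a ∧
        x / ∏ a ∈ S, a < 64 ^ (k + 2) then 8 ^ (k + 2) else 0 := by
    intro S _
    have hvx : x / ∏ a ∈ S, a ≤ x := Nat.div_le_self _ _
    generalize x / ∏ a ∈ S, a = v at *
    have hsq : ∀ l, v < 64 ^ l → v.sqrt ≤ 8 ^ l := by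
      intro l hl
      refine (Nat.sqrt_lt'.2 ?_).le
      rwa [← pow_mul, mul_comm, pow_mul]
    rcases lt_or_ge v (64 ^ (K + 1)) with h | h
    · exact (hsq _ h).trans (Nat.le_add_right _ _)
    · have hv : v ≠ 0 := by
        have : 0 < 64 ^ (K + 1) := by positivity
        lia
      have h1 := Nat.pow_log_le_self 64 hv
      have h2 := Nat.lt_pow_succ_log_self (b := 64) (by norm_num) v
      have h3 : K + 1 ≤ Nat.log 64 v := Nat.le_log_of_pow_le (by norm_num) h
      have h4 : Nat.log 64 v < 64 ^ Nat.log 64 v := Nat.lt_pow_self (by norm_num)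
      obtain ⟨k, hk⟩ : ∃ k, Nat.log 64 v = k + 1 := ⟨Nat.log 64 v - 1, by lia⟩
      rw [hk] at h1 h2 h3 h4
      have h5 := Finset.single_le_sum (s := Finset.Ico K x)
        (f := fun k => if 64 ^ (k + 1) ≤ v ∧ v < 64 ^ (k + 2) then 8 ^ (k + 2) else 0)
        (fun _ _ => Nat.zero_le _) (Finset.mem_Ico.2 ⟨by lia, by lia⟩ : k ∈ Finset.Ico K x)
      simp only [if_pos (show 64 ^ (k + 1) ≤ v ∧ v < 64 ^ (k + 2) from ⟨h1, h2⟩)] at h5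
      exact (hsq _ h2).trans (h5.trans (Nat.le_add_left _ _))
  have hs := Finset.sum_le_sum hpt
  rw [Finset.sum_add_distrib, Finset.sum_comm, Finset.sum_const, smul_eq_mul] at hs
  have hLsum : ∀ k, (∑ S ∈ denseFamily x (x + 1), if 64 ^ (k + 1) ≤ x / ∏ a ∈ S, a ∧
        x / ∏ a ∈ S, a < 64 ^ (k + 2) then 8 ^ (k + 2) else 0) = 8 ^ (k + 2) * (L k).card := by
    intro k
    rw [← Finset.sum_filter, Finset.sum_const, smul_eq_mul, mul_comm]
  rw [Finset.sum_congr rfl fun k _ => hLsum k] at hs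
  calc ((∑ S ∈ denseFamily x (x + 1), (x / ∏ a ∈ S, a).sqrt : ℕ) : ℝ)
      ≤ (((denseFamily x (x + 1)).card * 8 ^ (K + 1)
        + ∑ k ∈ Finset.Ico K x, 8 ^ (k + 2) * (L k).card : ℕ) : ℝ) := by exact_mod_cast hs
    _ = 8 ^ (K + 1) * (denseFamily x (x + 1)).card
        + ∑ k ∈ Finset.Ico K x, ((8 ^ (k + 2) * (L k).card : ℕ) : ℝ) := by push_cast; ring
    _ ≤ 8 ^ (K + 1) * (denseFamily x (x + 1)).card + ∑ k ∈ Finset.Ico K x,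
        2 ^ 39 * (((k + 1 : ℕ) : ℝ) ^ 4 * (1 / 2) ^ (k + 1)) * (denseFamily x (x + 1)).card := by
        gcongr with k hk
        exact hL k (Finset.mem_Ico.1 hk).1
    _ ≤ _ := by
        rw [← Finset.sum_mul, ← add_mul]
        gcongr
        exact hsum.sum_le_tsum _ fun k _ => hnn k

lemma le_Fdiv {m : ℕ} (hm : m ≠ 0) : m ≤ Fdiv m := by
  unfold Fdiv
  split_ifs with h
  · exact h.le
  · have hmem : m ∈ m.divisors.filter (fun d => 1 < d) := by
      rw [Finset.mem_filter, Nat.mem_divisors]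
      exact ⟨⟨dvd_rfl, hm⟩, by lia⟩
    exact (Nat.le_mul_of_pos_right m m.minFac_pos).trans
      (Finset.le_sup (f := fun d => d * d.minFac) hmem)

lemma finite_squarefree_Fdiv_le (x : ℕ) : {m : ℕ | Squarefree m ∧ Fdiv m ≤ x}.Finite :=
  (Set.finite_Iic x).subset fun _ hm => (le_Fdiv hm.1.ne_zero).trans hm.2

lemma squarefree_prod_of_prime {S : Finset ℕ} (hprime : ∀ q ∈ S, q.Prime) :
    Squarefree (∏ a ∈ S, a) := by
  refine Finset.squarefree_prod_of_pairwise_isCoprime (fun a ha b hb hab => ?_)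
    fun a ha => (hprime a ha).squarefree
  exact Nat.coprime_iff_isRelPrime.1 ((Nat.coprime_primes (hprime a ha) (hprime b hb)).2 hab)

lemma DenseSet.Fdiv_prod_le {x : ℕ} {S : Finset ℕ} (hS : DenseSet x S)
    (hprime : ∀ q ∈ S, q.Prime) (hx : 1 ≤ x) : Fdiv (∏ a ∈ S, a) ≤ x := by
  unfold Fdiv
  split_ifs
  · exact hx
  · refine Finset.sup_le fun d hd => ?_
    rw [Finset.mem_filter, Nat.mem_divisors] at hd
    obtain ⟨⟨hd, h0⟩, h1⟩ := hd
    have hmem : ∀ q, q.Prime → q ∣ d → q ∈ S := by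
      intro q hq hqd
      rw [← Nat.primeFactors_prod hprime]
      exact Nat.mem_primeFactors.2 ⟨hq, hqd.trans hd, h0⟩
    have hsq : Squarefree d := (squarefree_prod_of_prime hprime).squarefree_of_dvd hd
    have hle : d ≤ ∏ a ∈ S with d.minFac ≤ a, a := by
      conv_lhs => rw [← Nat.prod_primeFactors_of_squarefree hsq]
      refine Finset.prod_le_prod_of_subset_of_one_le' (fun q hq => ?_)
        fun a ha _ => (hprime a (Finset.mem_filter.1 ha).1).one_le
      rw [Nat.mem_primeFactors] at hq
      exact Finset.mem_filter.2 ⟨hmem q hq.1 hq.2.1, Nat.minFac_le_of_dvd hq.1.two_le hq.2.1⟩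
    calc d * d.minFac = d.minFac * d := mul_comm _ _
      _ ≤ d.minFac * ∏ a ∈ S with d.minFac ≤ a, a := Nat.mul_le_mul_left _ hle
      _ ≤ x := hS _ (hmem _ (Nat.minFac_prime (by lia)) d.minFac_dvd)

lemma card_denseFamily_le {x : ℕ} (hx : 1 ≤ x) :
    (denseFamily x (x + 1)).card ≤ {m : ℕ | Squarefree m ∧ Fdiv m ≤ x}.ncard := by
  rw [← Set.ncard_coe_finset]
  refine Set.ncard_le_ncard_of_injOn (fun S => ∏ a ∈ S, a) (fun S hS => ?_) (fun S hS S' hS' h => ?_)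
    (finite_squarefree_Fdiv_le x)
  · rw [Finset.mem_coe, mem_denseFamily_succ_self] at hS
    exact ⟨squarefree_prod_of_prime hS.1, hS.2.Fdiv_prod_le hS.1 hx⟩
  · rw [Finset.mem_coe, mem_denseFamily_succ_self] at hS hS'
    rw [← Nat.primeFactors_prod hS.1, ← Nat.primeFactors_prod hS'.1]
    exact congrArg Nat.primeFactors h

theorem count_squarefree_dense_divisors :
    ∃ c : ℝ, 0 < c ∧ ∀ p : ℕ, p.Prime →
      c * (p : ℝ) ^ 2 / Real.log p ≤
        ({m : ℕ | Squarefree m ∧ Fdiv m ≤ p ^ 2}.ncard : ℝ) := by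
  obtain ⟨C, hC, hsum⟩ := exists_sum_sqrt_le
  obtain ⟨N, hN⟩ := eventually_le_log_mul_card_primes
  have hlog2 : 0 < Real.log 2 := Real.log_pos (by norm_num)
  have hM : (0 : ℝ) < (max N 16 : ℕ) := by
    have : 0 < max N 16 := by lia
    exact_mod_cast this
  refine ⟨min (1 / (8 * (3 + C))) (Real.log 2 / (max N 16 : ℕ)),
    lt_min (by positivity) (by positivity), fun p hp => ?_⟩
  have hp2 : Real.log 2 ≤ Real.log p :=
    Real.log_le_log (by norm_num) (by exact_mod_cast hp.two_le)
  have hT : 1 ≤ {m : ℕ | Squarefree m ∧ Fdiv m ≤ p ^ 2}.ncard := by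
    rw [Nat.one_le_iff_ne_zero, Ne, Set.ncard_eq_zero (finite_squarefree_Fdiv_le _)]
    refine Set.Nonempty.ne_empty ⟨1, squarefree_one, ?_⟩
    rw [Fdiv, if_pos rfl]
    exact Nat.one_le_pow _ _ hp.pos
  have hcard := card_denseFamily_le (x := p ^ 2) (Nat.one_le_pow _ _ hp.pos)
  generalize {m : ℕ | Squarefree m ∧ Fdiv m ≤ p ^ 2}.ncard = T at *
  have hTR : (1 : ℝ) ≤ T := by exact_mod_cast hT
  rw [div_le_iff₀ (hlog2.trans_le hp2)]
  rcases le_or_gt (max N 16) (p ^ 2) with h | h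
  · have h1 := hN (p ^ 2) ((le_max_left _ _).trans h)
    have h2 := card_primes_le_sum_sqrt ((le_max_right _ _).trans h)
    have h3 : (((Finset.Ioc (p ^ 2 / 4) (p ^ 2)).filter Nat.Prime).card : ℝ) ≤ (3 + C) * T := by
      have h4 := hsum (p ^ 2)
      have h5 : C * ((denseFamily (p ^ 2) (p ^ 2 + 1)).card : ℝ) ≤ C * T := by gcongr
      have h6 : (((Finset.Ioc (p ^ 2 / 4) (p ^ 2)).filter Nat.Prime).card : ℝ)
        ≤ 3 + ((∑ S ∈ denseFamily (p ^ 2) (p ^ 2 + 1), (p ^ 2 / ∏ a ∈ S, a).sqrt : ℕ) : ℝ) := by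
        exact_mod_cast h2
      nlinarith
    push_cast at h1
    rw [Real.log_pow] at h1
    push_cast at h1
    have hpos : 0 ≤ 4 * (2 * Real.log p) := by linarith
    calc min (1 / (8 * (3 + C))) (Real.log 2 / (max N 16 : ℕ)) * (p : ℝ) ^ 2
        ≤ 1 / (8 * (3 + C)) * (4 * (2 * Real.log p) * ((3 + C) * T)) := by
          gcongr
          · exact min_le_left _ _
          · exact h1.trans (mul_le_mul_of_nonneg_left h3 hpos)
      _ = T * Real.log p := by field_simp; ring
  · have h1 : (p : ℝ) ^ 2 ≤ (max N 16 : ℕ) := by exact_mod_cast h.le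
    calc min (1 / (8 * (3 + C))) (Real.log 2 / (max N 16 : ℕ)) * (p : ℝ) ^ 2
        ≤ Real.log 2 / (max N 16 : ℕ) * (max N 16 : ℕ) := by
          gcongr
          exact min_le_right _ _
      _ = Real.log 2 := div_mul_cancel₀ _ hM.ne'
      _ ≤ T * Real.log p := by nlinarith
end

section
/- For every prime p ≥ 3, if C is a finite chain containing all squarefree integers m with F(m) ≤ p², whose entries are all squarefree, at most 2p², and with largest prime factor at most p, then the length of C is at least c·p²/log p for some absolute constant c > 0 (independent of p and C). -/
def Pplus (n : ℕ) : ℕ := if n = 1 then 1 else n.primeFactors.sup id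

namespace DenseChain

open Finset

/-- The Mertens sum `∑ (log p) / p` over primes `p ≤ n`. -/
noncomputable def mertensSum (n : ℕ) : ℝ :=
  ∑ i ∈ range (n + 1), if i.Prime then Real.log i / i else 0

/-- The mean of `log m` over squarefree `n`-smooth `m`, each weighted by `1 / m`. -/
noncomputable def logMean (n : ℕ) : ℝ :=
  ∑ i ∈ range (n + 1), if i.Prime then Real.log i / (i + 1) else 0

/-- The product `∏ (1 + 1 / p)` over primes `p ≤ n`. -/
noncomputable def eulerProd (n : ℕ) : ℝ :=
  ∏ i ∈ range (n + 1), if i.Prime then 1 + (i : ℝ)⁻¹ else 1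

lemma logMean_le_mertensSum (n : ℕ) : logMean n ≤ mertensSum n := by
  refine sum_le_sum fun i _ => ?_
  split_ifs with h
  · have := h.pos
    gcongr
    linarith
  · rfl

lemma log_factorial_eq_sum (n : ℕ) :
    Real.log n.factorial =
      ∑ i ∈ range (n + 1), if i.Prime then (n.factorial.factorization i : ℝ) * Real.log i else 0 := by
  rw [Real.log_nat_eq_sum_factorization, Finsupp.sum, ← sum_filter]
  refine sum_subset (fun p hp => ?_) (fun p _ hp => ?_)
  · have hp' := Nat.prime_of_mem_primeFactors hp
    have : p ∣ n.factorial := Nat.dvd_of_mem_primeFactors hp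
    rw [hp'.dvd_factorial] at this
    simp [hp']
    omega
  · simp [Finsupp.notMem_support_iff.mp hp]

lemma mertensSum_le {n : ℕ} (hn : 1 ≤ n) : mertensSum n ≤ Real.log n + Real.log 4 := by
  have hn0 : (0 : ℝ) < n := by exact_mod_cast hn
  have h1 : Real.log n.factorial ≤ n * Real.log n := by
    rw [← Real.log_pow]
    exact Real.log_le_log (by positivity) (by exact_mod_cast Nat.factorial_le_pow n)
  have h2 : (n : ℝ) * mertensSum n - Chebyshev.theta n ≤ Real.log n.factorial := by
    have h3 : Chebyshev.theta n = ∑ i ∈ range (n + 1), if i.Prime then Real.log i else 0 := by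
      rw [Chebyshev.theta_eq_sum_Icc, Nat.floor_natCast, sum_filter, range_eq_Ico]
      rfl
    rw [log_factorial_eq_sum, mertensSum, h3, mul_sum, ← sum_sub_distrib]
    refine sum_le_sum fun p _ => ?_
    split_ifs with hp
    · have hlog : 0 ≤ Real.log p := Real.log_natCast_nonneg p
      have hdiv : n / p ≤ n.factorial.factorization p := by
        rw [Nat.factorization_factorial hp (Nat.lt_succ_self (Nat.log p n))]
        by_cases hpn : p ≤ n
        · calc n / p = n / p ^ 1 := by simp
            _ ≤ _ := single_le_sum (f := fun i => n / p ^ i) (fun _ _ => Nat.zero_le _)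
              (by simpa using ⟨hpn, hp.one_lt⟩)
        · simp [Nat.div_eq_of_lt (not_le.mp hpn)]
      have hfl : (n : ℝ) / p - 1 ≤ (n / p : ℕ) := by
        rw [← Nat.floor_div_eq_div (K := ℝ)]
        exact (Nat.sub_one_lt_floor _).le
      have hdiv' : ((n / p : ℕ) : ℝ) ≤ n.factorial.factorization p := by exact_mod_cast hdiv
      calc (n : ℝ) * (Real.log p / p) - Real.log p = ((n : ℝ) / p - 1) * Real.log p := by ring
        _ ≤ _ := by gcongr; linarith
    · simp
  have h4 := Chebyshev.theta_le_log4_mul_x hn0.le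
  have h5 : (n : ℝ) * mertensSum n ≤ n * (Real.log n + Real.log 4) := by linarith
  exact le_of_mul_le_mul_left h5 hn0

lemma exists_le_logMean : ∃ C : ℝ, 0 ≤ C ∧ ∀ n : ℕ, 1 ≤ n → Real.log n - C ≤ logMean n := by
  have hs : Summable fun n : ℕ => (6 : ℝ) * (1 / (n : ℝ) ^ (3 / 2 : ℝ)) :=
    (Real.summable_one_div_nat_rpow.mpr (by norm_num)).mul_left 6
  set S := ∑' n : ℕ, (6 : ℝ) * (1 / (n : ℝ) ^ (3 / 2 : ℝ)) with hS
  have hS0 : 0 ≤ S := tsum_nonneg fun n => by positivity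
  refine ⟨1 + S, by linarith, fun n hn => ?_⟩
  have hn0 : (0 : ℝ) < n := by exact_mod_cast hn
  have h1 : (n : ℝ) * Real.log n - n ≤ Real.log n.factorial := by
    have := Stirling.le_log_factorial_stirling (n := n) (by omega)
    have h2 : 0 ≤ Real.log n := Real.log_natCast_nonneg n
    have h3 : 0 ≤ Real.log (2 * Real.pi) := Real.log_nonneg (by linarith [Real.pi_gt_three])
    linarith
  have h2 : Real.log n.factorial ≤ n * (logMean n + S) := by
    have hS' : ∑ i ∈ range (n + 1), (6 : ℝ) * (1 / (i : ℝ) ^ (3 / 2 : ℝ)) ≤ S :=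
      hs.sum_le_tsum _ fun i _ => by positivity
    calc Real.log n.factorial
        ≤ n * (logMean n + ∑ i ∈ range (n + 1), (6 : ℝ) * (1 / (i : ℝ) ^ (3 / 2 : ℝ))) := by
          rw [log_factorial_eq_sum, logMean, ← sum_add_distrib, mul_sum]
          refine sum_le_sum fun p _ => ?_
          split_ifs with hp
          · have hp2 : (2 : ℝ) ≤ p := by exact_mod_cast hp.two_le
            have hlog : 0 ≤ Real.log p := Real.log_natCast_nonneg p
            have hv : (n.factorial.factorization p : ℝ) ≤ n / (p - 1) := by
              have := Nat.factorization_factorial_le_div_pred hp n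
              calc (n.factorial.factorization p : ℝ) ≤ (n / (p - 1) : ℕ) := by exact_mod_cast this
                _ ≤ n / ((p - 1 : ℕ) : ℝ) := Nat.cast_div_le
                _ = _ := by rw [Nat.cast_sub hp.one_le]; simp
            have hlog2 : Real.log p ≤ 2 * (p : ℝ) ^ (1 / 2 : ℝ) := by
              have := Real.log_le_rpow_div (x := p) (by linarith) (ε := 1 / 2) (by norm_num)
              linarith
            have hrp : (p : ℝ) ^ (3 / 2 : ℝ) * (p : ℝ) ^ (1 / 2 : ℝ) = p ^ 2 := by
              rw [← Real.rpow_add (by linarith)]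
              norm_num
            have hrp0 : (0 : ℝ) < (p : ℝ) ^ (3 / 2 : ℝ) := by positivity
            have key : Real.log p / (p - 1) ≤
                Real.log p / (p + 1) + 6 * (1 / (p : ℝ) ^ (3 / 2 : ℝ)) := by
              have e : Real.log p / (p - 1) - Real.log p / (p + 1) =
                  2 * Real.log p / (p ^ 2 - 1) := by
                have : (p : ℝ) - 1 ≠ 0 := by linarith
                have : (p : ℝ) ^ 2 - 1 ≠ 0 := by nlinarith
                field_simp
                ring
              have : 2 * Real.log p / (p ^ 2 - 1) ≤ 6 * (1 / (p : ℝ) ^ (3 / 2 : ℝ)) := by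
                rw [mul_one_div, div_le_div_iff₀ (by nlinarith) hrp0]
                nlinarith
              linarith
            calc (n.factorial.factorization p : ℝ) * Real.log p
                ≤ n / (p - 1) * Real.log p := by gcongr
              _ = n * (Real.log p / (p - 1)) := by ring
              _ ≤ _ := by gcongr
          · positivity
      _ ≤ _ := by gcongr
  have h3 : (n : ℝ) * (Real.log n - (1 + S)) ≤ n * logMean n := by linarith
  exact le_of_mul_le_mul_left h3 hn0

lemma exists_sum_inv_primes_ge : ∃ C : ℝ, 0 ≤ C ∧ ∀ a b : ℕ, 1 ≤ a → a ≤ b →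
    Real.log b - Real.log a - C ≤ Real.log b * ∑ p ∈ Ioc a b with p.Prime, (p : ℝ)⁻¹ := by
  obtain ⟨C, hC0, hC⟩ := exists_le_logMean
  refine ⟨C + Real.log 4, add_nonneg hC0 (Real.log_nonneg (by norm_num)), fun a b ha hab => ?_⟩
  have h1 := mertensSum_le ha
  have h2 := (hC b (ha.trans hab)).trans (logMean_le_mertensSum b)
  have h3 : mertensSum b - mertensSum a = ∑ p ∈ Ioc a b with p.Prime, Real.log p / p := by
    rw [mertensSum, mertensSum, sum_filter, range_eq_Ico, range_eq_Ico,
      ← sum_Ico_consecutive _ (Nat.zero_le (a + 1)) (by omega : a + 1 ≤ b + 1), add_sub_cancel_left]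
    exact sum_congr (by ext; simp) fun _ _ => rfl
  have h4 : ∑ p ∈ Ioc a b with p.Prime, Real.log p / p ≤
      Real.log b * ∑ p ∈ Ioc a b with p.Prime, (p : ℝ)⁻¹ := by
    rw [mul_sum]
    refine sum_le_sum fun p hp => ?_
    simp only [mem_filter, mem_Ioc] at hp
    have := hp.2.pos
    rw [div_eq_mul_inv]
    gcongr
    exact hp.1.2
  linarith

lemma eulerProd_succ (n : ℕ) :
    eulerProd (n + 1) =
      (if (n + 1).Prime then 1 + ((n + 1 : ℕ) : ℝ)⁻¹ else 1) * eulerProd n := by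
  rw [eulerProd, prod_range_succ, mul_comm]
  rfl

lemma logMean_succ (n : ℕ) :
    logMean (n + 1) =
      logMean n + if (n + 1).Prime then Real.log (n + 1 : ℕ) / ((n + 1 : ℕ) + 1) else 0 := by
  rw [logMean, sum_range_succ]
  rfl

lemma mertensSum_succ (n : ℕ) :
    mertensSum (n + 1) =
      mertensSum n + if (n + 1).Prime then Real.log (n + 1 : ℕ) / (n + 1 : ℕ) else 0 := by
  rw [mertensSum, sum_range_succ]
  rfl

@[simp] lemma eulerProd_zero : eulerProd 0 = 1 := by simp [eulerProd, Nat.not_prime_zero]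

@[simp] lemma logMean_zero : logMean 0 = 0 := by simp [logMean]

@[simp] lemma mertensSum_zero : mertensSum 0 = 0 := by simp [mertensSum]

lemma eulerFactor_pos (n : ℕ) : (0 : ℝ) < if n.Prime then 1 + (n : ℝ)⁻¹ else 1 := by
  split_ifs <;> positivity

lemma eulerProd_pos (n : ℕ) : 0 < eulerProd n := prod_pos fun i _ => eulerFactor_pos i

lemma eulerProd_succ_le (n : ℕ) : eulerProd (n + 1) ≤ 2 * eulerProd n := by
  rw [eulerProd_succ]
  have := eulerProd_pos n
  gcongr
  split_ifs with h
  · have : ((n + 1 : ℕ) : ℝ)⁻¹ ≤ 1 := inv_le_one_of_one_le₀ (by exact_mod_cast h.one_le)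
    linarith
  · norm_num

/-- The states at time `n` of the process which starts from `1` and, at each prime `p`, drops
every `m` with `K * m < p` and adjoins `m * p` for every remaining `m`. -/
def alive (K : ℕ) : ℕ → Finset ℕ
  | 0 => {1}
  | n + 1 =>
    if (n + 1).Prime then
      {m ∈ alive K n | n + 1 ≤ K * m} ∪ {m ∈ alive K n | n + 1 ≤ K * m}.image (· * (n + 1))
    else {m ∈ alive K n | n + 1 ≤ K * m}

/-- The states at time `n` that survive to time `n + 1`. -/
def survivors (K n : ℕ) : Finset ℕ := {m ∈ alive K n | n + 1 ≤ K * m}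

lemma alive_succ (K n : ℕ) :
    alive K (n + 1) =
      if (n + 1).Prime then survivors K n ∪ (survivors K n).image (· * (n + 1))
      else survivors K n := rfl

lemma mem_survivors {K n m : ℕ} : m ∈ survivors K n ↔ m ∈ alive K n ∧ n + 1 ≤ K * m := by
  simp [survivors]

lemma survivors_subset_alive_succ (K n : ℕ) : survivors K n ⊆ alive K (n + 1) := by
  rw [alive_succ]
  split_ifs
  · exact subset_union_left
  · rfl

lemma mul_mem_alive {K n m : ℕ} (hm : m ∈ survivors K n) (hn : (n + 1).Prime) :
    m * (n + 1) ∈ alive K (n + 1) := by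
  rw [alive_succ, if_pos hn]
  exact mem_union_right _ (mem_image_of_mem _ hm)

lemma mem_alive_of_le {K i n m : ℕ} (hm : m ∈ alive K i) (hin : i ≤ n) (hn : n ≤ K * m) :
    m ∈ alive K n := by
  induction n, hin using Nat.le_induction with
  | base => exact hm
  | succ n _ ih =>
    exact survivors_subset_alive_succ K n (mem_survivors.2 ⟨ih (by omega), hn⟩)

/-- Squarefree `n`-smooth integers `m` with `Fdiv m ≤ K * m`. -/
structure IsDense (K n m : ℕ) : Prop where
  squarefree : Squarefree m
  smooth : ∀ q : ℕ, q.Prime → q ∣ m → q ≤ n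
  mul_minFac_le : ∀ d, d ∣ m → 1 < d → d * d.minFac ≤ K * m

lemma IsDense.pos {K n m : ℕ} (h : IsDense K n m) : 0 < m :=
  Nat.pos_of_ne_zero h.squarefree.ne_zero

lemma IsDense.mono {K n n' m : ℕ} (h : IsDense K n m) (hn : n ≤ n') : IsDense K n' m :=
  ⟨h.squarefree, fun q hq hqm => (h.smooth q hq hqm).trans hn, h.mul_minFac_le⟩

lemma IsDense.not_dvd {K n m p : ℕ} (h : IsDense K n m) (hp : p.Prime) (hnp : n < p) : ¬ p ∣ m :=
  fun hd => absurd (h.smooth p hp hd) (not_le.2 hnp)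

lemma IsDense.mul_prime {K n m p : ℕ} (h : IsDense K n m) (hp : p.Prime) (hnp : n < p)
    (hpm : p ≤ K * m) : IsDense K p (m * p) := by
  refine ⟨?_, fun q hq hqm => ?_, fun d hd h1 => ?_⟩
  · rw [Nat.squarefree_mul_iff]
    exact ⟨((Nat.Prime.coprime_iff_not_dvd hp).2 (h.not_dvd hp hnp)).symm, h.squarefree,
      hp.prime.squarefree⟩
  · rcases (Nat.Prime.dvd_mul hq).1 hqm with h1 | h1
    · exact (h.smooth q hq h1).trans hnp.le
    · exact Nat.le_of_dvd hp.pos h1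
  · by_cases hpd : p ∣ d
    · obtain ⟨e, rfl⟩ := hpd
      have he : e ∣ m := by
        rw [mul_comm m p] at hd
        exact Nat.dvd_of_mul_dvd_mul_left hp.pos hd
      have he0 : 0 < e := Nat.pos_of_dvd_of_pos he h.pos
      rcases Nat.lt_or_ge 1 e with h2 | h2
      · have h3 := h.mul_minFac_le e he h2
        have h4 : (p * e).minFac ≤ e.minFac :=
          Nat.minFac_le_of_dvd (Nat.minFac_prime (by omega)).two_le
            ((Nat.minFac_dvd e).trans (dvd_mul_left e p))
        calc p * e * (p * e).minFac ≤ p * e * e.minFac := by gcongr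
          _ = p * (e * e.minFac) := by ring
          _ ≤ p * (K * m) := by gcongr
          _ = K * (m * p) := by ring
      · obtain rfl : e = 1 := by omega
        rw [mul_one, hp.minFac_eq, ← mul_assoc]
        gcongr
    · have hdm : d ∣ m :=
        Nat.Coprime.dvd_of_dvd_mul_right ((Nat.Prime.coprime_iff_not_dvd hp).2 hpd).symm hd
      calc d * d.minFac ≤ K * m := h.mul_minFac_le d hdm h1
        _ ≤ K * (m * p) := by gcongr; exact Nat.le_mul_of_pos_right m hp.pos

lemma isDense_one (K n : ℕ) : IsDense K n 1 := by
  refine ⟨squarefree_one, fun q hq h => absurd (Nat.dvd_one.1 h) hq.ne_one, fun d hd h => ?_⟩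
  have := Nat.dvd_one.1 hd
  omega

lemma alive_spec {K n m : ℕ} (hm : m ∈ alive K n) : IsDense K n m ∧ n ≤ K * m := by
  induction n generalizing m with
  | zero =>
    simp only [alive, mem_singleton] at hm
    subst hm
    exact ⟨isDense_one _ _, by omega⟩
  | succ n ih =>
    have hs : ∀ m ∈ survivors K n, IsDense K (n + 1) m ∧ n + 1 ≤ K * m := fun m hm => by
      rw [mem_survivors] at hm
      exact ⟨(ih hm.1).1.mono (by omega), hm.2⟩
    rw [alive_succ] at hm
    split_ifs at hm with hp
    · rcases mem_union.1 hm with h | h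
      · exact hs m h
      · obtain ⟨m', hm', rfl⟩ := mem_image.1 h
        rw [mem_survivors] at hm'
        refine ⟨(ih hm'.1).1.mul_prime hp (by omega) hm'.2, hm'.2.trans ?_⟩
        gcongr
        exact Nat.le_mul_of_pos_right m' (by omega)
    · exact hs m hm

lemma sum_alive_succ (K n : ℕ) (f : ℕ → ℝ) :
    ∑ m ∈ alive K (n + 1), f m =
      ∑ m ∈ survivors K n, (f m + if (n + 1).Prime then f (m * (n + 1)) else 0) := by
  rw [alive_succ]
  split_ifs with hp
  · rw [sum_union, sum_image, sum_add_distrib]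
    · intro a _ b _ hab
      exact Nat.eq_of_mul_eq_mul_right (by omega) hab
    · rw [disjoint_left]
      intro m hm hm'
      obtain ⟨m', _, rfl⟩ := mem_image.1 hm'
      exact (alive_spec (mem_survivors.1 hm).1).1.not_dvd hp (by omega) (dvd_mul_left _ _)
  · simp

lemma sum_survivors_le (K n : ℕ) {f : ℕ → ℝ} (hf : ∀ m ∈ alive K n, 0 ≤ f m) :
    ∑ m ∈ survivors K n, f m ≤ ∑ m ∈ alive K n, f m :=
  sum_le_sum_of_subset_of_nonneg (filter_subset _ _) fun m hm _ => hf m hm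

/-- The total mass `∑ 1 / m` of the states at time `n`. -/
noncomputable def mass (K n : ℕ) : ℝ := ∑ m ∈ alive K n, (m : ℝ)⁻¹

/-- The first moment of the centred logarithm at time `n`. -/
noncomputable def drift (K n : ℕ) : ℝ := ∑ m ∈ alive K n, (Real.log m - logMean n) * (m : ℝ)⁻¹

/-- The second moment of the centred logarithm at time `n`. -/
noncomputable def spread (K n : ℕ) : ℝ :=
  ∑ m ∈ alive K n, (Real.log m - logMean n) ^ 2 * (m : ℝ)⁻¹

lemma mass_nonneg (K n : ℕ) : 0 ≤ mass K n := sum_nonneg fun m _ => by positivity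

lemma mass_succ (K n : ℕ) :
    mass K (n + 1) =
      (if (n + 1).Prime then 1 + ((n + 1 : ℕ) : ℝ)⁻¹ else 1) * ∑ m ∈ survivors K n, (m : ℝ)⁻¹ := by
  rw [mass, sum_alive_succ, mul_sum]
  refine sum_congr rfl fun m _ => ?_
  split_ifs
  · push_cast
    rw [mul_inv]
    ring
  · simp

lemma drift_succ (K n : ℕ) :
    drift K (n + 1) =
      (if (n + 1).Prime then 1 + ((n + 1 : ℕ) : ℝ)⁻¹ else 1) *
        ∑ m ∈ survivors K n, (Real.log m - logMean n) * (m : ℝ)⁻¹ := by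
  rw [drift, sum_alive_succ, mul_sum, logMean_succ]
  refine sum_congr rfl fun m hm => ?_
  have hm0 : (m : ℝ) ≠ 0 := by exact_mod_cast (alive_spec (mem_survivors.1 hm).1).1.pos.ne'
  split_ifs
  · rw [Nat.cast_mul, Real.log_mul hm0 (by positivity), mul_inv]
    have : ((n + 1 : ℕ) : ℝ) ≠ 0 := by positivity
    have : ((n + 1 : ℕ) : ℝ) + 1 ≠ 0 := by positivity
    generalize ((n + 1 : ℕ) : ℝ) = p at *
    field_simp
    ring
  · simp

lemma spread_succ (K n : ℕ) :
    spread K (n + 1) ≤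
      (if (n + 1).Prime then 1 + ((n + 1 : ℕ) : ℝ)⁻¹ else 1) *
        ∑ m ∈ survivors K n, ((Real.log m - logMean n) ^ 2 +
          if (n + 1).Prime then Real.log (n + 1 : ℕ) ^ 2 / (n + 1 : ℕ) else 0) * (m : ℝ)⁻¹ := by
  rw [spread, sum_alive_succ, mul_sum, logMean_succ]
  refine sum_le_sum fun m hm => ?_
  have hm0 : (0 : ℝ) < m := by exact_mod_cast (alive_spec (mem_survivors.1 hm).1).1.pos
  split_ifs
  · rw [Nat.cast_mul, Real.log_mul hm0.ne' (by positivity), mul_inv]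
    have hp : (0 : ℝ) < ((n + 1 : ℕ) : ℝ) := by positivity
    generalize ((n + 1 : ℕ) : ℝ) = p at *
    set x := Real.log m
    set l := Real.log p
    set L := logMean n
    have e : (x - (L + l / (p + 1))) ^ 2 * (m : ℝ)⁻¹ +
        (x + l - (L + l / (p + 1))) ^ 2 * ((m : ℝ)⁻¹ * p⁻¹) =
        (1 + p⁻¹) * (((x - L) ^ 2 + l ^ 2 * (p / (p + 1) ^ 2)) * (m : ℝ)⁻¹) := by
      field_simp
      ring
    rw [e, div_eq_mul_inv (l ^ 2)]
    gcongr
    rw [div_le_iff₀ (by positivity), inv_mul_eq_div, le_div_iff₀ hp]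
    nlinarith
  · simp

lemma sum_comp_le_sum_of_injOn {ι κ : Type*} [DecidableEq κ] {s : Finset ι} {t : Finset κ}
    {f : κ → ℝ} (g : ι → κ) (hg : ∀ x ∈ s, g x ∈ t) (hinj : Set.InjOn g s)
    (hf : ∀ y ∈ t, 0 ≤ f y) : ∑ x ∈ s, f (g x) ≤ ∑ y ∈ t, f y := by
  rw [← sum_image hinj]
  exact sum_le_sum_of_subset_of_nonneg (image_subset_iff.2 hg) fun y hy _ => hf y hy

lemma mass_div_eulerProd_antitone (K : ℕ) : Antitone fun n => mass K n / eulerProd n := by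
  refine antitone_nat_of_succ_le fun n => ?_
  rw [mass_succ, eulerProd_succ, mul_div_mul_left _ _ (eulerFactor_pos _).ne']
  have := eulerProd_pos n
  gcongr
  exact sum_survivors_le K n fun m _ => by positivity

lemma mass_zero (K : ℕ) : mass K 0 = 1 := by simp [mass, alive]

lemma drift_zero (K : ℕ) : drift K 0 = 0 := by simp [drift, alive]

lemma spread_zero (K : ℕ) : spread K 0 = 0 := by simp [spread, alive]

lemma mass_le_eulerProd (K n : ℕ) : mass K n ≤ eulerProd n := by
  have := mass_div_eulerProd_antitone K (Nat.zero_le n)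
  simp only [mass_zero, eulerProd_zero, div_one] at this
  rwa [div_le_one (eulerProd_pos n)] at this

lemma log_alive_ge {K n m : ℕ} (hK : 1 ≤ K) (hm : m ∈ alive K n) :
    0 ≤ Real.log m - logMean n + (Real.log K + Real.log 4) := by
  obtain ⟨hd, hn⟩ := alive_spec hm
  have hm0 : (0 : ℝ) < m := by exact_mod_cast hd.pos
  have hK0 : (0 : ℝ) < K := by exact_mod_cast hK
  rcases Nat.eq_zero_or_pos n with rfl | hn0
  · have h1 : 0 ≤ Real.log m := Real.log_natCast_nonneg m
    have h2 : 0 ≤ Real.log K := Real.log_natCast_nonneg K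
    have h3 : 0 ≤ Real.log 4 := Real.log_nonneg (by norm_num)
    simp only [logMean_zero]
    linarith
  · have h1 := (logMean_le_mertensSum n).trans (mertensSum_le hn0)
    have h2 : Real.log n ≤ Real.log K + Real.log m := by
      rw [← Real.log_mul hK0.ne' hm0.ne']
      exact Real.log_le_log (by exact_mod_cast hn0) (by exact_mod_cast hn)
    linarith

lemma drift_le {K : ℕ} (hK : 1 ≤ K) (n : ℕ) :
    drift K n + (Real.log K + Real.log 4) * mass K n ≤
      (Real.log K + Real.log 4) * eulerProd n := by
  set B := Real.log K + Real.log 4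
  have key : ∀ n, drift K n + B * mass K n =
      ∑ m ∈ alive K n, (Real.log m - logMean n + B) * (m : ℝ)⁻¹ := fun n => by
    rw [drift, mass, mul_sum, ← sum_add_distrib]
    exact sum_congr rfl fun m _ => by ring
  induction n with
  | zero => simp [mass_zero, drift_zero]
  | succ n ih =>
    have h : drift K (n + 1) + B * mass K (n + 1) =
        (if (n + 1).Prime then 1 + ((n + 1 : ℕ) : ℝ)⁻¹ else 1) *
          ∑ m ∈ survivors K n, (Real.log m - logMean n + B) * (m : ℝ)⁻¹ := by
      simp only [drift_succ, mass_succ, add_mul, sum_add_distrib, ← mul_sum]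
      ring
    rw [h, eulerProd_succ, mul_left_comm]
    refine mul_le_mul_of_nonneg_left ?_ (eulerFactor_pos _).le
    refine (sum_survivors_le K n fun m hm => ?_).trans ((key n).symm.le.trans ih)
    exact mul_nonneg (log_alive_ge hK hm) (by positivity)

lemma eulerProd_le_drift_add_mass {K : ℕ} (hK1 : 1 ≤ K)
    (hK : ∀ n : ℕ, 1 ≤ n → Real.log n - logMean n + 1 ≤ Real.log K) (n : ℕ) :
    eulerProd n ≤ drift K n + mass K n := by
  have key : ∀ n, drift K n + mass K n =
      ∑ m ∈ alive K n, (Real.log m - logMean n + 1) * (m : ℝ)⁻¹ := fun n => by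
    rw [drift, mass, ← sum_add_distrib]
    exact sum_congr rfl fun m _ => by ring
  induction n with
  | zero => simp [mass_zero, drift_zero]
  | succ n ih =>
    have h : drift K (n + 1) + mass K (n + 1) =
        (if (n + 1).Prime then 1 + ((n + 1 : ℕ) : ℝ)⁻¹ else 1) *
          ∑ m ∈ survivors K n, (Real.log m - logMean n + 1) * (m : ℝ)⁻¹ := by
      simp only [drift_succ, mass_succ, add_mul, sum_add_distrib, one_mul]
      ring
    rw [h, eulerProd_succ]
    refine mul_le_mul_of_nonneg_left ?_ (eulerFactor_pos _).le
    refine ih.trans ((key n).le.trans ?_)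
    have hsplit := sum_sdiff (f := fun m : ℕ => (Real.log m - logMean n + 1) * (m : ℝ)⁻¹)
      (filter_subset (fun m => n + 1 ≤ K * m) (alive K n))
    rw [← hsplit]
    refine add_le_of_nonpos_left (sum_nonpos fun m hm => ?_)
    simp only [mem_sdiff, mem_filter, not_and, not_le] at hm
    have hm0 : 0 < m := (alive_spec hm.1).1.pos
    have hlt : K * m ≤ n := Nat.lt_succ_iff.1 (hm.2 hm.1)
    have hn : 1 ≤ n := (Nat.mul_pos hK1 hm0).trans_le hlt
    have h1 : Real.log K + Real.log m ≤ Real.log n := by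
      rw [← Real.log_mul (by positivity) (by positivity)]
      exact Real.log_le_log (by positivity) (by exact_mod_cast hlt)
    have h2 := hK n hn
    exact mul_nonpos_of_nonpos_of_nonneg (by linarith) (by positivity)

lemma survivors_eq_alive {K n : ℕ} (h : n + 1 ≤ K) : survivors K n = alive K n := by
  refine filter_true_of_mem fun m hm => ?_
  exact h.trans (Nat.le_mul_of_pos_right K (alive_spec hm).1.pos)

lemma mass_eq_eulerProd {K n : ℕ} (h : n ≤ K) : mass K n = eulerProd n := by
  induction n with
  | zero => simp [mass_zero]
  | succ n ih =>
    rw [mass_succ, eulerProd_succ, survivors_eq_alive h, ← ih (by omega)]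
    rfl

lemma drift_eq_zero {K n : ℕ} (h : n ≤ K) : drift K n = 0 := by
  induction n with
  | zero => simp [drift_zero]
  | succ n ih =>
    rw [drift_succ, survivors_eq_alive h]
    have : ∑ m ∈ alive K n, (Real.log m - logMean n) * (m : ℝ)⁻¹ = 0 := ih (by omega)
    rw [this, mul_zero]

lemma eulerProd_le {n : ℕ} (hn : 2 ≤ n) : eulerProd n ≤ 2 + 4 * logMean n := by
  have hL : 0 < logMean n := by
    have h0 : ∀ i ∈ range (n + 1), (0 : ℝ) ≤ if i.Prime then Real.log i / (i + 1) else 0 := by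
      intro i _
      have := Real.log_natCast_nonneg i
      split_ifs <;> positivity
    refine lt_of_lt_of_le ?_ (single_le_sum h0 (mem_range.2 (by omega : 2 < n + 1)))
    have : 0 < Real.log 2 := Real.log_pos (by norm_num)
    simp only [Nat.prime_two, if_true, Nat.cast_ofNat]
    positivity
  set L := logMean n
  have h1 : ∑ m ∈ alive n n, Real.log m * (m : ℝ)⁻¹ = L * eulerProd n := by
    have h2 := drift_eq_zero (le_refl n)
    rw [← mass_eq_eulerProd (le_refl n), mass, mul_sum, ← sub_eq_zero, ← sum_sub_distrib, ← h2,
      drift]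
    exact sum_congr rfl fun m _ => by ring
  have h3 : ∑ m ∈ alive n n with ¬ Real.log (m : ℕ) ≤ 2 * L, (m : ℝ)⁻¹ ≤ eulerProd n / 2 := by
    have h4 : 2 * L * ∑ m ∈ alive n n with ¬ Real.log (m : ℕ) ≤ 2 * L, (m : ℝ)⁻¹ ≤
        L * eulerProd n := by
      rw [← h1, mul_sum]
      calc ∑ m ∈ alive n n with ¬ Real.log (m : ℕ) ≤ 2 * L, 2 * L * (m : ℝ)⁻¹
          ≤ ∑ m ∈ alive n n with ¬ Real.log (m : ℕ) ≤ 2 * L, Real.log m * (m : ℝ)⁻¹ := by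
            refine sum_le_sum fun m hm => ?_
            have := (mem_filter.1 hm).2
            gcongr
            linarith
        _ ≤ _ := sum_le_sum_of_subset_of_nonneg (filter_subset _ _) fun m _ _ =>
            mul_nonneg (Real.log_natCast_nonneg m) (by positivity)
    have : L * (2 * ∑ m ∈ alive n n with ¬ Real.log (m : ℕ) ≤ 2 * L, (m : ℝ)⁻¹) ≤ L * eulerProd n := by
      linarith
    linarith [le_of_mul_le_mul_left this hL]
  have h5 : ∑ m ∈ alive n n with Real.log (m : ℕ) ≤ 2 * L, (m : ℝ)⁻¹ ≤ 1 + 2 * L := by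
    have h6 := harmonic_floor_le_one_add_log (Real.exp (2 * L)) (Real.one_le_exp (by linarith))
    rw [Real.log_exp, harmonic_eq_sum_Icc] at h6
    push_cast at h6
    refine le_trans (sum_le_sum_of_subset_of_nonneg (fun m hm => ?_) fun m _ _ => by positivity) h6
    rw [mem_filter] at hm
    have hm0 : 0 < m := (alive_spec hm.1).1.pos
    rw [mem_Icc]
    refine ⟨hm0, Nat.le_floor ?_⟩
    rw [← Real.log_le_iff_le_exp (by exact_mod_cast hm0)]
    exact hm.2
  have h7 := sum_filter_add_sum_filter_not (alive n n) (fun m : ℕ => Real.log m ≤ 2 * L)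
    (fun m : ℕ => (m : ℝ)⁻¹)
  have h8 : ∑ m ∈ alive n n, (m : ℝ)⁻¹ = eulerProd n := mass_eq_eulerProd (le_refl n)
  linarith

lemma sum_inv_sq_le (n : ℕ) : ∑ a ∈ Icc 1 n, ((a : ℝ) ^ 2)⁻¹ ≤ 2 := by
  have := sum_Ioo_inv_sq_le (α := ℝ) 0 (n + 1)
  have e : Ioo 0 (n + 1) = Icc 1 n := by ext; simp; omega
  rw [e] at this
  simpa using this

lemma log_le_two_mul_eulerProd (n : ℕ) : Real.log n ≤ 2 * eulerProd n := by
  have h1 : Real.log n ≤ ∑ i ∈ Icc 1 n, (i : ℝ)⁻¹ := by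
    rcases Nat.eq_zero_or_pos n with rfl | hn
    · simp
    have := log_add_one_le_harmonic n
    rw [harmonic_eq_sum_Icc] at this
    push_cast at this
    refine le_trans (Real.log_le_log (by positivity) (by linarith)) this
  have h2 : ∑ b ∈ Icc 1 n with Squarefree b, (b : ℝ)⁻¹ ≤ eulerProd n := by
    have e : eulerProd n = ∑ t ∈ ((range (n + 1)).filter Nat.Prime).powerset,
        ((∏ p ∈ t, p : ℕ) : ℝ)⁻¹ := by
      rw [eulerProd, ← prod_filter, prod_one_add]
      simp
    rw [e]
    have h3 : ∀ b ∈ (Icc 1 n).filter Squarefree,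
        (b : ℝ)⁻¹ = ((∏ p ∈ b.primeFactors, p : ℕ) : ℝ)⁻¹ := fun b hb => by
      rw [Nat.prod_primeFactors_of_squarefree (mem_filter.1 hb).2]
    rw [sum_congr rfl h3]
    refine sum_comp_le_sum_of_injOn (f := fun t : Finset ℕ => ((∏ p ∈ t, p : ℕ) : ℝ)⁻¹)
      Nat.primeFactors (fun b hb => ?_) (fun b hb c hc hbc => ?_) fun _ _ => by positivity
    · simp only [mem_filter, mem_Icc] at hb
      rw [mem_powerset]
      intro p hp
      have h4 := Nat.le_of_dvd hb.1.1 (Nat.dvd_of_mem_primeFactors hp)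
      exact mem_filter.2 ⟨mem_range.2 (by omega), Nat.prime_of_mem_primeFactors hp⟩
    · rw [← Nat.prod_primeFactors_of_squarefree (mem_filter.1 hb).2,
        ← Nat.prod_primeFactors_of_squarefree (mem_filter.1 hc).2, hbc]
  have h3 : ∀ i : ℕ, ∃ x : ℕ × ℕ, 0 < i → 0 < x.1 ∧ 0 < x.2 ∧ x.1 ^ 2 * x.2 = i ∧
      Squarefree x.2 := fun i => by
    rcases Nat.eq_zero_or_pos i with rfl | hi
    · exact ⟨(0, 0), fun h => absurd h (lt_irrefl 0)⟩
    · obtain ⟨b, a, h1, h2, h3, h4⟩ := Nat.sq_mul_squarefree_of_pos hi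
      exact ⟨(a, b), fun _ => ⟨h2, h1, h3, h4⟩⟩
  choose g hg using h3
  have h4 : ∑ i ∈ Icc 1 n, (i : ℝ)⁻¹ ≤
      ∑ x ∈ Icc 1 n ×ˢ (Icc 1 n).filter Squarefree, ((x.1 : ℝ) ^ 2)⁻¹ * (x.2 : ℝ)⁻¹ := by
    have h5 : ∀ i ∈ Icc 1 n, (i : ℝ)⁻¹ = (((g i).1 : ℝ) ^ 2)⁻¹ * ((g i).2 : ℝ)⁻¹ := fun i hi => by
      have := (hg i (mem_Icc.1 hi).1).2.2.1
      rw [← mul_inv]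
      exact_mod_cast congrArg (fun k : ℕ => (k : ℝ)⁻¹) this.symm
    rw [sum_congr rfl h5]
    refine sum_comp_le_sum_of_injOn
      (f := fun x : ℕ × ℕ => ((x.1 : ℝ) ^ 2)⁻¹ * (x.2 : ℝ)⁻¹) g (fun i hi => ?_)
      (fun i hi j hj hij => ?_) fun _ _ => by positivity
    · rw [mem_Icc] at hi
      obtain ⟨h6, h7, h8, h9⟩ := hg i hi.1
      have h10 : (g i).1 ≤ i := by nlinarith
      have h11 : (g i).2 ≤ i := by nlinarith [pow_pos h6 2]
      simp only [mem_product, mem_filter, mem_Icc]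
      exact ⟨⟨h6, h10.trans hi.2⟩, ⟨h7, h11.trans hi.2⟩, h9⟩
    · rw [← (hg i (mem_Icc.1 hi).1).2.2.1, ← (hg j (mem_Icc.1 hj).1).2.2.1, hij]
  rw [sum_product] at h4
  dsimp only at h4
  rw [← sum_mul_sum] at h4
  refine h1.trans (h4.trans ?_)
  gcongr
  exact sum_inv_sq_le n

lemma eulerProd_mono : Monotone eulerProd := by
  refine monotone_nat_of_le_succ fun n => ?_
  rw [eulerProd_succ]
  refine le_mul_of_one_le_left (eulerProd_pos n).le ?_
  split_ifs
  · have : (0 : ℝ) ≤ ((n + 1 : ℕ) : ℝ)⁻¹ := by positivity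
    linarith
  · rfl

lemma log_four_le {n : ℕ} (hn : 2 ≤ n) : Real.log 4 ≤ 2 * Real.log n := by
  have h : Real.log 2 ≤ Real.log n := Real.log_le_log (by norm_num) (by exact_mod_cast hn)
  have : Real.log 4 = 2 * Real.log 2 := by
    rw [show (4 : ℝ) = 2 ^ 2 by norm_num, Real.log_pow]
    norm_num
  linarith

lemma mertensSum_le_mul_log {n : ℕ} (hn : 2 ≤ n) : mertensSum n ≤ 3 * Real.log n := by
  linarith [mertensSum_le (by omega : 1 ≤ n), log_four_le hn]

lemma eulerProd_le_mul_log {n : ℕ} (hn : 2 ≤ n) : eulerProd n ≤ 15 * Real.log n := by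
  have h1 := eulerProd_le hn
  have h2 := (logMean_le_mertensSum n).trans (mertensSum_le_mul_log hn)
  have h3 : Real.log 2 ≤ Real.log n := Real.log_le_log (by norm_num) (by exact_mod_cast hn)
  have h4 := Real.log_two_gt_d9
  linarith

lemma logMean_nonneg (n : ℕ) : 0 ≤ logMean n := by
  refine sum_nonneg fun i _ => ?_
  have := Real.log_natCast_nonneg i
  split_ifs <;> positivity

lemma eventually_le_log (c : ℝ) : ∀ᶠ n : ℕ in Filter.atTop, c ≤ Real.log n :=
  (Real.tendsto_log_atTop.comp tendsto_natCast_atTop_atTop).eventually_ge_atTop c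

lemma eq_of_mul_prime_eq_mul_prime {K n n' m m' p p' : ℕ} (hm : IsDense K n m)
    (hm' : IsDense K n' m') (hp : p.Prime) (hp' : p'.Prime) (hn : n < p) (hn' : n' < p')
    (h : m * p = m' * p') : p = p' ∧ m = m' := by
  have key : ∀ {n m m' p p' : ℕ}, IsDense K n m → p.Prime → p'.Prime → n < p →
      m * p = m' * p' → p' ≤ p := by
    intro n m m' p p' hm hp hp' hn h
    have hd : p' ∣ m * p := h ▸ dvd_mul_left p' m'
    rcases (Nat.Prime.dvd_mul hp').1 hd with h1 | h1
    · exact (hm.smooth p' hp' h1).trans hn.le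
    · exact Nat.le_of_dvd hp.pos h1
  have e := le_antisymm (key hm' hp' hp hn' h.symm) (key hm hp hp' hn h)
  subst e
  exact ⟨rfl, Nat.eq_of_mul_eq_mul_right hp.pos h⟩

lemma mass_le_mul_sum_survivors {K n p : ℕ} (hn : 2 ≤ n) (hp : p.Prime) (hpn : p ≤ n)
    (hlog : 3 / 4 * Real.log n ≤ Real.log p) :
    mass K n ≤ 80 * ∑ m ∈ survivors K (p - 1), (m : ℝ)⁻¹ := by
  obtain ⟨i, rfl⟩ : ∃ i, p = i + 1 := ⟨p - 1, by have := hp.pos; omega⟩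
  rw [Nat.add_sub_cancel]
  have h1 := mass_div_eulerProd_antitone K hpn
  simp only at h1
  rw [mass_succ, eulerProd_succ, mul_div_mul_left _ _ (eulerFactor_pos _).ne',
    div_le_div_iff₀ (eulerProd_pos _) (eulerProd_pos _)] at h1
  have h2 := eulerProd_succ_le i
  have h3 := log_le_two_mul_eulerProd (i + 1)
  have h4 := eulerProd_le_mul_log hn
  have h5 : 0 < Real.log n := Real.log_pos (by exact_mod_cast hn)
  set s := ∑ m ∈ survivors K i, (m : ℝ)⁻¹
  have hs : 0 ≤ s := sum_nonneg fun m _ => by positivity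
  have hm := mass_nonneg K n
  have h6 : mass K n * (3 / 16 * Real.log n) ≤ s * (15 * Real.log n) :=
    calc mass K n * (3 / 16 * Real.log n) ≤ mass K n * eulerProd i := by gcongr; linarith
      _ ≤ s * eulerProd n := h1
      _ ≤ _ := by gcongr
  have h7 : mass K n * (3 / 16) ≤ s * 15 := by
    refine le_of_mul_le_mul_right ?_ h5
    linarith
  linarith

lemma exists_mass_le {K : ℕ} (hK : 1 ≤ K) : ∃ C : ℝ, 1 ≤ C ∧ ∀ n, mass K n ≤ C := by
  obtain ⟨C₀, hC₀, hP⟩ := exists_sum_inv_primes_ge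
  set B := Real.log K + Real.log 4 with hB
  have hB0 : 0 ≤ B := add_nonneg (Real.log_natCast_nonneg K) (Real.log_nonneg (by norm_num))
  obtain ⟨N, hN⟩ := Filter.eventually_atTop.1
    ((eventually_le_log (8 * C₀)).and ((eventually_le_log (4 * B)).and
      (Filter.eventually_ge_atTop 2)))
  have main : ∀ n, N ≤ n → mass K n ≤ 38400 * B := by
    intro n hn
    obtain ⟨h1, h2, h3⟩ := hN n hn
    have hn0 : (0 : ℝ) < n := by positivity
    have hn1 : (1 : ℝ) ≤ n := by exact_mod_cast (by omega : 1 ≤ n)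
    have hlog : 0 < Real.log n := Real.log_pos (by exact_mod_cast h3)
    set a := ⌊(n : ℝ) ^ (3 / 4 : ℝ)⌋₊ with ha
    have ha1 : 1 ≤ a := Nat.le_floor (by simpa using Real.one_le_rpow hn1 (by norm_num))
    have han : a ≤ n := by
      have : (n : ℝ) ^ (3 / 4 : ℝ) ≤ n := by
        conv_rhs => rw [← Real.rpow_one (n : ℝ)]
        exact Real.rpow_le_rpow_of_exponent_le hn1 (by norm_num)
      exact (Nat.floor_le_floor this).trans (Nat.floor_natCast n).le
    have hloga : Real.log a ≤ 3 / 4 * Real.log n := by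
      rw [← Real.log_rpow hn0]
      exact Real.log_le_log (by exact_mod_cast ha1) (Nat.floor_le (by positivity))
    have hsum : 1 / 8 ≤ ∑ p ∈ Ioc a n with p.Prime, (p : ℝ)⁻¹ := by
      refine le_of_mul_le_mul_left ?_ hlog
      linarith [hP a n ha1 han]
    have hlogp : ∀ p ∈ Ioc a n, 3 / 4 * Real.log n ≤ Real.log p := fun p hp => by
      rw [← Real.log_rpow hn0]
      exact Real.log_le_log (by positivity) (Nat.lt_of_floor_lt (mem_Ioc.1 hp).1).le
    set t := (alive K n).filter fun m : ℕ => Real.log n / 4 ≤ Real.log m - logMean n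
    have ht : ∑ m ∈ t, (m : ℝ)⁻¹ ≤ 60 * B := by
      have h4 : Real.log n / 4 * ∑ m ∈ t, (m : ℝ)⁻¹ ≤ B * eulerProd n := by
        refine le_trans ?_ (drift_le hK n)
        rw [← hB, drift, mass, mul_sum, mul_sum, ← sum_add_distrib]
        calc ∑ m ∈ t, Real.log n / 4 * (m : ℝ)⁻¹
            ≤ ∑ m ∈ t, ((Real.log m - logMean n) * (m : ℝ)⁻¹ + B * (m : ℝ)⁻¹) := by
              refine sum_le_sum fun m hm => ?_
              rw [← add_mul]
              have := (mem_filter.1 hm).2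
              gcongr
              linarith
          _ ≤ _ := by
              refine sum_le_sum_of_subset_of_nonneg (filter_subset _ _) fun m hm _ => ?_
              rw [← add_mul]
              exact mul_nonneg (log_alive_ge hK hm) (by positivity)
      have h5 := eulerProd_le_mul_log h3
      have h6 : B * eulerProd n ≤ B * (15 * Real.log n) := by gcongr
      refine le_of_mul_le_mul_left ?_ hlog
      linarith
    have hinj : ∑ p ∈ Ioc a n with p.Prime, (p : ℝ)⁻¹ * ∑ m ∈ survivors K (p - 1), (m : ℝ)⁻¹ ≤
        ∑ m ∈ t, (m : ℝ)⁻¹ := by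
      have e : ∑ p ∈ Ioc a n with p.Prime, (p : ℝ)⁻¹ * ∑ m ∈ survivors K (p - 1), (m : ℝ)⁻¹ =
          ∑ x ∈ ((Ioc a n).filter Nat.Prime).sigma fun p => survivors K (p - 1),
            ((x.2 * x.1 : ℕ) : ℝ)⁻¹ := by
        rw [sum_sigma]
        refine sum_congr rfl fun p _ => ?_
        rw [mul_sum]
        refine sum_congr rfl fun m _ => ?_
        push_cast
        rw [mul_inv, mul_comm]
      rw [e]
      refine sum_comp_le_sum_of_injOn (f := fun k : ℕ => (k : ℝ)⁻¹)
        (fun x : (_ : ℕ) × ℕ => x.2 * x.1) ?_ ?_ fun _ _ => by positivity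
      · rintro ⟨p, m⟩ hx
        simp only [mem_sigma, mem_filter] at hx
        obtain ⟨⟨hpI, hp⟩, hm⟩ := hx
        have hlp := hlogp p hpI
        have hpn := (mem_Ioc.1 hpI).2
        obtain ⟨i, rfl⟩ : ∃ i, p = i + 1 := ⟨p - 1, by have := hp.pos; omega⟩
        rw [Nat.add_sub_cancel] at hm
        have hm' := mem_survivors.1 hm
        have hm0 : 0 < m := (alive_spec hm'.1).1.pos
        have hlm : Real.log (i + 1 : ℕ) ≤ Real.log K + Real.log m := by
          rw [← Real.log_mul (by positivity) (by positivity)]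
          exact Real.log_le_log (by positivity) (by exact_mod_cast hm'.2)
        have hlmp : Real.log (m * (i + 1) : ℕ) = Real.log m + Real.log (i + 1 : ℕ) := by
          rw [Nat.cast_mul, Real.log_mul (by positivity) (by positivity)]
        refine mem_filter.2 ⟨mem_alive_of_le (mul_mem_alive hm hp) hpn ?_, ?_⟩
        · have : Real.log n ≤ Real.log (K * (m * (i + 1)) : ℕ) := by
            rw [Nat.cast_mul, Real.log_mul (by positivity) (by positivity), hlmp]
            linarith
          rw [Real.log_le_log_iff (by positivity) (by positivity)] at this
          exact_mod_cast this
        · have hL := (logMean_le_mertensSum n).trans (mertensSum_le (by omega))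
          dsimp only
          rw [hlmp]
          linarith
      · rintro ⟨p, m⟩ hx ⟨p', m'⟩ hx' h
        simp only [coe_sigma, Set.mem_sigma_iff, mem_coe, mem_filter] at hx hx' h
        obtain ⟨h7, h8⟩ := eq_of_mul_prime_eq_mul_prime (alive_spec (mem_survivors.1 hx.2).1).1
          (alive_spec (mem_survivors.1 hx'.2).1).1 hx.1.2 hx'.1.2
          (Nat.sub_lt hx.1.2.pos one_pos) (Nat.sub_lt hx'.1.2.pos one_pos) h
        subst h7 h8
        rfl
    have hfin : 1 / 8 * mass K n ≤ 80 * (60 * B) := by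
      calc 1 / 8 * mass K n ≤ (∑ p ∈ Ioc a n with p.Prime, (p : ℝ)⁻¹) * mass K n := by
            have := mass_nonneg K n
            gcongr
        _ ≤ ∑ p ∈ Ioc a n with p.Prime,
            80 * ((p : ℝ)⁻¹ * ∑ m ∈ survivors K (p - 1), (m : ℝ)⁻¹) := by
            rw [sum_mul]
            refine sum_le_sum fun p hp => ?_
            rw [mem_filter] at hp
            rw [mul_left_comm]
            gcongr
            exact mass_le_mul_sum_survivors h3 hp.2 (mem_Ioc.1 hp.1).2 (hlogp p hp.1)
        _ ≤ _ := by
            rw [← mul_sum]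
            gcongr
            exact hinj.trans ht
    linarith
  refine ⟨1 + 38400 * B + eulerProd N, by have := eulerProd_pos N; linarith, fun n => ?_⟩
  have hW := eulerProd_pos N
  rcases le_total N n with h | h
  · linarith [main n h]
  · linarith [(mass_le_eulerProd K n).trans (eulerProd_mono h)]

lemma spread_le {K : ℕ} {C : ℝ} (hC : ∀ n, mass K n ≤ C) (n : ℕ) :
    spread K n ≤ 4 * C * eulerProd n * mertensSum n := by
  have hC0 : 0 ≤ C := (mass_nonneg K 0).trans (hC 0)
  induction n with
  | zero => simp [spread_zero]
  | succ n ih =>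
    refine (spread_succ K n).trans ?_
    rw [eulerProd_succ, mertensSum_succ, mul_left_comm (4 * C), mul_assoc]
    refine mul_le_mul_of_nonneg_left ?_ (eulerFactor_pos _).le
    simp only [add_mul, sum_add_distrib, ← mul_sum]
    have h1 : ∑ m ∈ survivors K n, (Real.log m - logMean n) ^ 2 * (m : ℝ)⁻¹ ≤ spread K n :=
      sum_survivors_le K n fun m _ => by positivity
    have h2 : ∑ m ∈ survivors K n, (m : ℝ)⁻¹ ≤ C :=
      (sum_survivors_le K n fun m _ => by positivity).trans (hC n)
    rw [mul_add]
    refine add_le_add (h1.trans ih) ?_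
    split_ifs with hp
    · have h3 := eulerProd_succ_le n
      have h4 := log_le_two_mul_eulerProd (n + 1)
      have h5 : 0 ≤ Real.log (n + 1 : ℕ) := Real.log_natCast_nonneg _
      generalize Real.log (n + 1 : ℕ) = l at *
      calc l ^ 2 / (n + 1 : ℕ) * ∑ m ∈ survivors K n, (m : ℝ)⁻¹
          ≤ l ^ 2 / (n + 1 : ℕ) * C := by gcongr
        _ = C * l * (l / (n + 1 : ℕ)) := by ring
        _ ≤ C * (4 * eulerProd n) * (l / (n + 1 : ℕ)) := by gcongr; linarith
        _ = _ := by ring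
    · simp

lemma exists_window : ∃ K : ℕ, 1 ≤ K ∧ ∃ η : ℝ, 0 < η ∧ ∃ u : ℕ, 1 ≤ u ∧ ∃ c : ℝ, 0 < c ∧
    ∀ᶠ n : ℕ in Filter.atTop, c ≤ ∑ m ∈ alive K n with
      (1 + η) * Real.log n ≤ Real.log (m : ℕ) ∧ Real.log (m : ℕ) ≤ u * Real.log n, (m : ℝ)⁻¹ := by
  obtain ⟨C₁, hC₁, hL⟩ := exists_le_logMean
  obtain ⟨K, hK⟩ := exists_nat_ge (Real.exp (C₁ + 1))
  have hK0 : (0 : ℝ) < K := (Real.exp_pos _).trans_le hK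
  have hK1 : 1 ≤ K := by exact_mod_cast hK0
  have hlogK : C₁ + 1 ≤ Real.log K := (Real.le_log_iff_exp_le hK0).2 hK
  obtain ⟨C, hC1, hC⟩ := exists_mass_le hK1
  obtain ⟨v, hv⟩ := exists_nat_ge (16 * (180 * C))
  have hv0 : (0 : ℝ) < v := by linarith
  refine ⟨K, hK1, 1 / (32 * C), by positivity, v + 3, by omega, 1 / (8 * (v + 3)), by positivity, ?_⟩
  filter_upwards [eventually_le_log (4 * C), eventually_le_log (32 * C * C₁),
    Filter.eventually_ge_atTop 2] with n h1 h2 h3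
  have hlog : 0 < Real.log n := by linarith
  set l := Real.log n with hl
  set L := logMean n with hLdef
  have hL1 : l - C₁ ≤ L := hL n (by omega)
  have hL2 : L ≤ 3 * l := (logMean_le_mertensSum n).trans (mertensSum_le_mul_log h3)
  have hL0 : 0 ≤ L := logMean_nonneg n
  have hdrift : l / 4 ≤ drift K n := by
    have := eulerProd_le_drift_add_mass hK1 (fun k hk => by linarith [hL k hk]) n
    linarith [hC n, log_le_two_mul_eulerProd n]
  have hspread : spread K n ≤ v / 16 * l * l :=
    calc spread K n ≤ 4 * C * eulerProd n * mertensSum n := spread_le hC n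
      _ ≤ 4 * C * (15 * l) * (3 * l) := by
        have := eulerProd_pos n
        have := hL0.trans (logMean_le_mertensSum n)
        gcongr
        · exact eulerProd_le_mul_log h3
        · exact mertensSum_le_mul_log h3
      _ = 180 * C * l * l := by ring
      _ ≤ _ := by gcongr; linarith
  set W := (alive K n).filter fun m : ℕ =>
    (1 + 1 / (32 * C)) * l ≤ Real.log m ∧ Real.log m ≤ (v + 3 : ℕ) * l with hW
  have hpt : drift K n ≤ (1 / (32 * C) * l + C₁) * mass K n + (v * l)⁻¹ * spread K n +
      (v + 3) * l * ∑ m ∈ W, (m : ℝ)⁻¹ := by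
    rw [drift, mass, spread, hW, sum_filter, mul_sum, mul_sum, mul_sum, ← sum_add_distrib,
      ← sum_add_distrib]
    refine sum_le_sum fun m _ => ?_
    have hm : (0 : ℝ) ≤ (m : ℝ)⁻¹ := by positivity
    have hsq : 0 ≤ (v * l)⁻¹ * (Real.log m - L) ^ 2 := by positivity
    have hη : 0 ≤ 1 / (32 * C) * l + C₁ := by positivity
    have : Real.log m - L ≤ (1 / (32 * C) * l + C₁) + (v * l)⁻¹ * (Real.log m - L) ^ 2 +
        (v + 3) * l * (if (1 + 1 / (32 * C)) * l ≤ Real.log m ∧ Real.log m ≤ (v + 3 : ℕ) * l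
          then 1 else 0) := by
      split_ifs with hif
      · have := hif.2
        push_cast at this
        linarith
      · rw [not_and_or, not_le, not_le] at hif
        rcases hif with hif | hif
        · linarith
        · push_cast at hif
          have h5 : v * l ≤ Real.log m - L := by linarith
          have h6 : Real.log m - L ≤ (v * l)⁻¹ * (Real.log m - L) ^ 2 := by
            rw [inv_mul_eq_div, le_div_iff₀ (by positivity), sq]
            gcongr
            exact (by positivity : 0 ≤ v * l).trans h5
          linarith
    calc (Real.log m - L) * (m : ℝ)⁻¹ ≤ _ := mul_le_mul_of_nonneg_right this hm
      _ = _ := by split_ifs <;> ring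
  have h4 : (1 / (32 * C) * l + C₁) * mass K n ≤ l / 16 := by
    calc (1 / (32 * C) * l + C₁) * mass K n ≤ (1 / (32 * C) * l + C₁) * C := by
          gcongr
          exact hC n
      _ = l / 32 + C * C₁ := by field_simp
      _ ≤ _ := by linarith
  have h5 : (v * l)⁻¹ * spread K n ≤ l / 16 := by
    calc (v * l)⁻¹ * spread K n ≤ (v * l)⁻¹ * (v / 16 * l * l) := by gcongr
      _ = _ := by field_simp
  rw [div_le_iff₀ (by positivity)]
  refine le_of_mul_le_mul_left ?_ hlog
  linarith

lemma exists_isDense_mul_primes {K y y' L U : ℕ} {G : Finset ℕ}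
    (hG : ∀ m ∈ G, IsDense K y m ∧ L ≤ m ∧ m ≤ U) (hy : y' ≤ K * L) :
    ∃ G' : Finset ℕ, (∀ m ∈ G', IsDense K y' m ∧ L * y ≤ m ∧ m ≤ U * y') ∧
      (∑ m ∈ G, (m : ℝ)⁻¹) * ∑ q ∈ Ioc y y' with q.Prime, (q : ℝ)⁻¹ ≤
        ∑ m ∈ G', (m : ℝ)⁻¹ := by
  refine ⟨(G ×ˢ {q ∈ Ioc y y' | q.Prime}).image fun x => x.1 * x.2, fun m hm => ?_, ?_⟩
  · simp only [mem_image, mem_product, mem_filter, mem_Ioc, Prod.exists] at hm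
    obtain ⟨g, q, ⟨hg, ⟨h1, h2⟩, hq⟩, rfl⟩ := hm
    obtain ⟨hd, hL, hU⟩ := hG g hg
    exact ⟨(hd.mul_prime hq h1 (h2.trans (hy.trans (by gcongr)))).mono h2,
      Nat.mul_le_mul hL h1.le, Nat.mul_le_mul hU h2⟩
  · rw [sum_mul_sum, ← sum_product']
    simp only [← mul_inv, ← Nat.cast_mul]
    refine sum_comp_le_sum_of_injOn (f := fun k : ℕ => (k : ℝ)⁻¹) (fun x : ℕ × ℕ => x.1 * x.2)
      (fun x hx => mem_image_of_mem _ hx) ?_ fun _ _ => by positivity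
    rintro ⟨a, q⟩ hx ⟨b, r⟩ hy h
    simp only [mem_coe, mem_product, mem_filter, mem_Ioc] at hx hy
    obtain ⟨h1, h2⟩ := eq_of_mul_prime_eq_mul_prime (hG a hx.1).1 (hG b hy.1).1 hx.2.2 hy.2.2
      hx.2.1.1 hy.2.1.1 h
    rw [h1, h2]

lemma eventually_le_sum_inv_primes_pow (N : ℕ) :
    ∀ᶠ t : ℕ in Filter.atTop, ∀ a < N,
      (2 * N : ℝ)⁻¹ ≤ ∑ q ∈ Ioc (t ^ a) (t ^ (a + 1)) with q.Prime, (q : ℝ)⁻¹ := by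
  obtain ⟨C, hC0, hC⟩ := exists_sum_inv_primes_ge
  filter_upwards [eventually_le_log (2 * C), eventually_le_log 1, Filter.eventually_ge_atTop 1]
    with t h1 h2 h3 a ha
  have h := hC (t ^ a) (t ^ (a + 1)) (Nat.one_le_pow _ _ h3) (Nat.pow_le_pow_right h3 (by omega))
  set S := ∑ q ∈ Ioc (t ^ a) (t ^ (a + 1)) with q.Prime, (q : ℝ)⁻¹
  have hS : 0 ≤ S := sum_nonneg fun _ _ => by positivity
  push_cast at h
  rw [Real.log_pow, Real.log_pow] at h
  push_cast at h
  have hN : (a : ℝ) + 1 ≤ N := by exact_mod_cast ha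
  have hN0 : (0 : ℝ) < N := by linarith [(Nat.cast_nonneg a : (0 : ℝ) ≤ a)]
  rw [inv_le_iff_one_le_mul₀ (by positivity)]
  have h4 : ((a : ℝ) + 1) * S ≤ N * S := by gcongr
  have h5 : Real.log t / 2 ≤ Real.log t * (N * S) := by
    nlinarith
  nlinarith

lemma exists_isDense_family {K M j u t : ℕ} {c : ℝ} {G : Finset ℕ} (hK : 1 ≤ K) (ht : 1 ≤ t)
    (hG : ∀ m ∈ G, IsDense K (t ^ M) m ∧ t ^ (M + j) ≤ m ∧ m ≤ t ^ (M * u))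
    (hc : c ≤ ∑ m ∈ G, (m : ℝ)⁻¹)
    (hp : ∀ a < M + j, (2 * (M + j : ℕ) : ℝ)⁻¹ ≤
      ∑ q ∈ Ioc (t ^ a) (t ^ (a + 1)) with q.Prime, (q : ℝ)⁻¹) (i : ℕ) (hi : i ≤ j) :
    ∃ G' : Finset ℕ, (∀ m ∈ G', IsDense K (t ^ (M + i)) m ∧ t ^ (M * i + (M + j)) ≤ m ∧
      m ≤ t ^ (M * u + i * (M + j))) ∧
      c * ((2 * (M + j : ℕ) : ℝ)⁻¹) ^ i ≤ ∑ m ∈ G', (m : ℝ)⁻¹ := by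
  induction i with
  | zero => exact ⟨G, by simpa using hG, by simpa using hc⟩
  | succ i ih =>
    obtain ⟨G', h1, h2⟩ := ih (by omega)
    obtain ⟨G'', h3, h4⟩ := exists_isDense_mul_primes (y' := t ^ (M + i + 1)) h1
      ((Nat.pow_le_pow_right ht (by omega : M + i + 1 ≤ M * i + (M + j))).trans
        (Nat.le_mul_of_pos_left _ hK))
    refine ⟨G'', fun m hm => ?_, ?_⟩
    · obtain ⟨h5, h6, h7⟩ := h3 m hm
      refine ⟨h5, le_trans ?_ h6, h7.trans ?_⟩
      · rw [← pow_add]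
        exact Nat.pow_le_pow_right ht (by rw [mul_add]; omega)
      · rw [← pow_add]
        exact Nat.pow_le_pow_right ht (by rw [add_mul]; omega)
    · refine le_trans ?_ h4
      rw [pow_succ, ← mul_assoc]
      have := hp (M + i) (by omega)
      gcongr

lemma eventually_le_card_primes :
    ∀ᶠ y : ℕ in Filter.atTop, ∀ a : ℕ, a ^ 2 ≤ y →
      (y : ℝ) / (4 * Real.log y) ≤ #{q ∈ Ioc a y | q.Prime} := by
  have h0 := (isLittleO_log_rpow_atTop (r := 1 / 2) (by norm_num)).def
    (show (0 : ℝ) < 1 / 16 by norm_num)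
  filter_upwards [tendsto_natCast_atTop_atTop.eventually h0, Filter.eventually_ge_atTop 2]
    with y h1 h2 a ha
  rw [← Real.sqrt_eq_rpow] at h1
  have hy : (2 : ℝ) ≤ y := by exact_mod_cast h2
  have hl : 0 < Real.log y := Real.log_pos (by linarith)
  rw [Real.norm_of_nonneg hl.le, Real.norm_of_nonneg (Real.sqrt_nonneg _)] at h1
  have hs := Real.sq_sqrt (show (0 : ℝ) ≤ y by linarith)
  have ha' : (a : ℝ) ≤ √y := Real.le_sqrt_of_sq_le (by exact_mod_cast ha)
  have h3 : Real.log (y + 1) ≤ 2 * Real.log y := by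
    rw [← Nat.cast_two (R := ℝ), ← Real.log_pow]
    exact Real.log_le_log (by linarith) (by nlinarith)
  have h4 := Chebyshev.pi_ge y
  have h5 : y.primeCounting ≤ a + #{q ∈ Ioc a y | q.Prime} := by
    rw [Nat.primeCounting, Nat.primeCounting', Nat.count_eq_card_filter_range]
    calc _ ≤ #(Icc 1 a ∪ {q ∈ Ioc a y | q.Prime}) := by
          refine card_le_card fun q hq => ?_
          simp only [mem_filter, mem_range, mem_union, mem_Icc, mem_Ioc] at hq ⊢
          have := hq.2.pos
          by_cases h : q ≤ a
          · exact Or.inl ⟨this, h⟩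
          · exact Or.inr ⟨⟨by omega, by omega⟩, hq.2⟩
      _ ≤ _ := by simpa using card_union_le (Icc 1 a) {q ∈ Ioc a y | q.Prime}
  have h5' : (y.primeCounting : ℝ) ≤ a + #{q ∈ Ioc a y | q.Prime} := by exact_mod_cast h5
  rw [div_le_iff₀ hl] at h4
  rw [div_le_iff₀ (by positivity)]
  have h6 : (y.primeCounting : ℝ) * Real.log y ≤
      (√y + #{q ∈ Ioc a y | q.Prime}) * Real.log y := by gcongr; linarith
  have h7 : √y * Real.log y ≤ y / 16 := by nlinarith [Real.sqrt_nonneg (y : ℝ)]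
  have h8 : 1 ≤ √(y : ℝ) := Real.one_le_sqrt.2 (by linarith)
  nlinarith [Real.log_two_gt_d9]

lemma IsDense.Fdiv_le {K n m X : ℕ} (h : IsDense K n m) (h1 : m ≠ 1) (hX : K * m ≤ X) :
    Fdiv m ≤ X := by
  rw [Fdiv, if_neg h1, Finset.sup_le_iff]
  intro d hd
  rw [mem_filter, Nat.mem_divisors] at hd
  exact (h.mul_minFac_le d hd.1.1 hd.2).trans hX

lemma exists_sublevel_family {K A X Y₀ : ℕ} {G : Finset ℕ} (hK : 1 ≤ K) (hA : 2 ≤ A)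
    (hY₀ : ∀ y ≥ Y₀, ∀ a : ℕ, a ^ 2 ≤ y →
      (y : ℝ) / (4 * Real.log y) ≤ #{q ∈ Ioc a y | q.Prime}) (hYA : Y₀ ≤ A)
    (hG : ∀ m ∈ G, IsDense K A m ∧ X ≤ m ^ 2 ∧ A ^ 2 * (K * m) ≤ X) :
    ∃ S : Finset ℕ, (∀ m ∈ S, 0 < m ∧ Squarefree m ∧ Fdiv m ≤ X) ∧
      X / (8 * K * Real.log X) * ∑ m ∈ G, (m : ℝ)⁻¹ ≤ #S := by
  set P : ℕ → Finset ℕ := fun g => {q ∈ Ioc A (X / (K * g)) | q.Prime} with hP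
  refine ⟨(G.sigma P).image fun x => x.1 * x.2, fun m hm => ?_, ?_⟩
  · simp only [mem_image, mem_sigma, Sigma.exists, hP, mem_filter, mem_Ioc] at hm
    obtain ⟨g, q, ⟨hg, ⟨h1, h2⟩, hq⟩, rfl⟩ := hm
    obtain ⟨hd, hX, -⟩ := hG g hg
    have hg0 := hd.pos
    rw [Nat.le_div_iff_mul_le (by positivity)] at h2
    have h3 : q ≤ K * g := by
      have : q * g ≤ g * g := by
        calc q * g ≤ q * (K * g) := by gcongr; exact Nat.le_mul_of_pos_left _ hK
          _ ≤ X := h2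
          _ ≤ g * g := by rw [← sq]; exact hX
      exact (Nat.le_of_mul_le_mul_right this hg0).trans (Nat.le_mul_of_pos_left _ hK)
    have hd' := hd.mul_prime hq h1 h3
    refine ⟨hd'.pos, hd'.squarefree, hd'.Fdiv_le ?_ (by linarith)⟩
    exact fun h => hq.ne_one (mul_eq_one.1 h).2
  · rw [card_image_of_injOn, card_sigma, mul_sum, Nat.cast_sum]
    · refine sum_le_sum fun g hg => ?_
      obtain ⟨hd, -, hA'⟩ := hG g hg
      have hg0 := hd.pos
      set Y := X / (K * g) with hY
      have h1 : A ^ 2 ≤ Y := (Nat.le_div_iff_mul_le (by positivity)).2 hA'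
      have hAA : A ≤ A ^ 2 := Nat.le_self_pow two_ne_zero A
      refine le_trans ?_ (hY₀ Y (by omega) A h1)
      have hY2 : 2 ≤ Y := by omega
      have hYX : Y ≤ X := Nat.div_le_self _ _
      have h2 : X ≤ 2 * (K * g) * Y := by
        have := Nat.lt_mul_div_succ X (show 0 < K * g by positivity)
        rw [← hY] at this
        nlinarith
      have h2' : (X : ℝ) ≤ 2 * (K * g) * Y := by exact_mod_cast h2
      have hYr : (2 : ℝ) ≤ Y := by exact_mod_cast hY2
      have hl : 0 < Real.log Y := Real.log_pos (by linarith)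
      have hll : Real.log Y ≤ Real.log X :=
        Real.log_le_log (by linarith) (by exact_mod_cast hYX)
      have hKr : (0 : ℝ) < K := by exact_mod_cast hK
      have hgr : (0 : ℝ) < g := by exact_mod_cast hg0
      calc (X : ℝ) / (8 * K * Real.log X) * (g : ℝ)⁻¹
          ≤ 2 * (K * g) * Y / (8 * K * Real.log Y) * (g : ℝ)⁻¹ := by gcongr
        _ = Y / (4 * Real.log Y) := by field_simp; ring
    · rintro ⟨a, q⟩ hx ⟨b, r⟩ hy h
      simp only [mem_coe, mem_sigma, hP, mem_filter, mem_Ioc] at hx hy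
      obtain ⟨h1, h2⟩ := eq_of_mul_prime_eq_mul_prime (hG a hx.1).1 (hG b hy.1).1 hx.2.2 hy.2.2
        hx.2.1.1 hy.2.1.1 h
      rw [h1, h2]

lemma exists_pow_bracket {D T X : ℕ} (hD : 1 ≤ D) (hT : 2 ^ D ≤ T) (hX : T ^ D ≤ X) :
    ∃ t, T < t ∧ X ≤ t ^ D ∧ t ^ (D - 1) ≤ X := by
  have hex : ∃ t : ℕ, X < t ^ D :=
    ⟨X + 1, (Nat.lt_succ_self X).trans_le (Nat.le_self_pow (by omega) _)⟩
  classical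
  obtain ⟨t, ht, hmin⟩ : ∃ t, X < t ^ D ∧ ∀ s < t, s ^ D ≤ X :=
    ⟨Nat.find hex, Nat.find_spec hex, fun s hs => not_lt.1 (Nat.find_min hex hs)⟩
  have hTt : T < t := lt_of_pow_lt_pow_left₀ D (Nat.zero_le _) (hX.trans_lt ht)
  refine ⟨t, hTt, ht.le, le_trans ?_ (hmin (t - 1) (by omega))⟩
  obtain ⟨s, rfl⟩ : ∃ s, t = s + 1 := ⟨t - 1, by omega⟩
  obtain ⟨E, rfl⟩ : ∃ E, D = E + 1 := ⟨D - 1, by omega⟩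
  simp only [Nat.add_sub_cancel]
  have h2 : 2 ^ E ≤ 2 ^ (E + 1) := Nat.pow_le_pow_right (by norm_num) (by omega)
  have h3 : 1 ≤ 2 ^ E := Nat.one_le_two_pow
  calc (s + 1) ^ E ≤ (2 * s) ^ E := Nat.pow_le_pow_left (by omega) _
    _ = 2 ^ E * s ^ E := mul_pow _ _ _
    _ ≤ s * s ^ E := by gcongr; omega
    _ = s ^ (E + 1) := by ring

lemma eventually_exists_sublevel_family : ∃ c : ℝ, 0 < c ∧ ∀ᶠ X : ℕ in Filter.atTop,
    ∃ S : Finset ℕ, (∀ m ∈ S, 0 < m ∧ Squarefree m ∧ Fdiv m ≤ X) ∧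
      c * (X / Real.log X) ≤ #S := by
  obtain ⟨K, hK, η, hη, u, hu, c, hc, hev⟩ := exists_window
  obtain ⟨M₀, hM₀⟩ := exists_nat_ge ((u + 4 : ℕ) / η : ℝ)
  obtain ⟨j, hj⟩ : ∃ j, j = u + 4 := ⟨_, rfl⟩
  rw [← hj] at hM₀
  obtain ⟨M, hM⟩ : ∃ M, M = M₀ + j ^ 2 + 2 * j := ⟨_, rfl⟩
  have hMη : (j : ℝ) ≤ η * M := by
    rw [div_le_iff₀ hη] at hM₀
    have : (M₀ : ℝ) ≤ M := by exact_mod_cast (by omega)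
    nlinarith
  have hM1 : 1 ≤ M := by omega
  obtain ⟨Y₀, hY₀⟩ := Filter.eventually_atTop.1 eventually_le_card_primes
  have hev' := (Filter.tendsto_pow_atTop (α := ℕ) (show M ≠ 0 by omega)).eventually hev
  obtain ⟨T₀, hT₀⟩ := Filter.eventually_atTop.1
    (hev'.and (eventually_le_sum_inv_primes_pow (M + j)))
  obtain ⟨D, hD⟩ : ∃ D, D = 2 * M * j := ⟨_, rfl⟩
  have hD1 : 1 ≤ D := hD ▸ Nat.mul_pos (by omega) (by omega)
  have h2D : 0 < 2 ^ D := by positivity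
  obtain ⟨T, hT⟩ : ∃ T, T = T₀ + Y₀ + K + 2 ^ D + 2 := ⟨_, rfl⟩
  refine ⟨c * ((2 * (M + j : ℕ) : ℝ)⁻¹) ^ j / (8 * K), by positivity, ?_⟩
  filter_upwards [Filter.eventually_ge_atTop (T ^ D)] with X hX
  obtain ⟨t, hTt, hXt, htX⟩ := exists_pow_bracket hD1 (by omega) hX
  obtain ⟨hwin, hpr⟩ := hT₀ t (by omega)
  have ht1 : 1 < t := by omega
  have hlt : 0 < Real.log t := Real.log_pos (by exact_mod_cast ht1)
  have hwin' : ∀ m ∈ {m ∈ alive K (t ^ M) | (1 + η) * Real.log (t ^ M : ℕ) ≤ Real.log (m : ℕ) ∧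
      Real.log (m : ℕ) ≤ u * Real.log (t ^ M : ℕ)},
      IsDense K (t ^ M) m ∧ t ^ (M + j) ≤ m ∧ m ≤ t ^ (M * u) := by
    intro m hm
    obtain ⟨hm1, hm2, hm3⟩ := mem_filter.1 hm
    have hd := (alive_spec hm1).1
    have hm0 : (0 : ℝ) < m := by exact_mod_cast hd.pos
    push_cast at hm2 hm3
    rw [Real.log_pow] at hm2 hm3
    refine ⟨hd, ?_, ?_⟩
    · have : (t : ℝ) ^ (M + j) ≤ m := by
        rw [← Real.log_le_log_iff (by positivity) hm0, Real.log_pow]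
        push_cast
        nlinarith
      exact_mod_cast this
    · have : (m : ℝ) ≤ t ^ (M * u) := by
        rw [← Real.log_le_log_iff hm0 (by positivity), Real.log_pow]
        push_cast
        linarith
      exact_mod_cast this
  obtain ⟨G, hG, hGc⟩ := exists_isDense_family hK ht1.le hwin' hwin hpr j le_rfl
  have hG' : ∀ m ∈ G, IsDense K (t ^ (M + j)) m ∧ X ≤ m ^ 2 ∧
      (t ^ (M + j)) ^ 2 * (K * m) ≤ X := by
    intro m hm
    obtain ⟨h1, h2, h3⟩ := hG m hm
    refine ⟨h1, ?_, ?_⟩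
    · calc X ≤ t ^ D := hXt
        _ = (t ^ (M * j)) ^ 2 := by rw [← pow_mul, hD]; ring
        _ ≤ m ^ 2 := by
          gcongr
          exact (Nat.pow_le_pow_right ht1.le (by omega)).trans h2
    · refine le_trans ?_ htX
      calc (t ^ (M + j)) ^ 2 * (K * m)
          ≤ (t ^ (M + j)) ^ 2 * (t * t ^ (M * u + j * (M + j))) := by
            gcongr
            omega
        _ = t ^ ((M + j) * 2 + (M * u + j * (M + j) + 1)) := by ring
        _ ≤ t ^ (D - 1) := by
          refine Nat.pow_le_pow_right ht1.le (Nat.le_sub_of_add_le ?_)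
          have : M * j = M * u + 4 * M := by rw [hj]; ring
          nlinarith
  obtain ⟨S, hS, hcard⟩ := exists_sublevel_family hK
    (ht1.trans_le (Nat.le_self_pow (by omega) t)) hY₀
    ((by omega : Y₀ ≤ t).trans (Nat.le_self_pow (by omega) t)) hG'
  refine ⟨S, hS, le_trans ?_ hcard⟩
  calc _ = (X : ℝ) / (8 * K * Real.log X) * (c * ((2 * (M + j : ℕ) : ℝ)⁻¹) ^ j) := by ring
    _ ≤ _ := by
      have : 0 ≤ Real.log X := Real.log_natCast_nonneg X
      gcongr

end DenseChain

theorem chain_length_lower_bound :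
    ∃ c : ℝ, 0 < c ∧ ∀ p : ℕ, p.Prime → 3 ≤ p →
      ∀ C : List ℕ,
        C.Nodup →
        C.Chain' (fun a b => a ∣ b ∨ b ∣ a) →
        (∀ m ∈ C, 0 < m ∧ Squarefree m ∧ m ≤ 2 * p ^ 2 ∧ Pplus m ≤ p) →
        (∀ m : ℕ, 0 < m → Squarefree m → Fdiv m ≤ p ^ 2 → m ∈ C) →
        c * (p : ℝ) ^ 2 / Real.log p ≤ (C.length : ℝ) := by
  obtain ⟨c, hc, hev⟩ := DenseChain.eventually_exists_sublevel_family
  obtain ⟨X₀, hX₀⟩ := Filter.eventually_atTop.1 hev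
  refine ⟨min (c / 2) (1 / (X₀ + 1)), by positivity, fun p hp hp3 C _ _ _ hC => ?_⟩
  have hp3' : (3 : ℝ) ≤ p := by exact_mod_cast hp3
  have hlog : 1 ≤ Real.log p := by
    rw [Real.le_log_iff_exp_le (by linarith)]
    linarith [Real.exp_one_lt_d9]
  rw [div_le_iff₀ (by linarith)]
  by_cases h : X₀ ≤ p ^ 2
  · obtain ⟨S, hS, hcard⟩ := hX₀ _ h
    have h1 : S.card ≤ C.length :=
      (Finset.card_le_card fun m hm => List.mem_toFinset.2
        (hC m (hS m hm).1 (hS m hm).2.1 (hS m hm).2.2)).trans (List.toFinset_card_le C)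
    have h1' : (S.card : ℝ) ≤ C.length := by exact_mod_cast h1
    push_cast at hcard
    rw [Real.log_pow, ← mul_div_assoc, div_le_iff₀ (by push_cast; linarith)] at hcard
    push_cast at hcard
    have h2 : min (c / 2) (1 / ((X₀ : ℝ) + 1)) * p ^ 2 ≤ c / 2 * p ^ 2 := by
      gcongr
      exact min_le_left _ _
    have h3 : (S.card : ℝ) * Real.log p ≤ C.length * Real.log p := by gcongr
    linarith
  · have h1 : 1 ≤ C.length := List.length_pos_of_mem
      (hC 1 one_pos squarefree_one (by rw [Fdiv, if_pos rfl]; nlinarith))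
    have h1' : (1 : ℝ) ≤ C.length := by exact_mod_cast h1
    have h2 : ((p : ℝ)) ^ 2 ≤ X₀ + 1 := by
      have : p ^ 2 ≤ X₀ + 1 := by omega
      exact_mod_cast this
    calc min (c / 2) (1 / ((X₀ : ℝ) + 1)) * p ^ 2 ≤ 1 / (X₀ + 1) * (X₀ + 1) := by
          gcongr
          exact min_le_right _ _
      _ = 1 := by field_simp
      _ ≤ C.length * Real.log p := by nlinarith
end
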